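/- arXiv:1804.09566 — 9 statements merged into one kernel-verified Lean document; each statement's English description precedes it below -/
import Mathlib

section
/- Let K be a field of characteristic zero, let n ≥ 1, and let L be the free Lie algebra over K on two generators x and y. Then ⁅ad_x^{2n}(y), y⁆ + ⁅x, Σ_{i=0}^{n−1} (−1)^i ⁅ad_x^i(y), ad_x^{2n−1−i}(y)⁆⁆ = 0. Equivalently, the unique derivation δ_{2n} of L determined by δ_{2n}(x) = ad_x^{2n}(y) and δ_{2n}(y) = Σ_{i=0}^{n−1} (−1)^i ⁅ad_x^i(y), ad_x^{2n−1−i}(y)⁆ annihilates the element ⁅x,y⁆. -/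
/-- Bracketing `x` with the alternating sum of `⁅ad_x^i(y), ad_x^{m−1−i}(y)⁆` telescopes. -/
theorem lie_sum_alternating_ad_pow {R L : Type*} [CommRing R] [LieRing L] [LieAlgebra R L]
    (x y : L) (m k : ℕ) (hk : k ≤ m) :
    ⁅x, ∑ i ∈ Finset.range k,
        ((-1 : R) ^ i) • ⁅(LieAlgebra.ad R L x ^ i) y, (LieAlgebra.ad R L x ^ (m - 1 - i)) y⁆⁆ =
      ⁅y, (LieAlgebra.ad R L x ^ m) y⁆ -
        ((-1 : R) ^ k) • ⁅(LieAlgebra.ad R L x ^ k) y, (LieAlgebra.ad R L x ^ (m - k)) y⁆ := by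
  induction k with
  | zero => simp
  | succ k ih =>
    have hsucc (j : ℕ) : ⁅x, (LieAlgebra.ad R L x ^ j) y⁆ = (LieAlgebra.ad R L x ^ (j + 1)) y := by
      rw [pow_succ', Module.End.mul_apply, LieAlgebra.ad_apply]
    have h₁ : m - 1 - k + 1 = m - k := by omega
    have h₂ : m - (k + 1) = m - 1 - k := by omega
    rw [Finset.sum_range_succ, lie_add, ih (by omega), lie_smul, leibniz_lie, hsucc, hsucc, h₁, h₂,
      pow_succ (-1 : R) k]
    module


/-- Let `K` be a field of characteristic zero, `n ≥ 1`, and `L` the free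
Lie algebra over `K` on two generators `x`, `y`.  Then
`⁅ad_x^{2n}(y), y⁆ + ⁅x, Σ_{i=0}^{n−1} (−1)^i ⁅ad_x^i(y), ad_x^{2n−1−i}(y)⁆⁆ = 0`,
i.e. the symplectic derivation `δ_{2n}` determined by these values on generators
annihilates `⁅x,y⁆`. -/
theorem stmt_0 (K : Type*) [Field K] [CharZero K] (n : ℕ) (hn : 1 ≤ n) :
    let L := FreeLieAlgebra K (Fin 2)
    let x : L := FreeLieAlgebra.of K 0
    let y : L := FreeLieAlgebra.of K 1
    let adx : Module.End K L := LieAlgebra.ad K L x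
    ⁅(adx ^ (2 * n)) y, y⁆ +
      ⁅x, ∑ i ∈ Finset.range n,
          ((-1 : K) ^ i) • ⁅(adx ^ i) y, (adx ^ (2 * n - 1 - i)) y⁆⁆ = 0 := by
  intro L x y adx
  rw [lie_sum_alternating_ad_pow x y (2 * n) n (by omega), show 2 * n - n = n by omega, lie_self,
    smul_zero, sub_zero, ← lie_skew y]
  exact add_neg_cancel _
end

section
/- Let K be a field of characteristic zero, let n ≥ 1, and let A be the free associative unital K-algebra on two generators x and y. Set a = ad_x^{2n}(y) and b = Σ_{i=0}^{n−1} (−1)^i [ad_x^i(y), ad_x^{2n−1−i}(y)], where [p,q] = pq − qp and ad_x(p) = [x,p]. Then the image of ∂_x(a) + ∂_y(b) under the map (|·|⊗|·|) : A⊗A → |A|⊗|A| is zero. (This says that the tangential divergence tDiv(δ_{2n}) of the symplectic derivation δ_{2n} vanishes, which together with δ_{2n}([x,y]) = 0 shows that δ_{2n} lies in the Kashiwara–Vergne Lie algebra 𝔨𝔯𝔳^{(1,1)}.) -/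
open TensorProduct

/-- `[A,A]`: the `K`-linear span of all commutators `p*q - q*p` in `A`. -/
def commutatorSpan (K A : Type*) [CommRing K] [Ring A] [Algebra K A] : Submodule K A :=
  Submodule.span K {a : A | ∃ p q : A, a = p * q - q * p}

/-- The map `A ⊗ A → |A| ⊗ |A|` is a trace on the algebra `A ⊗ A`. -/
theorem map_mkQ_mul_comm {K A : Type*} [CommRing K] [Ring A] [Algebra K A] (z w : A ⊗[K] A) :
    TensorProduct.map (commutatorSpan K A).mkQ (commutatorSpan K A).mkQ (z * w) =
      TensorProduct.map (commutatorSpan K A).mkQ (commutatorSpan K A).mkQ (w * z) := by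
  have mkQ_mul_comm (p q : A) :
      (commutatorSpan K A).mkQ (p * q) = (commutatorSpan K A).mkQ (q * p) := by
    rw [← sub_eq_zero, ← map_sub]
    exact (Submodule.Quotient.mk_eq_zero _).2 (Submodule.subset_span ⟨p, q, rfl⟩)
  induction z with
  | zero => simp
  | add z₁ z₂ h₁ h₂ => simp only [add_mul, mul_add, map_add, h₁, h₂]
  | tmul p q =>
    induction w with
    | zero => simp
    | add w₁ w₂ h₁ h₂ => simp only [add_mul, mul_add, map_add, h₁, h₂]
    | tmul r s =>
      simp only [Algebra.TensorProduct.tmul_mul_tmul, TensorProduct.map_tmul,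
        mkQ_mul_comm p r, mkQ_mul_comm q s]

section OuterAd

variable (K : Type*) {A : Type*} [CommRing K] [Ring A] [Algebra K A]

/-- The adjoint action `z ↦ x z - z x` for the outer `A`-bimodule structure on `A ⊗ A`. -/
def outerAd (x : A) : Module.End K (A ⊗[K] A) :=
  LinearMap.mulLeft K (x ⊗ₜ[K] (1 : A)) - LinearMap.mulRight K ((1 : A) ⊗ₜ[K] x)

theorem outerAd_apply (x : A) (z : A ⊗[K] A) :
    outerAd K x z = (x ⊗ₜ[K] 1) * z - z * (1 ⊗ₜ[K] x) := rfl

variable {K}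

theorem commute_tmul_one_one_tmul (p q : A) : Commute (p ⊗ₜ[K] (1 : A)) ((1 : A) ⊗ₜ[K] q) := by
  simp [Commute, SemiconjBy]

theorem outerAd_pow_one_tmul (x u : A) (k : ℕ) :
    (outerAd K x ^ k) (1 ⊗ₜ[K] u) = (1 ⊗ₜ[K] u) * (outerAd K x ^ k) 1 := by
  induction k with
  | zero => simp
  | succ k ih =>
    rw [pow_succ', Module.End.mul_apply, Module.End.mul_apply, ih, outerAd_apply, outerAd_apply,
      mul_sub, ← mul_assoc, ← mul_assoc, ← mul_assoc, (commute_tmul_one_one_tmul x u).eq]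

theorem outerAd_pow_tmul_one (x u : A) (k : ℕ) :
    (outerAd K x ^ k) (u ⊗ₜ[K] 1) = (outerAd K x ^ k) 1 * (u ⊗ₜ[K] 1) := by
  induction k with
  | zero => simp
  | succ k ih =>
    rw [pow_succ', Module.End.mul_apply, Module.End.mul_apply, ih, outerAd_apply, outerAd_apply,
      sub_mul, mul_assoc, mul_assoc, mul_assoc, (commute_tmul_one_one_tmul u x).eq]

theorem commute_outerAd_pow_one {x : A} {c : A ⊗[K] A} (hl : Commute c (x ⊗ₜ[K] 1))
    (hr : Commute c (1 ⊗ₜ[K] x)) (k : ℕ) : Commute c ((outerAd K x ^ k) 1) := by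
  induction k with
  | zero => simp
  | succ k ih =>
    rw [pow_succ', Module.End.mul_apply, outerAd_apply]
    exact (hl.mul_right ih).sub_right (ih.mul_right hr)

theorem map_mkQ_commutator_mul {c P : A ⊗[K] A} (h : Commute c P) (v : A ⊗[K] A) :
    TensorProduct.map (commutatorSpan K A).mkQ (commutatorSpan K A).mkQ
      ((c * v - v * c) * P) = 0 := by
  rw [sub_mul, map_sub, mul_assoc, map_mkQ_mul_comm c, mul_assoc, mul_assoc, h.eq, sub_self]

theorem map_mkQ_outerAd_pow_one_tmul_commutator (x v : A) (k : ℕ) :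
    TensorProduct.map (commutatorSpan K A).mkQ (commutatorSpan K A).mkQ
      ((outerAd K x ^ k) (1 ⊗ₜ[K] (x * v - v * x))) = 0 := by
  have h : Commute ((1 : A) ⊗ₜ[K] x) ((outerAd K x ^ k) 1) :=
    commute_outerAd_pow_one (commute_tmul_one_one_tmul x x).symm (Commute.refl _) k
  rw [outerAd_pow_one_tmul]
  simpa [TensorProduct.tmul_sub] using map_mkQ_commutator_mul h (1 ⊗ₜ[K] v)

theorem map_mkQ_outerAd_pow_commutator_tmul_one (x v : A) (k : ℕ) :
    TensorProduct.map (commutatorSpan K A).mkQ (commutatorSpan K A).mkQ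
      ((outerAd K x ^ k) ((x * v - v * x) ⊗ₜ[K] 1)) = 0 := by
  have h : Commute (x ⊗ₜ[K] (1 : A)) ((outerAd K x ^ k) 1) :=
    commute_outerAd_pow_one (Commute.refl _) (commute_tmul_one_one_tmul x x) k
  rw [outerAd_pow_tmul_one, map_mkQ_mul_comm]
  simpa [TensorProduct.sub_tmul] using map_mkQ_commutator_mul h (v ⊗ₜ[K] 1)

theorem apply_iterate_commutator_eq_outerAd_pow {x y : A} {D : A →ₗ[K] A ⊗[K] A}
    (hDx : D x = 0) (hDy : D y = 1 ⊗ₜ[K] 1)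
    (hD : ∀ p q : A, D (p * q) = D p * (1 ⊗ₜ[K] q) + (p ⊗ₜ[K] 1) * D q) (k : ℕ) :
    D ((fun p => x * p - p * x)^[k] y) = (outerAd K x ^ k) 1 := by
  induction k with
  | zero => simpa [Algebra.TensorProduct.one_def] using hDy
  | succ k ih =>
    rw [Function.iterate_succ_apply', pow_succ', Module.End.mul_apply, outerAd_apply, ← ih]
    simp [hD, hDx]

theorem map_mkQ_outerAd_pow_apply_iterate_commutator {x y : A} {D : A →ₗ[K] A ⊗[K] A}
    (hDx : D x = 1 ⊗ₜ[K] 1) (hDy : D y = 0)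
    (hD : ∀ p q : A, D (p * q) = D p * (1 ⊗ₜ[K] q) + (p ⊗ₜ[K] 1) * D q) (m k : ℕ) :
    TensorProduct.map (commutatorSpan K A).mkQ (commutatorSpan K A).mkQ
        ((outerAd K x ^ k) (D ((fun p => x * p - p * x)^[m + 1] y))) =
      TensorProduct.map (commutatorSpan K A).mkQ (commutatorSpan K A).mkQ
        ((outerAd K x ^ (k + m)) (1 ⊗ₜ[K] y - y ⊗ₜ[K] 1)) := by
  have hstep (u : A) :
      D (x * u - u * x) = outerAd K x (D u) + (1 ⊗ₜ[K] u - u ⊗ₜ[K] 1) := by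
    rw [map_sub, hD, hD, hDx, outerAd_apply, ← Algebra.TensorProduct.one_def, one_mul, mul_one]
    abel
  induction m generalizing k with
  | zero => simp [hstep, hDy]
  | succ m ih =>
    rw [Function.iterate_succ_apply', hstep, map_add, map_add, ← Module.End.mul_apply, ← pow_succ,
      ih, Function.iterate_succ_apply', map_sub (outerAd K x ^ k) (1 ⊗ₜ[K] (_ - _)),
      map_sub (TensorProduct.map _ _) ((outerAd K x ^ k) (1 ⊗ₜ[K] (_ - _))),
      map_mkQ_outerAd_pow_one_tmul_commutator, map_mkQ_outerAd_pow_commutator_tmul_one,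
      sub_zero, add_zero, add_right_comm, add_assoc]

end OuterAd

/-- Let `A` be the free associative unital `K`-algebra on `x`, `y`
(`K` a field of characteristic zero, `n ≥ 1`).  Set `a = ad_x^{2n}(y)` and
`b = Σ_{i=0}^{n-1} (-1)^i [ad_x^i(y), ad_x^{2n-1-i}(y)]`.  If `∂_x`, `∂_y` are the
double derivations of `A` (characterized by their values on generators and the
Leibniz rule), then the image of `∂_x(a) + ∂_y(b)` in `|A| ⊗ |A|` vanishes:
`tDiv(δ_{2n}) = 0`. -/
theorem stmt_1 (K : Type*) [Field K] [CharZero K] (n : ℕ) (hn : 1 ≤ n)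
    (x y : FreeAlgebra K (Fin 2))
    (hx : x = FreeAlgebra.ι K (0 : Fin 2)) (hy : y = FreeAlgebra.ι K (1 : Fin 2))
    (Dx Dy : FreeAlgebra K (Fin 2) →ₗ[K] (FreeAlgebra K (Fin 2) ⊗[K] FreeAlgebra K (Fin 2)))
    (hDxx : Dx x = 1 ⊗ₜ[K] 1) (hDxy : Dx y = 0)
    (hDyy : Dy y = 1 ⊗ₜ[K] 1) (hDyx : Dy x = 0)
    (hDxL : ∀ p q : FreeAlgebra K (Fin 2),
      Dx (p * q) = Dx p * (1 ⊗ₜ[K] q) + (p ⊗ₜ[K] 1) * Dx q)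
    (hDyL : ∀ p q : FreeAlgebra K (Fin 2),
      Dy (p * q) = Dy p * (1 ⊗ₜ[K] q) + (p ⊗ₜ[K] 1) * Dy q)
    (a b : FreeAlgebra K (Fin 2))
    (ha : a = (fun p => x * p - p * x)^[2 * n] y)
    (hb : b = ∑ i ∈ Finset.range n, ((-1 : K) ^ i) •
        ((fun p => x * p - p * x)^[i] y * (fun p => x * p - p * x)^[2 * n - 1 - i] y
          - (fun p => x * p - p * x)^[2 * n - 1 - i] y * (fun p => x * p - p * x)^[i] y)) :
    TensorProduct.map (commutatorSpan K (FreeAlgebra K (Fin 2))).mkQ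
        (commutatorSpan K (FreeAlgebra K (Fin 2))).mkQ
      (Dx a + Dy b) = 0 := by
  obtain ⟨m, rfl⟩ : ∃ m, n = m + 1 := ⟨n - 1, by omega⟩
  have hDyu := apply_iterate_commutator_eq_outerAd_pow hDyx hDyy hDyL
  have hl (j k : ℕ) : TensorProduct.map (commutatorSpan K (FreeAlgebra K (Fin 2))).mkQ
      (commutatorSpan K (FreeAlgebra K (Fin 2))).mkQ
      ((outerAd K x ^ k) 1 * (1 ⊗ₜ[K] (fun p => x * p - p * x)^[j + 1] y)) = 0 := by
    rw [map_mkQ_mul_comm, ← outerAd_pow_one_tmul, Function.iterate_succ_apply',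
      map_mkQ_outerAd_pow_one_tmul_commutator]
  have hr (j k : ℕ) : TensorProduct.map (commutatorSpan K (FreeAlgebra K (Fin 2))).mkQ
      (commutatorSpan K (FreeAlgebra K (Fin 2))).mkQ
      (((fun p => x * p - p * x)^[j + 1] y ⊗ₜ[K] 1) * (outerAd K x ^ k) 1) = 0 := by
    rw [map_mkQ_mul_comm, ← outerAd_pow_tmul_one, Function.iterate_succ_apply',
      map_mkQ_outerAd_pow_commutator_tmul_one]
  have hDa := map_mkQ_outerAd_pow_apply_iterate_commutator hDxx hDxy hDxL (2 * m + 1) 0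
  rw [pow_zero, Module.End.one_apply, zero_add, map_sub (outerAd K x ^ _), outerAd_pow_one_tmul,
    outerAd_pow_tmul_one, map_sub, map_mkQ_mul_comm (1 ⊗ₜ[K] y),
    map_mkQ_mul_comm _ (y ⊗ₜ[K] 1)] at hDa
  have htail : ∀ i ∈ Finset.range m,
      TensorProduct.map (commutatorSpan K (FreeAlgebra K (Fin 2))).mkQ
        (commutatorSpan K (FreeAlgebra K (Fin 2))).mkQ (Dy (((-1 : K) ^ (i + 1)) •
        ((fun p => x * p - p * x)^[i + 1] y *
            (fun p => x * p - p * x)^[2 * (m + 1) - 1 - (i + 1)] y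
          - (fun p => x * p - p * x)^[2 * (m + 1) - 1 - (i + 1)] y *
            (fun p => x * p - p * x)^[i + 1] y))) = 0 := by
    intro i hi
    obtain ⟨l, hl'⟩ : ∃ l, 2 * (m + 1) - 1 - (i + 1) = l + 1 :=
      ⟨2 * m - i - 1, by have := Finset.mem_range.1 hi; omega⟩
    rw [hl', map_smul, map_smul, map_sub, hDyL, hDyL, hDyu, hDyu, map_sub, map_add, map_add,
      hl, hr, hl, hr]
    simp
  rw [ha, hb, Finset.sum_range_succ', map_add Dy, map_sum, map_add, map_add, map_sum,
    Finset.sum_eq_zero htail, zero_add, show 2 * (m + 1) = 2 * m + 1 + 1 by ring, hDa,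
    show 2 * m + 1 + 1 - 1 - 0 = 2 * m + 1 by omega, pow_zero, one_smul, map_sub Dy,
    hDyL, hDyL, hDyu, hDyu, map_sub, map_add, map_add, hl, hr, Function.iterate_zero_apply]
  abel
end

section
/- Let K be a field of characteristic zero and H a finite-dimensional K-vector space. Let l, m be non-negative integers with l + m > 0, and let u ∈ H^{⊗l} and v ∈ H^{⊗m} be non-zero elements such that u·v = v·u in the tensor algebra T(H). Then there exist an element w ∈ H^{⊗gcd(l,m)} and scalars c, d ∈ K such that u = c·w^{l'} and v = d·w^{m'}, where l' = l/gcd(l,m) and m' = m/gcd(l,m). -/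
/-- The degree-`p` homogeneous component `H^{⊗p}` of the tensor algebra `T(H)`,
realized as the `p`-th power of the submodule of degree-one elements. -/
def tensorGrade (K H : Type*) [CommRing K] [AddCommGroup H] [Module K H] (p : ℕ) :
    Submodule K (TensorAlgebra K H) :=
  (LinearMap.range (TensorAlgebra.ι K (M := H))) ^ p

namespace TensorAlgebra

open Module

variable {K H κ : Type*} [Field K] [AddCommGroup H] [Module K H]

/-- The coefficient of `x` at the word `s` in the letters of a basis `b` of `H`. -/
noncomputable def wordCoeff (b : Basis κ K H) (s : FreeMonoid κ) (x : TensorAlgebra K H) : K :=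
  (FreeAlgebra.equivMonoidAlgebraFreeMonoid (equivFreeAlgebra b x)).coeff s

section wordCoeff

variable (b : Basis κ K H)

@[simp]
theorem wordCoeff_zero (s : FreeMonoid κ) : wordCoeff b s 0 = 0 := by
  simp [wordCoeff]

@[simp]
theorem wordCoeff_add (s : FreeMonoid κ) (x y : TensorAlgebra K H) :
    wordCoeff b s (x + y) = wordCoeff b s x + wordCoeff b s y := by
  simp [wordCoeff]

@[simp]
theorem wordCoeff_smul (s : FreeMonoid κ) (r : K) (x : TensorAlgebra K H) :
    wordCoeff b s (r • x) = r * wordCoeff b s x := by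
  simp [wordCoeff]

theorem wordCoeff_sum {α : Type*} (s : FreeMonoid κ) (t : Finset α) (f : α → TensorAlgebra K H) :
    wordCoeff b s (∑ i ∈ t, f i) = ∑ i ∈ t, wordCoeff b s (f i) := by
  simp [wordCoeff]

theorem eq_zero_of_wordCoeff {x : TensorAlgebra K H} (h : ∀ s, wordCoeff b s x = 0) : x = 0 := by
  have h' : FreeAlgebra.equivMonoidAlgebraFreeMonoid (equivFreeAlgebra b x) = 0 := by
    ext s
    simpa [wordCoeff] using h s
  simpa using h'

theorem wordCoeff_ι_mul_of_mul (h : H) (x : TensorAlgebra K H) (a : κ) (s : FreeMonoid κ) :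
    wordCoeff b (.of a * s) (ι K h * x) = b.repr h a * wordCoeff b s x := by
  classical
  induction b.mem_span h using Submodule.span_induction with
  | mem h hh =>
    obtain ⟨i, rfl⟩ := hh
    simp only [wordCoeff, map_mul, equivFreeAlgebra_ι_apply, b.repr_self,
      FreeAlgebra.equivMonoidAlgebraFreeMonoid, AlgEquiv.ofAlgHom_apply, FreeAlgebra.lift_ι_apply,
      MonoidAlgebra.of_apply]
    by_cases hi : i = a
    · subst hi
      rw [MonoidAlgebra.coeff_single_mul_eq_mul_coeff s fun t _ => by simp]
      simp
    · rw [MonoidAlgebra.coeff_single_mul_of_forall_mul_ne]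
      · simp [hi]
      · exact fun t ht => hi (List.cons.inj ht).1
  | zero => simp
  | add h₁ h₂ _ _ ih₁ ih₂ => simp [add_mul, ih₁, ih₂]
  | smul r h _ ih => simp [ih, mul_assoc]

theorem wordCoeff_one_ι_mul (h : H) (x : TensorAlgebra K H) :
    wordCoeff b 1 (ι K h * x) = 0 := by
  classical
  induction b.mem_span h using Submodule.span_induction with
  | mem h hh =>
    obtain ⟨i, rfl⟩ := hh
    simp only [wordCoeff, map_mul, equivFreeAlgebra_ι_apply,
      FreeAlgebra.equivMonoidAlgebraFreeMonoid, AlgEquiv.ofAlgHom_apply, FreeAlgebra.lift_ι_apply,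
      MonoidAlgebra.of_apply]
    exact MonoidAlgebra.coeff_single_mul_of_forall_mul_ne _ _ fun t => List.cons_ne_nil _ _
  | zero => simp
  | add h₁ h₂ _ _ ih₁ ih₂ => simp [add_mul, ih₁, ih₂]
  | smul r h _ ih => simp [ih]

theorem wordCoeff_algebraMap_of_ne_one (r : K) {s : FreeMonoid κ} (hs : s ≠ 1) :
    wordCoeff b s (algebraMap K _ r) = 0 := by
  classical
  simp [wordCoeff, hs.symm, MonoidAlgebra.coe_algebraMap]

theorem wordCoeff_one_algebraMap (r : K) : wordCoeff b 1 (algebraMap K _ r) = r := by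
  simp [wordCoeff, MonoidAlgebra.coe_algebraMap]

theorem wordCoeff_eq_zero_of_length_ne {n : ℕ} {x : TensorAlgebra K H}
    (hx : x ∈ tensorGrade K H n) {s : FreeMonoid κ} (hs : s.length ≠ n) :
    wordCoeff b s x = 0 := by
  induction hx using Submodule.pow_induction_on_left' generalizing s with
  | algebraMap r =>
    exact wordCoeff_algebraMap_of_ne_one b r fun h => hs (by simp [h])
  | add x y i _ _ ihx ihy => simp [ihx hs, ihy hs]
  | mem_mul m hm i x _ ih =>
    obtain ⟨h, rfl⟩ := hm
    cases s using FreeMonoid.casesOn with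
    | one => exact wordCoeff_one_ι_mul b h x
    | of_mul a s =>
      rw [wordCoeff_ι_mul_of_mul, ih, mul_zero]
      rintro rfl
      exact hs (by simp [add_comm])

theorem wordCoeff_mul_mul {n : ℕ} {x : TensorAlgebra K H} (hx : x ∈ tensorGrade K H n)
    (y : TensorAlgebra K H) {s : FreeMonoid κ} (hs : s.length = n) (t : FreeMonoid κ) :
    wordCoeff b (s * t) (x * y) = wordCoeff b s x * wordCoeff b t y := by
  induction hx using Submodule.pow_induction_on_left' generalizing s with
  | algebraMap r =>
    obtain rfl := FreeMonoid.length_eq_zero.mp hs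
    rw [wordCoeff_one_algebraMap, one_mul, ← Algebra.smul_def, wordCoeff_smul]
  | add x₁ x₂ i _ _ ih₁ ih₂ => simp [add_mul, ih₁ hs, ih₂ hs]
  | mem_mul m hm i x _ ih =>
    obtain ⟨h, rfl⟩ := hm
    cases s using FreeMonoid.casesOn with
    | one => simp at hs
    | of_mul a s =>
      have hs' : s.length = i := by simp at hs; omega
      rw [mul_assoc, mul_assoc, wordCoeff_ι_mul_of_mul, wordCoeff_ι_mul_of_mul, ih hs', mul_assoc]

end wordCoeff

/-- A `K`-linearly independent family in `H^{⊗n}` is linearly independent in `T(H)` regarded as a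
right module over itself. -/
theorem eq_zero_of_sum_mul_eq_zero {α : Type*} {n : ℕ} {e : α → tensorGrade K H n}
    (he : LinearIndependent K e) {f : α →₀ TensorAlgebra K H}
    (hf : (f.sum fun i t => (e i : TensorAlgebra K H) * t) = 0) : f = 0 := by
  have b := Basis.ofVectorSpace K H
  ext i
  by_cases hi : i ∈ f.support
  swap
  · simpa using hi
  refine eq_zero_of_wordCoeff b fun t => ?_
  refine linearIndependent_iff'.mp he f.support (fun i => wordCoeff b t (f i)) ?_ i hi
  refine Subtype.ext (eq_zero_of_wordCoeff b fun s => ?_)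
  by_cases hs : s.length = n
  · have h := congrArg (wordCoeff b (s * t)) hf
    rw [Finsupp.sum, wordCoeff_sum, wordCoeff_zero] at h
    rw [← h, AddSubmonoidClass.coe_finsetSum, wordCoeff_sum]
    refine Finset.sum_congr rfl fun j _ => ?_
    rw [wordCoeff_mul_mul b (e j).2 _ hs, mul_comm]
    simp
  · exact wordCoeff_eq_zero_of_length_ne b (Subtype.prop _) hs

/-- An element of `H^{⊗(m+n)}` expands in a basis of `H^{⊗m}` with right coefficients in
`H^{⊗n}`. -/
theorem exists_finsupp_of_mem_tensorGrade_add {α : Type*} {m n : ℕ}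
    (e : Basis α K (tensorGrade K H m)) {v : TensorAlgebra K H}
    (hv : v ∈ tensorGrade K H (m + n)) :
    ∃ f : α →₀ TensorAlgebra K H, (∀ i, f i ∈ tensorGrade K H n) ∧
      (f.sum fun i t => (e i : TensorAlgebra K H) * t) = v := by
  classical
  rw [tensorGrade, pow_add] at hv
  induction hv using Submodule.mul_induction_on' with
  | mem_mul_mem x hx y hy =>
    refine ⟨(e.repr ⟨x, hx⟩).mapRange (fun r => r • y) (zero_smul _ _), fun i => ?_, ?_⟩
    · exact Submodule.smul_mem _ _ hy
    · rw [Finsupp.sum_mapRange_index (by simp)]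
      have h : _ = x := congrArg Subtype.val (e.linearCombination_repr ⟨x, hx⟩)
      rw [Finsupp.linearCombination_apply, Finsupp.sum, AddSubmonoidClass.coe_finsetSum] at h
      conv_rhs => rw [← h, Finset.sum_mul]
      exact Finset.sum_congr rfl fun i _ => by simp
  | add x _ y _ ihx ihy =>
    obtain ⟨f, hf, rfl⟩ := ihx
    obtain ⟨g, hg, rfl⟩ := ihy
    exact ⟨f + g, fun i => add_mem (hf i) (hg i),
      Finsupp.sum_add_index' (by simp) fun _ _ _ => mul_add _ _ _⟩

/-- A nonzero homogeneous element is a left divisor of every homogeneous element of larger degree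
commuting with it. -/
theorem exists_eq_mul_of_commute {m n : ℕ} {u v : TensorAlgebra K H} (hu0 : u ≠ 0)
    (hu : u ∈ tensorGrade K H m) (hv : v ∈ tensorGrade K H (m + n)) (hc : Commute u v) :
    ∃ t ∈ tensorGrade K H n, v = u * t := by
  classical
  have hu' : LinearIndepOn K id {(⟨u, hu⟩ : tensorGrade K H m)} :=
    .singleton fun h => hu0 (congrArg Subtype.val h)
  let e := Basis.extend hu'
  let i₀ : hu'.extend (Set.subset_univ _) := ⟨⟨u, hu⟩, Basis.subset_extend hu' rfl⟩
  have he : (e i₀ : TensorAlgebra K H) = u := congrArg Subtype.val (Basis.extend_apply_self hu' i₀)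
  obtain ⟨f, hf, rfl⟩ := exists_finsupp_of_mem_tensorGrade_add e hv
  set v := f.sum fun i t => (e i : TensorAlgebra K H) * t with hv_def
  have hg : f.mapRange (· * u) (zero_mul u) + Finsupp.single i₀ (-v) = 0 := by
    refine eq_zero_of_sum_mul_eq_zero e.linearIndependent ?_
    rw [Finsupp.sum_add_index' (by simp) fun _ _ _ => mul_add _ _ _,
      Finsupp.sum_mapRange_index (by simp), Finsupp.sum_single_index (by simp), he, mul_neg,
      hc.eq, add_neg_eq_zero]
    conv_rhs => rw [hv_def, Finsupp.sum, Finset.sum_mul]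
    exact Finset.sum_congr rfl fun i _ => (mul_assoc _ _ _).symm
  refine ⟨f i₀, hf i₀, ?_⟩
  refine Eq.trans ?_ (congrArg (· * f i₀) he)
  refine Finset.sum_eq_single i₀ (fun i _ hi => ?_) fun h => by simp_all
  have h := DFunLike.congr_fun hg i
  have hfi : f i = 0 := by simpa [hi.symm, hu0] using h
  simp [hfi]

/-- Commuting nonzero homogeneous elements of `T(H)` are proportional to powers of a common
homogeneous element. -/
theorem exists_eq_smul_pow_of_commute {l m : ℕ} (hlm : 0 < l + m) {u v : TensorAlgebra K H}
    (hu0 : u ≠ 0) (hv0 : v ≠ 0) (hu : u ∈ tensorGrade K H l) (hv : v ∈ tensorGrade K H m)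
    (hc : Commute u v) :
    ∃ w ∈ tensorGrade K H (Nat.gcd l m), ∃ c d : K,
      u = c • w ^ (l / Nat.gcd l m) ∧ v = d • w ^ (m / Nat.gcd l m) := by
  induction hN : l + m using Nat.strong_induction_on generalizing l m u v with
  | _ N ih =>
    subst hN
    wlog h : l ≤ m generalizing l m u v
    · obtain ⟨w, hw, c, d, hcw, hdw⟩ := this (by omega) hv0 hu0 hv hu hc.symm
        (fun k hk => ih k (by omega)) (by omega)
      rw [Nat.gcd_comm] at hw hcw hdw
      exact ⟨w, hw, d, c, hdw, hcw⟩
    obtain rfl | hl := Nat.eq_zero_or_pos l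
    · obtain ⟨r, rfl⟩ := Submodule.mem_one.mp (by simpa [tensorGrade] using hu)
      have hm : 0 < m := by omega
      refine ⟨v, by simpa using hv, r, 1, ?_, ?_⟩
      · simp [Algebra.algebraMap_eq_smul_one]
      · simp [Nat.div_self hm]
    · obtain ⟨n, rfl⟩ := Nat.exists_eq_add_of_le h
      obtain ⟨t, ht, rfl⟩ := exists_eq_mul_of_commute hu0 hu hv hc
      have hct : Commute u t := mul_left_cancel₀ hu0 (by rw [hc.eq, mul_assoc])
      obtain ⟨w, hw, c, d, hcw, hdw⟩ :=
        ih (l + n) (by omega) (by omega) hu0 (right_ne_zero_of_mul hv0) hu ht hct rfl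
      have hg : Nat.gcd l (l + n) = Nat.gcd l n := by simp
      rw [hg]
      refine ⟨w, hw, c, c * d, hcw, ?_⟩
      rw [Nat.add_div_of_dvd_right (Nat.gcd_dvd_left l n), pow_add, mul_smul]
      nth_rewrite 1 [hcw]
      nth_rewrite 1 [hdw]
      rw [smul_mul_assoc, mul_smul_comm]

end TensorAlgebra

/-- **Euclidean algorithm.** Let `K` be a field of characteristic zero and
`H` a finite-dimensional `K`-vector space.  If `u ∈ H^{⊗l}` and `v ∈ H^{⊗m}` are non-zero
with `l + m > 0` and `u * v = v * u` in `T(H)`, then there are `w ∈ H^{⊗gcd(l,m)}` and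
`c, d ∈ K` with `u = c • w^{l/gcd(l,m)}` and `v = d • w^{m/gcd(l,m)}`. -/
theorem stmt_2 (K H : Type*) [Field K] [CharZero K] [AddCommGroup H] [Module K H]
    [FiniteDimensional K H] (l m : ℕ) (hlm : 0 < l + m)
    (u v : TensorAlgebra K H) (hu0 : u ≠ 0) (hv0 : v ≠ 0)
    (hu : u ∈ tensorGrade K H l) (hv : v ∈ tensorGrade K H m)
    (hc : u * v = v * u) :
    ∃ w ∈ tensorGrade K H (Nat.gcd l m), ∃ c d : K,
      u = c • w ^ (l / Nat.gcd l m) ∧ v = d • w ^ (m / Nat.gcd l m) := by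
  exact TensorAlgebra.exists_eq_smul_pow_of_commute hlm hu0 hv0 hu hv hc
end

section
/- Let K be a field of characteristic zero, H a finite-dimensional K-vector space, and u₀ ∈ H^{⊗l} (l ≥ 1) a non-zero reduced element. Then the centralizer {v ∈ T(H) | v·u₀ = u₀·v} equals the unital subalgebra of T(H) generated by u₀, i.e. the set of polynomials in u₀ with coefficients in K. -/
/-- A non-zero homogeneous element `u₀ ∈ H^{⊗l}` (`l ≥ 1`) is *reduced* if for every
divisor `d` of `l`, every `λ ∈ K` and every `v₀ ∈ H^{⊗(l/d)}`, the equation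
`u₀ = λ • v₀^d` implies `d = 1`. -/
def IsReduced' (K H : Type*) [CommRing K] [AddCommGroup H] [Module K H]
    (l : ℕ) (u₀ : TensorAlgebra K H) : Prop :=
  ∀ d : ℕ, d ∣ l → ∀ c : K, ∀ v₀ ∈ tensorGrade K H (l / d), u₀ = c • v₀ ^ d → d = 1

section LeftContraction

variable {K H : Type*} [Field K] [AddCommGroup H] [Module K H]

/-- The action of `h ∈ H` on pairs `(x, y)`, given by `(h * x, φ h • x)`. -/
def pairAction (φ : Module.Dual K H) :
    H →ₗ[K] Module.End K (TensorAlgebra K H × TensorAlgebra K H) where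
  toFun h :=
    LinearMap.prod
      ((LinearMap.mulLeft K (TensorAlgebra.ι K h)) ∘ₗ LinearMap.fst K _ _)
      (φ h • LinearMap.fst K _ _)
  map_add' h k := by
    ext x <;> simp [add_mul, add_smul]
  map_smul' c h := by
    ext x <;> simp [mul_smul]

/-- Contraction of the leftmost tensor factor against `φ`. -/
def leftContract (φ : Module.Dual K H) : TensorAlgebra K H →ₗ[K] TensorAlgebra K H :=
  LinearMap.snd K _ _ ∘ₗ
    (LinearMap.applyₗ ((1, 0) : TensorAlgebra K H × TensorAlgebra K H)) ∘ₗ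
      (TensorAlgebra.lift K (pairAction φ)).toLinearMap

lemma lift_pairAction_fst (φ : Module.Dual K H) (x : TensorAlgebra K H)
    (z : TensorAlgebra K H × TensorAlgebra K H) :
    (TensorAlgebra.lift K (pairAction φ) x z).1 = x * z.1 := by
  induction x using TensorAlgebra.induction generalizing z with
  | algebraMap r => simp [Algebra.smul_def]
  | ι h => simp [pairAction]
  | mul a b ha hb => simp [ha, hb, mul_assoc]
  | add a b ha hb => simp [ha, hb, add_mul]

lemma leftContract_ι_mul (φ : Module.Dual K H) (h : H) (x : TensorAlgebra K H) :
    leftContract φ (TensorAlgebra.ι K h * x) = φ h • x := by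
  have := lift_pairAction_fst φ x (1, 0)
  simp only [mul_one] at this
  simp only [leftContract, LinearMap.comp_apply, AlgHom.toLinearMap_apply,
    LinearMap.applyₗ_apply_apply, LinearMap.snd_apply, map_mul, Module.End.mul_apply, TensorAlgebra.lift_ι_apply]
  exact congrArg (φ h • ·) this

/-- Induction principle for tensors of positive degree. -/
lemma tensorGrade_succ_induction {p : ℕ} {P : TensorAlgebra K H → Prop}
    (hmul : ∀ h : H, ∀ x ∈ tensorGrade K H p, P (TensorAlgebra.ι K h * x))
    (hadd : ∀ x y, P x → P y → P (x + y))
    {a : TensorAlgebra K H} (ha : a ∈ tensorGrade K H (p + 1)) : P a := by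
  rw [tensorGrade, pow_succ'] at ha
  refine Submodule.mul_induction_on ha ?_ hadd
  rintro _ ⟨h, rfl⟩ x hx
  exact hmul h x hx

lemma leftContract_mul (φ : Module.Dual K H) {p : ℕ} {a : TensorAlgebra K H}
    (ha : a ∈ tensorGrade K H (p + 1)) (x : TensorAlgebra K H) :
    leftContract φ (a * x) = leftContract φ a * x := by
  refine tensorGrade_succ_induction (P := fun a => leftContract φ (a * x) = leftContract φ a * x)
    ?_ ?_ ha
  · intro h y _
    rw [mul_assoc, leftContract_ι_mul, leftContract_ι_mul, smul_mul_assoc]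
  · intro y z hy hz
    simp only [add_mul, map_add, hy, hz]

lemma leftContract_mem (φ : Module.Dual K H) {p : ℕ} {a : TensorAlgebra K H}
    (ha : a ∈ tensorGrade K H (p + 1)) : leftContract φ a ∈ tensorGrade K H p := by
  refine tensorGrade_succ_induction (P := fun a => leftContract φ a ∈ tensorGrade K H p) ?_ ?_ ha
  · intro h y hy
    rw [leftContract_ι_mul]
    exact Submodule.smul_mem _ _ hy
  · intro y z hy hz
    rw [map_add]
    exact Submodule.add_mem _ hy hz

lemma exists_leftContract_ne_zero [FiniteDimensional K H] {p : ℕ} {a : TensorAlgebra K H}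
    (ha : a ∈ tensorGrade K H (p + 1)) (hne : a ≠ 0) :
    ∃ φ : Module.Dual K H, leftContract φ a ≠ 0 := by
  by_contra! hzero
  let e := Module.finBasis K H
  have hsum : ∑ i, TensorAlgebra.ι K (e i) * leftContract (e.coord i) a = a := by
    refine tensorGrade_succ_induction
      (P := fun a => ∑ i, TensorAlgebra.ι K (e i) * leftContract (e.coord i) a = a) ?_ ?_ ha
    · intro h y _
      conv_rhs => rw [← e.sum_repr h, map_sum, Finset.sum_mul]
      simp [leftContract_ι_mul]
    · intro y z hy hz
      simp only [map_add, mul_add, Finset.sum_add_distrib, hy, hz]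
  exact hne (by simpa [hzero] using hsum.symm)

/-- Left multiplication by a non-zero homogeneous tensor of degree `p` has a linear left inverse
which lowers degrees by `p` and commutes with right multiplications in degrees at least `p`. -/
lemma exists_left_inverse_mulLeft [FiniteDimensional K H] {p : ℕ} {a : TensorAlgebra K H}
    (ha : a ∈ tensorGrade K H p) (hne : a ≠ 0) :
    ∃ F : TensorAlgebra K H →ₗ[K] TensorAlgebra K H, (∀ x, F (a * x) = x) ∧
      ∀ q, ∀ b ∈ tensorGrade K H (p + q),
        F b ∈ tensorGrade K H q ∧ ∀ x, F (b * x) = F b * x := by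
  induction p generalizing a with
  | zero =>
    rw [tensorGrade, pow_zero, Submodule.mem_one] at ha
    obtain ⟨k, rfl⟩ := ha
    have hk : k ≠ 0 := by
      rintro rfl
      simp at hne
    refine ⟨k⁻¹ • LinearMap.id, fun x => ?_, fun q b hb => ⟨?_, fun x => ?_⟩⟩
    · simp [← Algebra.smul_def, smul_smul, hk]
    · rw [zero_add] at hb
      exact Submodule.smul_mem _ _ hb
    · simp
  | succ p ih =>
    obtain ⟨φ, hφ⟩ := exists_leftContract_ne_zero ha hne
    obtain ⟨F, hF, hFb⟩ := ih (leftContract_mem φ ha) hφ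
    refine ⟨F ∘ₗ leftContract φ, fun x => ?_, fun q b hb => ?_⟩
    · simp [leftContract_mul φ ha, hF]
    · rw [Nat.add_right_comm] at hb
      obtain ⟨h1, h2⟩ := hFb q _ (leftContract_mem φ hb)
      exact ⟨h1, fun x => by simp [leftContract_mul φ hb, h2]⟩

lemma tensorGrade_mul_mem {p q : ℕ} {a b : TensorAlgebra K H}
    (ha : a ∈ tensorGrade K H p) (hb : b ∈ tensorGrade K H q) :
    a * b ∈ tensorGrade K H (p + q) := by
  rw [tensorGrade, pow_add]
  exact Submodule.mul_mem_mul ha hb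

/-- If homogeneous tensors commute, the one of larger degree is a multiple of the other, and the
quotient still commutes with it. -/
lemma exists_eq_mul_of_commute [FiniteDimensional K H] {p q : ℕ} {a b : TensorAlgebra K H}
    (ha : a ∈ tensorGrade K H p) (hane : a ≠ 0) (hb : b ∈ tensorGrade K H (p + q))
    (hab : Commute a b) :
    ∃ c ∈ tensorGrade K H q, b = c * a ∧ Commute a c := by
  obtain ⟨F, hF, hFb⟩ := exists_left_inverse_mulLeft ha hane
  obtain ⟨hc, hmul⟩ := hFb q b hb
  have hbc : b = F b * a := by rw [← hmul, ← hab.eq, hF]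
  refine ⟨F b, hc, hbc, ?_⟩
  by_contra hcomm
  have hy : a * F b - F b * a ∈ tensorGrade K H (p + q) :=
    Submodule.sub_mem _ (tensorGrade_mul_mem ha hc)
      (add_comm p q ▸ tensorGrade_mul_mem hc ha)
  obtain ⟨G, hG, -⟩ := exists_left_inverse_mulLeft hy (sub_ne_zero.mpr hcomm)
  have hzero : (a * F b - F b * a) * a = 0 := by
    rw [sub_mul, mul_assoc, ← hbc, hab.eq, sub_self]
  exact hane (by rw [← hG a, hzero, map_zero])

/-- Commuting non-zero homogeneous tensors are, up to scalars, powers of a common one. -/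
lemma exists_common_root_of_commute [FiniteDimensional K H] {p q : ℕ} {a b : TensorAlgebra K H}
    (ha : a ∈ tensorGrade K H p) (hane : a ≠ 0) (hb : b ∈ tensorGrade K H q) (hbne : b ≠ 0)
    (hab : Commute a b) :
    ∃ r i j : ℕ, ∃ w ∈ tensorGrade K H r, ∃ s t : K,
      p = i * r ∧ q = j * r ∧ a = s • w ^ i ∧ b = t • w ^ j := by
  induction hn : p + q using Nat.strong_induction_on generalizing p q a b with
  | _ n ih =>
    wlog hpq : p ≤ q generalizing p q a b
    · obtain ⟨r, i, j, w, hw, s, t, h1, h2, h3, h4⟩ :=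
        this hb hbne ha hane hab.symm (by omega) (by omega)
      exact ⟨r, j, i, w, hw, t, s, h2, h1, h4, h3⟩
    obtain rfl | hp := Nat.eq_zero_or_pos p
    · rw [tensorGrade, pow_zero, Submodule.mem_one] at ha
      obtain ⟨k, rfl⟩ := ha
      exact ⟨q, 0, 1, b, hb, k, 1, by simp, by simp, by simp [Algebra.algebraMap_eq_smul_one],
        by simp⟩
    · obtain ⟨m, rfl⟩ := Nat.exists_eq_add_of_le hpq
      obtain ⟨c, hc, rfl, hac⟩ := exists_eq_mul_of_commute ha hane hb hab
      obtain ⟨r, i, j, w, hw, s, t, h1, h2, h3, h4⟩ :=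
        ih (p + m) (by omega) ha hane hc (left_ne_zero_of_mul hbne) hac rfl
      refine ⟨r, i, j + i, w, hw, s, t * s, h1, by rw [add_mul, ← h1, ← h2, add_comm], h3, ?_⟩
      rw [h3, h4, smul_mul_smul_comm, pow_add]

end LeftContraction

/-- For a non-zero reduced `u₀ ∈ H^{⊗l}` (`l ≥ 1`), the centralizer
`{v ∈ T(H) | v·u₀ = u₀·v}` equals the unital subalgebra generated by `u₀`,
i.e. the polynomials in `u₀` with coefficients in `K`. -/
theorem stmt_3 (K H : Type*) [Field K] [CharZero K] [AddCommGroup H] [Module K H]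
    [FiniteDimensional K H] (l : ℕ) (hl : 1 ≤ l) (u₀ : TensorAlgebra K H)
    (hu₀ : u₀ ∈ tensorGrade K H l) (hne : u₀ ≠ 0) (hred : IsReduced' K H l u₀) :
    {v : TensorAlgebra K H | v * u₀ = u₀ * v}
      = ↑(Algebra.adjoin K {u₀} : Subalgebra K (TensorAlgebra K H)) := by
  have hu_mem : u₀ ∈ Algebra.adjoin K {u₀} := Algebra.self_mem_adjoin_singleton K u₀
  have hhom : ∀ m, ∀ b ∈ tensorGrade K H m, Commute u₀ b → b ∈ Algebra.adjoin K {u₀} := by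
    intro m b hb hcomm
    by_cases hb0 : b = 0
    · exact hb0 ▸ zero_mem _
    obtain ⟨r, i, j, w, hw, s, t, hli, -, hu, rfl⟩ :=
      exists_common_root_of_commute hu₀ hne hb hb0 hcomm
    have hi : 0 < i := Nat.pos_of_ne_zero (by rintro rfl; omega)
    have hr : l / i = r := by rw [hli, Nat.mul_div_cancel_left r hi]
    have hi1 : i = 1 := hred i ⟨r, hli⟩ s w (hr ▸ hw) hu
    rw [hi1, pow_one] at hu
    have hs : s ≠ 0 := by
      rintro rfl
      exact hne (by rw [hu, zero_smul])
    have hwu : w = s⁻¹ • u₀ := by rw [hu, smul_smul, inv_mul_cancel₀ hs, one_smul]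
    rw [hwu]
    exact Subalgebra.smul_mem _ (pow_mem (Subalgebra.smul_mem _ hu_mem _) _) _
  ext v
  refine ⟨fun hv => ?_, fun hv => ?_⟩
  · classical
    let 𝒜 : ℕ → Submodule K (TensorAlgebra K H) :=
      fun n => LinearMap.range (TensorAlgebra.ι K (M := H)) ^ n
    change v ∈ Algebra.adjoin K {u₀}
    rw [← DirectSum.sum_support_decompose 𝒜 v]
    refine sum_mem fun m _ => hhom m _ (SetLike.coe_mem _) ?_
    have h1 := DirectSum.coe_decompose_mul_add_of_left_mem 𝒜 (j := m) (b := v) hu₀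
    have h2 := DirectSum.coe_decompose_mul_add_of_right_mem 𝒜 (i := m) (a := v) hu₀
    have hv' : v * u₀ = u₀ * v := hv
    rw [hv', add_comm m l, h1] at h2
    exact h2
  · exact (Algebra.commute_of_mem_adjoin_self hv).symm.eq
end

section
/- Let K be a field of characteristic zero, H a finite-dimensional K-vector space, and u₀ ∈ H^{⊗l} (l ≥ 1) a non-zero reduced element. Then {v ∈ T(H) | u₀·v − v·u₀ lies in the unital subalgebra generated by u₀} equals the unital subalgebra of T(H) generated by u₀. In particular, if the commutator [u₀, v] is a polynomial in u₀, then v itself is a polynomial in u₀. -/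
open DirectSum

namespace TensorAlgebra

section CommRing

variable {K H : Type*} [CommRing K] [AddCommGroup H] [Module K H]

/-- The algebra morphism `T(H) → M₂(T(H))` sending `h ∈ H` to the matrix with rows `(h, f h)` and
`(0, 0)`. -/
noncomputable def stripHom (f : H →ₗ[K] K) :
    TensorAlgebra K H →ₐ[K] Matrix (Fin 2) (Fin 2) (TensorAlgebra K H) :=
  TensorAlgebra.lift K
    { toFun := fun h => !![ι K h, algebraMap K _ (f h); 0, 0]
      map_add' := fun x y => by
        ext i j
        fin_cases i <;> fin_cases j <;> simp
      map_smul' := fun c x => by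
        ext i j
        fin_cases i <;> fin_cases j <;> simp [Algebra.smul_def] }

lemma stripHom_ι (f : H →ₗ[K] K) (h : H) :
    stripHom f (ι K h) = !![ι K h, algebraMap K _ (f h); 0, 0] := by
  simp [stripHom]

lemma stripHom_apply_zero (f : H →ₗ[K] K) (a : TensorAlgebra K H) :
    stripHom f a 0 0 = a ∧ stripHom f a 1 0 = 0 := by
  induction a using TensorAlgebra.induction with
  | algebraMap r => simp [AlgHom.commutes, Matrix.algebraMap_matrix_apply]
  | ι x => simp [stripHom_ι]
  | mul a b ha hb => simp [Matrix.mul_apply, Fin.sum_univ_two, ha, hb]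
  | add a b ha hb => simp [ha, hb]

/-- Contraction of the last tensor factor with a linear form. -/
noncomputable def strip (f : H →ₗ[K] K) : TensorAlgebra K H →ₗ[K] TensorAlgebra K H where
  toFun a := stripHom f a 0 1
  map_add' a b := by simp
  map_smul' c a := by simp

lemma strip_mul_ι (f : H →ₗ[K] K) (a : TensorAlgebra K H) (h : H) :
    strip f (a * ι K h) = f h • a := by
  simp [strip, Matrix.mul_apply, Fin.sum_univ_two, stripHom_ι, stripHom_apply_zero,
    Algebra.smul_def, Algebra.commutes]

/-- To prove a property of the elements of `H^{⊗(p+q)}`, it is enough to treat products. -/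
lemma tensorGrade_add_induction {p q n : ℕ} (hn : p + q = n)
    {P : TensorAlgebra K H → Prop}
    (mul : ∀ a ∈ tensorGrade K H p, ∀ b ∈ tensorGrade K H q, P (a * b))
    (add : ∀ x y, P x → P y → P (x + y)) {x : TensorAlgebra K H}
    (hx : x ∈ tensorGrade K H n) : P x := by
  rw [← hn, tensorGrade, pow_add] at hx
  exact Submodule.mul_induction_on hx mul add

lemma mul_mem_tensorGrade {p q n : ℕ} (hn : p + q = n) {a b : TensorAlgebra K H}
    (ha : a ∈ tensorGrade K H p) (hb : b ∈ tensorGrade K H q) : a * b ∈ tensorGrade K H n := by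
  rw [← hn, tensorGrade, pow_add]
  exact Submodule.mul_mem_mul ha hb

lemma pow_mem_tensorGrade {l : ℕ} {u : TensorAlgebra K H} (hu : u ∈ tensorGrade K H l) (k : ℕ) :
    u ^ k ∈ tensorGrade K H (k * l) := by
  rw [mul_comm, tensorGrade, pow_mul]
  exact Submodule.pow_mem_pow _ hu k

lemma mem_tensorGrade_zero {a : TensorAlgebra K H} :
    a ∈ tensorGrade K H 0 ↔ ∃ c : K, algebraMap K _ c = a := by
  rw [tensorGrade, pow_zero, Submodule.mem_one]

lemma exists_ι_eq_of_mem_tensorGrade_one {a : TensorAlgebra K H} (ha : a ∈ tensorGrade K H 1) :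
    ∃ h : H, ι K h = a := by
  rwa [tensorGrade, pow_one] at ha

lemma strip_mul (f : H →ₗ[K] K) {n : ℕ} (a : TensorAlgebra K H) {q : TensorAlgebra K H}
    (hq : q ∈ tensorGrade K H (n + 1)) : strip f (a * q) = a * strip f q := by
  refine tensorGrade_add_induction (P := fun q => strip f (a * q) = a * strip f q) rfl ?_ ?_ hq
  · intro p _ b hb
    obtain ⟨h, rfl⟩ := exists_ι_eq_of_mem_tensorGrade_one hb
    rw [← mul_assoc, strip_mul_ι, strip_mul_ι, mul_smul_comm]
  · intro x y hx hy
    rw [mul_add, map_add, map_add, hx, hy, mul_add]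

lemma strip_mem (f : H →ₗ[K] K) {n : ℕ} {q : TensorAlgebra K H}
    (hq : q ∈ tensorGrade K H (n + 1)) : strip f q ∈ tensorGrade K H n := by
  refine tensorGrade_add_induction (P := fun q => strip f q ∈ tensorGrade K H n) rfl ?_ ?_ hq
  · intro p hp b hb
    obtain ⟨h, rfl⟩ := exists_ι_eq_of_mem_tensorGrade_one hb
    rw [strip_mul_ι]
    exact Submodule.smul_mem _ _ hp
  · intro x y hx hy
    rw [map_add]
    exact add_mem hx hy

lemma sum_strip_mul_ι {I : Type*} [Fintype I] (b : Module.Basis I K H) {n : ℕ}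
    {q : TensorAlgebra K H} (hq : q ∈ tensorGrade K H (n + 1)) :
    ∑ i, strip (b.coord i) q * ι K (b i) = q := by
  refine tensorGrade_add_induction
    (P := fun q => ∑ i, strip (b.coord i) q * ι K (b i) = q) rfl ?_ ?_ hq
  · intro p _ x hx
    obtain ⟨h, rfl⟩ := exists_ι_eq_of_mem_tensorGrade_one hx
    conv_rhs => rw [← b.sum_repr h, map_sum, Finset.mul_sum]
    refine Finset.sum_congr rfl fun i _ => ?_
    rw [strip_mul_ι, map_smul, mul_smul_comm, smul_mul_assoc, Module.Basis.coord_apply]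
  · intro x y hx hy
    simp only [map_add, add_mul, Finset.sum_add_distrib, hx, hy]

instance : GradedAlgebra (tensorGrade K H) :=
  inferInstanceAs (GradedAlgebra (LinearMap.range (ι K (M := H)) ^ · : ℕ → Submodule K _))

/-- The homogeneous components of a polynomial in a homogeneous element. -/
lemma decompose_aeval {l : ℕ} (hl : 1 ≤ l) {u : TensorAlgebra K H} (hu : u ∈ tensorGrade K H l)
    (p : Polynomial K) (n : ℕ) :
    (decompose (tensorGrade K H) (Polynomial.aeval u p) n : TensorAlgebra K H) =
      if l ∣ n then p.coeff (n / l) • u ^ (n / l) else 0 := by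
  induction p using Polynomial.induction_on' with
  | add p q hp hq =>
    rw [map_add, decompose_add, DirectSum.add_apply, Submodule.coe_add, hp, hq]
    split_ifs <;> simp [add_smul]
  | monomial k c =>
    rw [Polynomial.aeval_monomial, ← Algebra.smul_def]
    have hmem := Submodule.smul_mem _ c (pow_mem_tensorGrade hu k)
    by_cases hk : k * l = n
    · subst hk
      rw [decompose_of_mem_same _ hmem, if_pos (dvd_mul_left l k), Nat.mul_div_cancel _ hl,
        Polynomial.coeff_monomial_same]
    · rw [decompose_of_mem_ne _ hmem hk]
      split_ifs with hdvd
      · have hkn : k ≠ n / l := by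
          rintro rfl
          exact hk (Nat.div_mul_cancel hdvd)
        rw [Polynomial.coeff_monomial_of_ne _ hkn.symm, zero_smul]
      · rfl

end CommRing

section Field

variable {K H : Type*} [Field K] [AddCommGroup H] [Module K H] [FiniteDimensional K H]

/-- A non-zero homogeneous `u` of degree `l` is detected by some contraction of the last `l`
tensor factors. -/
lemma exists_contraction {l : ℕ} {u : TensorAlgebra K H} (hu : u ∈ tensorGrade K H l)
    (hne : u ≠ 0) :
    ∃ (R : TensorAlgebra K H →ₗ[K] TensorAlgebra K H) (φ : TensorAlgebra K H → K),
      φ u ≠ 0 ∧ ∀ a, ∀ q ∈ tensorGrade K H l, R (a * q) = φ q • a := by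
  induction l generalizing u with
  | zero =>
    refine ⟨LinearMap.id, algebraMapInv, ?_, ?_⟩
    · obtain ⟨c, rfl⟩ := mem_tensorGrade_zero.1 hu
      rintro h
      simp only [AlgHom.commutes, Algebra.algebraMap_self, RingHom.id_apply] at h
      simp [h] at hne
    · intro a q hq
      obtain ⟨c, rfl⟩ := mem_tensorGrade_zero.1 hq
      simp [Algebra.smul_def, Algebra.commutes]
  | succ l ih =>
    let b := Module.finBasis K H
    obtain ⟨i, hi⟩ : ∃ i, strip (b.coord i) u ≠ 0 := by
      by_contra! h
      apply hne
      rw [← sum_strip_mul_ι b hu]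
      simp [h]
    obtain ⟨R, φ, hφ, hR⟩ := ih (strip_mem (b.coord i) hu) hi
    refine ⟨R ∘ₗ strip (b.coord i), fun q => φ (strip (b.coord i) q), hφ, fun a q hq => ?_⟩
    rw [LinearMap.comp_apply, strip_mul _ _ hq, hR _ _ (strip_mem _ hq)]

lemma eq_zero_of_mul_eq_zero {m : ℕ} {u z : TensorAlgebra K H} (hne : u ≠ 0)
    (hz : z ∈ tensorGrade K H m) (h : u * z = 0) : z = 0 := by
  by_contra hz0
  obtain ⟨R, φ, hφ, hR⟩ := exists_contraction hz hz0
  have := hR u z hz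
  rw [h, map_zero] at this
  exact (smul_ne_zero hφ hne) this.symm

/-- A homogeneous `v` such that `v * u ∈ u * T(H)` is left divisible by `u`, if its degree is at
least that of `u`. -/
lemma exists_eq_mul {l k m : ℕ} (hm : k + l = m) {u v x : TensorAlgebra K H}
    (hu : u ∈ tensorGrade K H l) (hne : u ≠ 0) (hx : x ∈ tensorGrade K H m)
    (h : v * u = u * x) : ∃ v' ∈ tensorGrade K H k, v = u * v' := by
  obtain ⟨R, φ, hφ, hR⟩ := exists_contraction hu hne
  have key : R x ∈ tensorGrade K H k ∧ R (u * x) = u * R x := by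
    refine tensorGrade_add_induction
      (P := fun x => R x ∈ tensorGrade K H k ∧ R (u * x) = u * R x) hm ?_ ?_ hx
    · intro p hp q hq
      rw [← mul_assoc, hR _ _ hq, hR _ _ hq, mul_smul_comm]
      exact ⟨Submodule.smul_mem _ _ hp, rfl⟩
    · rintro x y ⟨hx1, hx2⟩ ⟨hy1, hy2⟩
      rw [mul_add, map_add, map_add, mul_add, hx2, hy2]
      exact ⟨add_mem hx1 hy1, rfl⟩
  refine ⟨(φ u)⁻¹ • R x, Submodule.smul_mem _ _ key.1, ?_⟩
  rw [mul_smul_comm, ← key.2, ← h, hR _ _ hu, inv_smul_smul₀ hφ]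

/-- Two non-zero commuting homogeneous elements are, up to scalars, powers of a common homogeneous
element. -/
lemma exists_common_root {l m : ℕ} {u v : TensorAlgebra K H}
    (hu : u ∈ tensorGrade K H l) (hv : v ∈ tensorGrade K H m) (hu0 : u ≠ 0) (hv0 : v ≠ 0)
    (h : u * v = v * u) :
    ∃ (k : ℕ) (w : TensorAlgebra K H) (i j : ℕ) (a b : K), w ∈ tensorGrade K H k ∧
      i * k = l ∧ u = a • w ^ i ∧ v = b • w ^ j ∧ j * k = m := by
  induction hN : l + m using Nat.strong_induction_on generalizing l m u v with
  | _ N ih =>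
    wlog hlm : l ≤ m generalizing l m u v
    · obtain ⟨k, w, i, j, a, b, hw, hi, hua, hvb, hj⟩ :=
        this hv hu hv0 hu0 h.symm (by omega) (by omega)
      exact ⟨k, w, j, i, b, a, hw, hj, hvb, hua, hi⟩
    rcases Nat.eq_zero_or_pos l with rfl | hl
    · obtain ⟨c, rfl⟩ := mem_tensorGrade_zero.1 hu
      exact ⟨m, v, 0, 1, c, 1, hv, by simp, by simp [Algebra.algebraMap_eq_smul_one],
        by simp, by simp⟩
    · obtain ⟨v', hv', rfl⟩ := exists_eq_mul (Nat.sub_add_cancel hlm) hu hu0 hv h.symm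
      have hcomm : u * v' = v' * u := by
        refine sub_eq_zero.1 (eq_zero_of_mul_eq_zero (m := m) hu0 ?_
          (by rw [mul_sub, h, mul_assoc, sub_self]))
        exact sub_mem hv (mul_mem_tensorGrade (Nat.sub_add_cancel hlm) hv' hu)
      obtain ⟨k, w, i, j, a, b, hw, hi, hua, hvb, hj⟩ :=
        ih (l + (m - l)) (by omega) hu hv' hu0 (right_ne_zero_of_mul hv0) hcomm rfl
      refine ⟨k, w, i, i + j, a, a * b, hw, hi, hua, ?_, by rw [add_mul]; omega⟩
      rw [hua, hvb, smul_mul_smul_comm, pow_add]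

/-- If the commutator of homogeneous elements `u` and `v` is a multiple of a power of `u`, then
it vanishes. -/
lemma smul_pow_eq_zero_of_commutator_eq {l k : ℕ} {u v : TensorAlgebra K H} {c : K}
    (hu : u ∈ tensorGrade K H l) (hne : u ≠ 0) (hv : v ∈ tensorGrade K H (k * l))
    (h : u * v - v * u = c • u ^ (k + 1)) : c • u ^ (k + 1) = 0 := by
  induction k generalizing v with
  | zero =>
    rw [zero_mul] at hv
    obtain ⟨r, rfl⟩ := mem_tensorGrade_zero.1 hv
    rw [← h, Algebra.commutes, sub_self]
  | succ k ih =>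
    have hpow := pow_mem_tensorGrade hu (k + 1)
    obtain ⟨v', hv', rfl⟩ := exists_eq_mul (k := k * l) (m := (k + 1) * l) (by ring) hu hne
      (x := v - c • u ^ (k + 1)) (sub_mem hv (Submodule.smul_mem _ _ hpow))
      (v := v) (by rw [mul_sub, mul_smul_comm, ← pow_succ', ← h, sub_sub_cancel])
    have h' : u * v' - v' * u = c • u ^ (k + 1) := by
      refine sub_eq_zero.1 (eq_zero_of_mul_eq_zero (m := (k + 1) * l) hne ?_ ?_)
      · exact sub_mem (sub_mem hv (mul_mem_tensorGrade (by ring) hv' hu))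
          (Submodule.smul_mem _ _ hpow)
      · rw [mul_sub, mul_sub, ← mul_assoc u v' u, h, mul_smul_comm, ← pow_succ', sub_self]
    rw [pow_succ', ← mul_smul_comm, ih hv' h', mul_zero]

/-- A homogeneous element commuting with a reduced element `u` is a multiple of a power of `u`. -/
lemma mem_adjoin_of_commute {l m : ℕ} (hl : 1 ≤ l) {u v : TensorAlgebra K H}
    (hu : u ∈ tensorGrade K H l) (hne : u ≠ 0) (hred : IsReduced' K H l u)
    (hv : v ∈ tensorGrade K H m) (h : u * v = v * u) :
    v ∈ (Algebra.adjoin K {u} : Subalgebra K (TensorAlgebra K H)) := by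
  rcases eq_or_ne v 0 with rfl | hv0
  · exact zero_mem _
  obtain ⟨k, w, i, j, a, b, hw, hi, hua, rfl, -⟩ := exists_common_root hu hv hne hv0 h
  have hi0 : 0 < i := Nat.pos_of_ne_zero (by rintro rfl; omega)
  have hk : l / i = k := by rw [← hi, Nat.mul_div_cancel_left _ hi0]
  obtain rfl : i = 1 := hred i ⟨k, hi.symm⟩ a w (hk ▸ hw) hua
  have ha : a ≠ 0 := by
    rintro rfl
    exact hne (by rw [hua, zero_smul])
  have hwu : w = a⁻¹ • u := by rw [hua, pow_one, inv_smul_smul₀ ha]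
  have hw' : w ∈ (Algebra.adjoin K {u} : Subalgebra K (TensorAlgebra K H)) :=
    hwu ▸ Subalgebra.smul_mem _ (Algebra.self_mem_adjoin_singleton K u) _
  exact Subalgebra.smul_mem _ (pow_mem hw' j) b

end Field

end TensorAlgebra

/-- **normalizer version.** For a non-zero reduced `u₀ ∈ H^{⊗l}` (`l ≥ 1`),
`{v ∈ T(H) | [u₀, v]` is a polynomial in `u₀}` equals the unital subalgebra
generated by `u₀`. -/
theorem stmt_4 (K H : Type*) [Field K] [CharZero K] [AddCommGroup H] [Module K H]
    [FiniteDimensional K H] (l : ℕ) (hl : 1 ≤ l) (u₀ : TensorAlgebra K H)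
    (hu₀ : u₀ ∈ tensorGrade K H l) (hne : u₀ ≠ 0) (hred : IsReduced' K H l u₀) :
    {v : TensorAlgebra K H |
        u₀ * v - v * u₀ ∈ (Algebra.adjoin K {u₀} : Subalgebra K (TensorAlgebra K H))}
      = ↑(Algebra.adjoin K {u₀} : Subalgebra K (TensorAlgebra K H)) := by
  ext v
  simp only [Set.mem_ofPred_eq, SetLike.mem_coe]
  have hself := Algebra.self_mem_adjoin_singleton K u₀
  refine ⟨fun h => ?_, fun h => sub_mem (mul_mem hself h) (mul_mem h hself)⟩
  rw [Algebra.adjoin_singleton_eq_range_aeval] at h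
  obtain ⟨p, hp⟩ := h
  replace hp : Polynomial.aeval u₀ p = u₀ * v - v * u₀ := hp
  classical
  rw [← DirectSum.sum_support_decompose (tensorGrade K H) v]
  refine sum_mem fun m _ => ?_
  set x := DirectSum.decompose (tensorGrade K H) v m
  have hcomp : u₀ * (x : TensorAlgebra K H) - x * u₀ =
      DirectSum.decompose (tensorGrade K H) (Polynomial.aeval u₀ p) (m + l) := by
    rw [hp, DirectSum.decompose_sub, DirectSum.sub_apply, AddSubgroupClass.coe_sub,
      DirectSum.coe_decompose_mul_add_of_right_mem (tensorGrade K H) hu₀, add_comm m l,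
      DirectSum.coe_decompose_mul_add_of_left_mem (tensorGrade K H) hu₀]
  refine TensorAlgebra.mem_adjoin_of_commute hl hu₀ hne hred x.2 (sub_eq_zero.1 ?_)
  rw [TensorAlgebra.decompose_aeval hl hu₀] at hcomp
  split_ifs at hcomp with hdvd
  · obtain ⟨k, hk⟩ := (Nat.dvd_add_left dvd_rfl).1 hdvd
    have hk' : (m + l) / l = k + 1 := by
      rw [hk, ← Nat.mul_succ, Nat.mul_div_cancel_left _ hl]
    rw [hk'] at hcomp
    rw [hcomp]
    refine TensorAlgebra.smul_pow_eq_zero_of_commutator_eq hu₀ hne ?_ hcomp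
    rw [mul_comm]
    exact hk ▸ x.2
  · exact hcomp
end

section
/- Let K be a field of characteristic zero, let g, n ≥ 0, and let A be the free associative unital K-algebra on the generators x₁,…,x_g, y₁,…,y_g, z₁,…,z_n. Set ω = Σ_{i=1}^g (x_i y_i − y_i x_i) + Σ_{j=1}^n z_j. Then every element a ∈ A satisfying a·ω = ω·a lies in the unital subalgebra of A generated by ω, i.e. a is a polynomial in ω with coefficients in K. -/
namespace FreeAlgebra

variable {K X : Type*} [Field K]

/-- The algebra morphism `a ↦ !![ε a, ∂ₑ a; 0, a]`, where `ε` is the augmentation and `∂ₑ` is the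
Fox derivative with respect to the generator `e`. -/
noncomputable def foxMatrix [DecidableEq X] (e : X) :
    FreeAlgebra K X →ₐ[K] Matrix (Fin 2) (Fin 2) (FreeAlgebra K X) :=
  lift K fun f => !![0, if e = f then 1 else 0; 0, ι K f]

/-- The Fox derivative `∂ₑ`, characterised by `∂ₑ f = δ_{ef}` on generators and
`∂ₑ (u * v) = ∂ₑ u * v + ε u • ∂ₑ v`. -/
noncomputable def foxDeriv [DecidableEq X] (e : X) : FreeAlgebra K X →ₗ[K] FreeAlgebra K X where
  toFun a := foxMatrix e a 0 1
  map_add' a b := by simp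
  map_smul' c a := by simp

theorem foxMatrix_apply [DecidableEq X] (e : X) (a : FreeAlgebra K X) :
    foxMatrix e a = !![algebraMap K _ (algebraMapInv a), foxDeriv e a; 0, a] := by
  have h : foxMatrix e a 0 0 = algebraMap K _ (algebraMapInv a) ∧
      foxMatrix e a 1 0 = 0 ∧ foxMatrix e a 1 1 = a := by
    induction a using FreeAlgebra.induction with
    | grade0 r => simp [Matrix.algebraMap_matrix_apply, algebraMapInv]
    | grade1 f => simp [foxMatrix, algebraMapInv]
    | mul a b ha hb => simp [Matrix.mul_apply, ha, hb]
    | add a b ha hb => simp [ha, hb]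
  ext i j
  fin_cases i <;> fin_cases j <;> simp [h, foxDeriv]

theorem foxDeriv_mul [DecidableEq X] (e : X) (a b : FreeAlgebra K X) :
    foxDeriv e (a * b) = foxDeriv e a * b + algebraMapInv a • foxDeriv e b := by
  have h := congrFun (congrFun (map_mul (foxMatrix e) a b) 0) 1
  simp only [foxMatrix_apply, Matrix.mul_apply, Fin.sum_univ_two] at h
  simpa [Algebra.smul_def, add_comm] using h

@[simp]
theorem foxDeriv_ι [DecidableEq X] (e f : X) :
    foxDeriv e (ι K f) = if e = f then 1 else 0 := by
  simp [foxDeriv, foxMatrix]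

@[simp]
theorem foxDeriv_one [DecidableEq X] (e : X) : foxDeriv e (1 : FreeAlgebra K X) = 0 := by
  simp [foxDeriv]

@[simp]
theorem algebraMapInv_ι (f : X) : algebraMapInv (ι K f) = 0 := by
  simp [algebraMapInv]

@[simp]
theorem foxDeriv_ι_mul [DecidableEq X] (e f : X) (a : FreeAlgebra K X) :
    foxDeriv e (ι K f * a) = if e = f then a else 0 := by
  simp [foxDeriv_mul]

/-- The commutation relation with an element of zero augmentation, after a Fox derivative. -/
theorem foxDeriv_mul_of_commute [DecidableEq X] (e : X) {a w : FreeAlgebra K X}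
    (hw : algebraMapInv w = 0) (h : a * w = w * a) :
    foxDeriv e a * w = foxDeriv e w * (a - algebraMap K _ (algebraMapInv a)) := by
  have h' := congrArg (foxDeriv e) h
  rw [foxDeriv_mul, foxDeriv_mul, hw, zero_smul, add_zero] at h'
  rw [mul_sub, ← h', ← Algebra.commutes, ← Algebra.smul_def, add_sub_cancel_right]

theorem span_range_list_prod :
    Submodule.span K (Set.range fun l : List X => (l.map (ι K)).prod) = ⊤ := by
  rw [eq_top_iff]
  rintro a -
  induction a using FreeAlgebra.induction with
  | grade0 r =>
    rw [Algebra.algebraMap_eq_smul_one]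
    exact Submodule.smul_mem _ _ (Submodule.subset_span ⟨[], by simp⟩)
  | grade1 f => exact Submodule.subset_span ⟨[f], by simp⟩
  | add a b ha hb => exact Submodule.add_mem _ ha hb
  | mul a b ha hb =>
    have := Submodule.mul_mem_mul ha hb
    rw [Submodule.span_mul_span] at this
    refine Submodule.span_mono ?_ this
    rintro _ ⟨_, ⟨l, rfl⟩, _, ⟨m, rfl⟩, rfl⟩
    exact ⟨l ++ m, by simp⟩

/-- An endomorphism sending each word to zero or to a shorter word is locally nilpotent. -/
theorem exists_pow_apply_eq_zero (D : Module.End K (FreeAlgebra K X))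
    (hD : ∀ l : List X, D (l.map (ι K)).prod = 0 ∨
      ∃ m : List X, m.length < l.length ∧ D (l.map (ι K)).prod = (m.map (ι K)).prod)
    (a : FreeAlgebra K X) : ∃ N, (D ^ N) a = 0 := by
  have hword : ∀ (N : ℕ) (l : List X), l.length < N → (D ^ N) (l.map (ι K)).prod = 0 := by
    intro N
    induction N with
    | zero => simp
    | succ N ih =>
      intro l hl
      rw [pow_succ, Module.End.mul_apply]
      rcases hD l with h | ⟨m, hm, h⟩
      · rw [h, map_zero]
      · rw [h, ih m (by omega)]
  have ha : a ∈ Submodule.span K (Set.range fun l : List X => (l.map (ι K)).prod) := by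
    rw [span_range_list_prod]; trivial
  have hle : Submodule.span K (Set.range fun l : List X => (l.map (ι K)).prod) ≤
      D.maxGenEigenspace 0 := by
    rw [Submodule.span_le]
    rintro _ ⟨l, rfl⟩
    rw [SetLike.mem_coe, Module.End.mem_maxGenEigenspace]
    exact ⟨l.length + 1, by simpa using hword _ l (Nat.lt_succ_self _)⟩
  simpa [Module.End.mem_maxGenEigenspace] using hle ha

theorem foxDeriv_list_prod [DecidableEq X] (e : X) (l : List X) :
    foxDeriv e (l.map (ι K)).prod = 0 ∨
      ∃ m : List X, m.length < l.length ∧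
        foxDeriv e (l.map (ι K)).prod = (m.map (ι K)).prod := by
  cases l with
  | nil => simp
  | cons f m =>
    by_cases h : e = f
    · exact Or.inr ⟨m, by simp, by simp [h]⟩
    · exact Or.inl (by simp [h])

theorem foxDeriv_foxDeriv_list_prod [DecidableEq X] (e f : X) (l : List X) :
    foxDeriv f (foxDeriv e (l.map (ι K)).prod) = 0 ∨
      ∃ m : List X, m.length < l.length ∧
        foxDeriv f (foxDeriv e (l.map (ι K)).prod) = (m.map (ι K)).prod := by
  rcases foxDeriv_list_prod (K := K) e l with h | ⟨m, hm, h⟩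
  · simp [h]
  · rw [h]
    rcases foxDeriv_list_prod (K := K) f m with h' | ⟨m', hm', h'⟩
    · exact Or.inl h'
    · exact Or.inr ⟨m', hm'.trans hm, h'⟩

end FreeAlgebra

/-- If every element commuting with `w` has a quotient `D a` by `w` with scalar remainder, and `D`
is locally nilpotent, then the centralizer of `w` is the algebra of polynomials in `w`. -/
theorem Algebra.mem_adjoin_singleton_of_commute {K A : Type*} [CommRing K] [Ring A] [Algebra K A]
    [NoZeroDivisors A] {w : A} (hw : w ≠ 0) (D : Module.End K A)
    (hnil : ∀ a, ∃ N, (D ^ N) a = 0)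
    (hD : ∀ a, a * w = w * a → ∃ c : K, a = algebraMap K A c + D a * w)
    (a : A) (ha : a * w = w * a) : a ∈ Algebra.adjoin K {w} := by
  obtain ⟨N, hN⟩ := hnil a
  induction N generalizing a with
  | zero =>
    obtain rfl : a = 0 := by simpa using hN
    exact zero_mem _
  | succ N ih =>
    obtain ⟨c, hc⟩ := hD a ha
    have hcomm : D a * w = w * D a := by
      refine mul_right_cancel₀ hw ?_
      rw [hc, add_mul, mul_add, Algebra.commutes c w] at ha
      rw [add_left_cancel ha, mul_assoc]
    rw [hc]
    exact add_mem (Subalgebra.algebraMap_mem _ c)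
      (mul_mem (ih (D a) hcomm (by rwa [pow_succ] at hN)) (Algebra.self_mem_adjoin_singleton K w))


/-- Let `A` be the free associative unital `K`-algebra on the generators
`x₁,…,x_g, y₁,…,y_g, z₁,…,z_n` (`K` a field of characteristic zero), and let
`ω = Σᵢ (xᵢyᵢ − yᵢxᵢ) + Σⱼ zⱼ`.  Every `a ∈ A` commuting with `ω` is a polynomial
in `ω` with coefficients in `K`. -/
theorem stmt_5 (K : Type*) [Field K] [CharZero K] (g n : ℕ)
    (ω : FreeAlgebra K (Fin g ⊕ Fin g ⊕ Fin n))
    (hω : ω = (∑ i : Fin g,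
        (FreeAlgebra.ι K (Sum.inl i) * FreeAlgebra.ι K (Sum.inr (Sum.inl i)) -
          FreeAlgebra.ι K (Sum.inr (Sum.inl i)) * FreeAlgebra.ι K (Sum.inl i))) +
      ∑ j : Fin n, FreeAlgebra.ι K (Sum.inr (Sum.inr j)))
    (a : FreeAlgebra K (Fin g ⊕ Fin g ⊕ Fin n)) (ha : a * ω = ω * a) :
    a ∈ (Algebra.adjoin K {ω} : Subalgebra K (FreeAlgebra K (Fin g ⊕ Fin g ⊕ Fin n))) := by
  have haug : FreeAlgebra.algebraMapInv ω = 0 := by simp [hω]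
  rcases n with _ | n
  · rcases g with _ | g
    · obtain ⟨r, rfl⟩ : ∃ r, algebraMap K _ r = a := by
        clear ha
        induction a using FreeAlgebra.induction with
        | grade0 r => exact ⟨r, rfl⟩
        | grade1 f => exact f.elim (fun i => i.elim0) (fun f => f.elim Fin.elim0 Fin.elim0)
        | mul a b ha hb =>
          obtain ⟨r, rfl⟩ := ha
          obtain ⟨s, rfl⟩ := hb
          exact ⟨r * s, map_mul _ _ _⟩
        | add a b ha hb =>
          obtain ⟨r, rfl⟩ := ha
          obtain ⟨s, rfl⟩ := hb
          exact ⟨r + s, map_add _ _ _⟩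
      exact Subalgebra.algebraMap_mem _ r
    · have hx : FreeAlgebra.foxDeriv (Sum.inl 0) ω = FreeAlgebra.ι K (Sum.inr (Sum.inl 0)) := by
        simp [hω]
      have hω0 : ω ≠ 0 := by
        rintro rfl
        have := congrArg (FreeAlgebra.foxDeriv (Sum.inr (Sum.inl 0))) hx
        simp at this
      have hab : FreeAlgebra.lift K (fun _ => (1 : K)) ω = 0 := by simp [hω]
      refine Algebra.mem_adjoin_singleton_of_commute hω0
        (FreeAlgebra.foxDeriv (Sum.inr (Sum.inl 0)) * FreeAlgebra.foxDeriv (Sum.inl 0))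
        (FreeAlgebra.exists_pow_apply_eq_zero _
          (FreeAlgebra.foxDeriv_foxDeriv_list_prod _ _)) (fun b hb => ?_) a ha
      have h := FreeAlgebra.foxDeriv_mul_of_commute (Sum.inl 0) haug hb
      rw [hx] at h
      have hxx := congrArg (FreeAlgebra.foxDeriv (Sum.inl 0)) h
      rw [FreeAlgebra.foxDeriv_mul, hx] at hxx
      have hd : FreeAlgebra.algebraMapInv (FreeAlgebra.foxDeriv (Sum.inl 0) b) = 0 := by
        simpa [hab] using congrArg (FreeAlgebra.lift K (fun _ => (1 : K))) hxx
      have hxy := congrArg (FreeAlgebra.foxDeriv (Sum.inr (Sum.inl 0))) h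
      rw [FreeAlgebra.foxDeriv_mul, hd, zero_smul, add_zero, FreeAlgebra.foxDeriv_ι_mul,
        if_pos rfl] at hxy
      exact ⟨_, by rw [Module.End.mul_apply, hxy, add_sub_cancel]⟩
  · have hz : FreeAlgebra.foxDeriv (Sum.inr (Sum.inr 0)) ω = 1 := by simp [hω]
    have hω0 : ω ≠ 0 := by
      rintro rfl
      simp at hz
    refine Algebra.mem_adjoin_singleton_of_commute hω0
      (FreeAlgebra.foxDeriv (Sum.inr (Sum.inr 0)))
      (FreeAlgebra.exists_pow_apply_eq_zero _ (FreeAlgebra.foxDeriv_list_prod _))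
      (fun b hb => ⟨FreeAlgebra.algebraMapInv b, ?_⟩) a ha
    rw [FreeAlgebra.foxDeriv_mul_of_commute _ haug hb, hz, one_mul, add_sub_cancel]
end

section
/- Let K be a field of characteristic zero and let A be the free associative unital K-algebra on the letters x₁,…,x_g, y₁,…,y_g, z₁,…,z_n. Define the K-bilinear map Π_gr : A × A → A⊗A on monomials (words in the letters) u = u₁⋯u_l and v = v₁⋯v_m by Π_gr(u,v) = Σ_{i,j} ⟨u_i,v_j⟩ (v₁⋯v_{j−1}u_{i+1}⋯u_l) ⊗ (u₁⋯u_{i−1}v_{j+1}⋯v_m) + Σ_{i,j} (v₁⋯v_{j−1}·𝔷(v_j,u_i)·u_{i+1}⋯u_l) ⊗ (u₁⋯u_{i−1}v_{j+1}⋯v_m) − Σ_{i,j} (v₁⋯v_{j−1}u_{i+1}⋯u_l) ⊗ (u₁⋯u_{i−1}·𝔷(u_i,v_j)·v_{j+1}⋯v_m). Then Π_gr is a double bracket on A, i.e. for all a, b, c ∈ A: Π_gr(a,bc) = Π_gr(a,b)·(1⊗c) + (b⊗1)·Π_gr(a,c) and Π_gr(ab,c) = Π_gr(a,c)·(b⊗1)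 + (1⊗a)·Π_gr(b,c); moreover for any two letters u, v one has Π_gr(u,v) = ⟨u,v⟩·(1⊗1) + 𝔷(u,v)⊗1 − 1⊗𝔷(u,v). -/
open TensorProduct

/-- The alphabet `x₁,…,x_g, y₁,…,y_g, z₁,…,z_n`. -/
abbrev GTLetter (g n : ℕ) := Fin g ⊕ Fin g ⊕ Fin n

/-- The skew pairing on letters: `⟨xᵢ,yᵢ⟩ = 1`, `⟨yᵢ,xᵢ⟩ = −1`, all other pairs `0`. -/
def gtPairing (K : Type*) [Field K] {g n : ℕ} : GTLetter g n → GTLetter g n → K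
  | Sum.inl i, Sum.inr (Sum.inl i') => if i = i' then 1 else 0
  | Sum.inr (Sum.inl i), Sum.inl i' => if i = i' then -1 else 0
  | _, _ => 0

/-- The symmetric letter-valued pairing `𝔷`: `𝔷(zⱼ,zⱼ) = zⱼ`, all other pairs `0`. -/
def gtZ (K : Type*) [Field K] {g n : ℕ} :
    GTLetter g n → GTLetter g n → FreeAlgebra K (GTLetter g n)
  | Sum.inr (Sum.inr j), Sum.inr (Sum.inr j') =>
      if j = j' then FreeAlgebra.ι K (Sum.inr (Sum.inr j)) else 0
  | _, _ => 0

/-- The monomial (word) in `A` associated with a list of letters. -/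
def wordProd (K : Type*) [Field K] {g n : ℕ} (w : List (GTLetter g n)) :
    FreeAlgebra K (GTLetter g n) :=
  (w.map (FreeAlgebra.ι K)).prod

/-- The defining formula of `Π_gr` on monomials `u = u₁⋯u_l`, `v = v₁⋯v_m`. -/
noncomputable def gtPiGrFormula (K : Type*) [Field K] {g n : ℕ} (u v : List (GTLetter g n)) :
    FreeAlgebra K (GTLetter g n) ⊗[K] FreeAlgebra K (GTLetter g n) :=
  ∑ i : Fin u.length, ∑ j : Fin v.length,
    (gtPairing K (u.get i) (v.get j) •
      (wordProd K (v.take j.1 ++ u.drop (i.1 + 1)) ⊗ₜ[K]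
        wordProd K (u.take i.1 ++ v.drop (j.1 + 1)))
    + (wordProd K (v.take j.1) * gtZ K (v.get j) (u.get i) * wordProd K (u.drop (i.1 + 1)))
        ⊗ₜ[K] wordProd K (u.take i.1 ++ v.drop (j.1 + 1))
    - wordProd K (v.take j.1 ++ u.drop (i.1 + 1)) ⊗ₜ[K]
        (wordProd K (u.take i.1) * gtZ K (u.get i) (v.get j) * wordProd K (v.drop (j.1 + 1))))

theorem wordProd_append (K : Type*) [Field K] {g n : ℕ} (u v : List (GTLetter g n)) :
    wordProd K (u ++ v) = wordProd K u * wordProd K v := by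
  simp [wordProd]

theorem span_range_wordProd (K : Type*) [Field K] (g n : ℕ) :
    Submodule.span K (Set.range (wordProd K : List (GTLetter g n) → _)) = ⊤ := by
  rw [eq_top_iff, ← Algebra.top_toSubmodule, ← FreeAlgebra.adjoin_range_ι, Algebra.adjoin_eq_span]
  refine Submodule.span_mono fun x hx => ?_
  induction hx using Submonoid.closure_induction with
  | mem x hx =>
    obtain ⟨a, rfl⟩ := hx
    exact ⟨[a], by simp [wordProd]⟩
  | one => exact ⟨[], by simp [wordProd]⟩
  | mul x y _ _ hx hy =>
    obtain ⟨u, rfl⟩ := hx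
    obtain ⟨v, rfl⟩ := hy
    exact ⟨u ++ v, wordProd_append K u v⟩

theorem wordProd_induction {K : Type*} [Field K] {g n : ℕ}
    {p : FreeAlgebra K (GTLetter g n) → Prop} (word : ∀ w, p (wordProd K w)) (zero : p 0)
    (add : ∀ a b, p a → p b → p (a + b)) (smul : ∀ (r : K) a, p a → p (r • a))
    (a : FreeAlgebra K (GTLetter g n)) : p a := by
  have ha : a ∈ Submodule.span K (Set.range (wordProd K : List (GTLetter g n) → _)) := by
    rw [span_range_wordProd]
    exact Submodule.mem_top
  induction ha using Submodule.span_induction with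
  | mem x hx =>
    obtain ⟨w, rfl⟩ := hx
    exact word w
  | zero => exact zero
  | add x y _ _ hx hy => exact add x y hx hy
  | smul r x _ hx => exact smul r x hx

/-- A sum over the positions of a concatenation splits into the sums over the positions of
the two parts. -/
theorem sum_positions_append {α M : Type*} [AddCommMonoid M] (l₁ l₂ : List α)
    (F : List α → α → List α → M) :
    ∑ i : Fin (l₁ ++ l₂).length,
        F ((l₁ ++ l₂).take i.1) ((l₁ ++ l₂).get i) ((l₁ ++ l₂).drop (i.1 + 1)) =
      ∑ i : Fin l₁.length, F (l₁.take i.1) (l₁.get i) (l₁.drop (i.1 + 1) ++ l₂) +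
        ∑ i : Fin l₂.length, F (l₁ ++ l₂.take i.1) (l₂.get i) (l₂.drop (i.1 + 1)) := by
  induction l₁ generalizing F with
  | nil => simp
  | cons a l ih =>
    have h := ih fun p b s => F (a :: p) b s
    simp only [List.cons_append, List.length_cons, Fin.sum_univ_succ]
    simpa [add_assoc] using congrArg (F [] a (l ++ l₂) + ·) h

/-- The contribution to `Π_gr` of the letters `a` of `p a s` and `b` of `q b t`. -/
noncomputable def gtPiGrTerm (K : Type*) [Field K] {g n : ℕ} (p : List (GTLetter g n))
    (a : GTLetter g n) (s q : List (GTLetter g n)) (b : GTLetter g n)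
    (t : List (GTLetter g n)) :
    FreeAlgebra K (GTLetter g n) ⊗[K] FreeAlgebra K (GTLetter g n) :=
  gtPairing K a b • (wordProd K (q ++ s) ⊗ₜ[K] wordProd K (p ++ t))
    + (wordProd K q * gtZ K b a * wordProd K s) ⊗ₜ[K] wordProd K (p ++ t)
    - wordProd K (q ++ s) ⊗ₜ[K] (wordProd K p * gtZ K a b * wordProd K t)

theorem gtPiGrFormula_eq_sum (K : Type*) [Field K] {g n : ℕ} (u v : List (GTLetter g n)) :
    gtPiGrFormula K u v = ∑ i : Fin u.length, ∑ j : Fin v.length,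
      gtPiGrTerm K (u.take i.1) (u.get i) (u.drop (i.1 + 1))
        (v.take j.1) (v.get j) (v.drop (j.1 + 1)) := rfl

theorem smul_mul_freeAlgebra_tmul {K X : Type*} [Field K] (r : K)
    (a b : FreeAlgebra K X ⊗[K] FreeAlgebra K X) : (r • a) * b = r • (a * b) :=
  Algebra.smul_mul_assoc r a b

theorem mul_smul_freeAlgebra_tmul {K X : Type*} [Field K] (r : K)
    (a b : FreeAlgebra K X ⊗[K] FreeAlgebra K X) : a * (r • b) = r • (a * b) :=
  Algebra.mul_smul_comm r a b

theorem gtPiGrFormula_append_right (K : Type*) [Field K] {g n : ℕ}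
    (u v w : List (GTLetter g n)) :
    gtPiGrFormula K u (v ++ w) =
      gtPiGrFormula K u v * ((1 : FreeAlgebra K (GTLetter g n)) ⊗ₜ[K] wordProd K w) +
        (wordProd K v ⊗ₜ[K] (1 : FreeAlgebra K (GTLetter g n))) * gtPiGrFormula K u w := by
  simp only [gtPiGrFormula_eq_sum, Finset.sum_mul, Finset.mul_sum, ← Finset.sum_add_distrib]
  refine Finset.sum_congr rfl fun i _ => ?_
  rw [sum_positions_append v w fun q b t =>
    gtPiGrTerm K (u.take i.1) (u.get i) (u.drop (i.1 + 1)) q b t]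
  simp [gtPiGrTerm, wordProd_append, add_mul, sub_mul, mul_add, mul_sub, mul_assoc,
    smul_mul_freeAlgebra_tmul, mul_smul_freeAlgebra_tmul]

theorem gtPiGrFormula_append_left (K : Type*) [Field K] {g n : ℕ}
    (u v w : List (GTLetter g n)) :
    gtPiGrFormula K (u ++ v) w =
      gtPiGrFormula K u w * (wordProd K v ⊗ₜ[K] (1 : FreeAlgebra K (GTLetter g n))) +
        ((1 : FreeAlgebra K (GTLetter g n)) ⊗ₜ[K] wordProd K u) * gtPiGrFormula K v w := by
  simp only [gtPiGrFormula_eq_sum, Finset.sum_mul, Finset.mul_sum]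
  rw [sum_positions_append u v fun p a s => ∑ j : Fin w.length,
    gtPiGrTerm K p a s (w.take j.1) (w.get j) (w.drop (j.1 + 1))]
  simp [gtPiGrTerm, wordProd_append, add_mul, sub_mul, mul_add, mul_sub, mul_assoc,
    smul_mul_freeAlgebra_tmul, mul_smul_freeAlgebra_tmul]

theorem gtZ_comm (K : Type*) [Field K] {g n : ℕ} (u v : GTLetter g n) :
    gtZ K u v = gtZ K v u := by
  rcases u with i | i | i <;> rcases v with j | j | j <;> simp only [gtZ]
  by_cases h : i = j
  · rw [h]
  · rw [if_neg h, if_neg (Ne.symm h)]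

/-- The bilinear map `Π_gr` on `A = K⟨x₁,…,x_g,y₁,…,y_g,z₁,…,z_n⟩`
defined on monomials by the explicit formula is a double bracket, i.e. it satisfies
the two Leibniz-type rules; moreover on letters `u`, `v` it is given by
`Π_gr(u,v) = ⟨u,v⟩(1⊗1) + 𝔷(u,v)⊗1 − 1⊗𝔷(u,v)`. -/
theorem stmt_6 (K : Type*) [Field K] [CharZero K] (g n : ℕ)
    (P : FreeAlgebra K (GTLetter g n) →ₗ[K] FreeAlgebra K (GTLetter g n) →ₗ[K]
      FreeAlgebra K (GTLetter g n) ⊗[K] FreeAlgebra K (GTLetter g n))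
    (hP : ∀ u v : List (GTLetter g n),
      P (wordProd K u) (wordProd K v) = gtPiGrFormula K u v) :
    (∀ a b c : FreeAlgebra K (GTLetter g n),
        P a (b * c) = P a b * ((1 : FreeAlgebra K (GTLetter g n)) ⊗ₜ[K] c) +
          (b ⊗ₜ[K] (1 : FreeAlgebra K (GTLetter g n))) * P a c) ∧
    (∀ a b c : FreeAlgebra K (GTLetter g n),
        P (a * b) c = P a c * (b ⊗ₜ[K] (1 : FreeAlgebra K (GTLetter g n))) +
          ((1 : FreeAlgebra K (GTLetter g n)) ⊗ₜ[K] a) * P b c) ∧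
    (∀ u v : GTLetter g n,
        P (FreeAlgebra.ι K u) (FreeAlgebra.ι K v) =
          gtPairing K u v •
              ((1 : FreeAlgebra K (GTLetter g n)) ⊗ₜ[K] (1 : FreeAlgebra K (GTLetter g n)))
            + gtZ K u v ⊗ₜ[K] (1 : FreeAlgebra K (GTLetter g n))
            - (1 : FreeAlgebra K (GTLetter g n)) ⊗ₜ[K] gtZ K u v) := by
  refine ⟨fun a b c => ?_, fun a b c => ?_, fun u v => ?_⟩
  · induction a using wordProd_induction with
    | zero => simp
    | add x y hx hy => simp only [map_add, LinearMap.add_apply, hx, hy, add_mul, mul_add]; abel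
    | smul r x hx => simp [hx, smul_mul_freeAlgebra_tmul, mul_smul_freeAlgebra_tmul]
    | word u =>
    induction b using wordProd_induction with
    | zero => simp
    | add x y hx hy => simp only [map_add, TensorProduct.add_tmul, hx, hy, add_mul]; abel
    | smul r x hx => simp [hx, ← TensorProduct.smul_tmul', smul_mul_freeAlgebra_tmul]
    | word v =>
    induction c using wordProd_induction with
    | zero => simp
    | add x y hx hy => simp only [map_add, TensorProduct.tmul_add, hx, hy, mul_add]; abel
    | smul r x hx => simp [hx, mul_smul_freeAlgebra_tmul]
    | word w => rw [← wordProd_append, hP, hP, hP, gtPiGrFormula_append_right]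
  · induction a using wordProd_induction with
    | zero => simp
    | add x y hx hy =>
      simp only [map_add, LinearMap.add_apply, TensorProduct.tmul_add, hx, hy, add_mul]; abel
    | smul r x hx => simp [hx, smul_mul_freeAlgebra_tmul]
    | word u =>
    induction b using wordProd_induction with
    | zero => simp
    | add x y hx hy =>
      simp only [map_add, LinearMap.add_apply, TensorProduct.add_tmul, hx, hy, mul_add]; abel
    | smul r x hx => simp [hx, ← TensorProduct.smul_tmul', mul_smul_freeAlgebra_tmul]
    | word v =>
    induction c using wordProd_induction with
    | zero => simp
    | add x y hx hy => simp only [map_add, hx, hy, add_mul, mul_add]; abel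
    | smul r x hx => simp [hx, smul_mul_freeAlgebra_tmul, mul_smul_freeAlgebra_tmul]
    | word w => rw [← wordProd_append, hP, hP, hP, gtPiGrFormula_append_left]
  · have h := hP [u] [v]
    simpa [wordProd, gtPiGrFormula, gtZ_comm K v u] using h
end

section
/- Let K be a field of characteristic zero, let A be the free associative unital K-algebra on x₁,…,x_g, y₁,…,y_g, z₁,…,z_n, and let Π_gr be the double bracket defined on monomials by the explicit formula above. Define B : A × A → |A| by B(a,b) = |m(Π_gr(a,b))|, where m : A⊗A → A is the multiplication and |·| : A → |A| = A/[A,A] is the projection. Then the set {a ∈ A | B(a,b) = 0 for all b ∈ A} equals [A,A] + span_K{ω^l : l ≥ 0} + span_K{z_j^l : 1 ≤ j ≤ n, l ≥ 1}, where ω = Σ_{i=1}^g (x_i y_i − y_i x_i) + Σ_{j=1}^n z_j. In other words, the center of the induced Lie bracket on |A| is spanned by the classes |ω^l| and |z_j^l|. -/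
open TensorProduct

section ListLemmas

variable {α : Type*}

theorem List.IsRotated.exists_append {u v : List α} (h : List.IsRotated u v) :
    ∃ l₁ l₂ : List α, u = l₁ ++ l₂ ∧ v = l₂ ++ l₁ := by
  obtain ⟨n, hn, rfl⟩ := List.isRotated_iff_mod.1 h
  exact ⟨u.take n, u.drop n, (List.take_append_drop n u).symm,
    List.rotate_eq_drop_append_take hn⟩

theorem List.eq_replicate_of_append_eq_replicate_append {c : α} {l s w : List α} {B : ℕ}
    (h : l ++ s = List.replicate B c ++ w) (hl : l.length ≤ B) :
    l = List.replicate l.length c := by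
  rw [List.eq_replicate_iff]
  refine ⟨rfl, fun b hb => ?_⟩
  have : l <+: List.replicate B c := by
    refine List.prefix_of_prefix_length_le (l₃ := l ++ s) (List.prefix_append _ _) ?_ (by simpa)
    rw [h]; exact List.prefix_append _ _
  exact List.eq_of_mem_replicate (this.subset hb)

theorem List.replicate_append_cons_inj {c d d' : α} (hd : d ≠ c) (hd' : d' ≠ c) {k k' : ℕ}
    {t t' : List α} (h : List.replicate k c ++ d :: t = List.replicate k' c ++ d' :: t') :
    k = k' ∧ d = d' ∧ t = t' := by
  induction k generalizing k' with
  | zero =>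
    cases k' with
    | zero => simpa using h
    | succ k' =>
      simp only [List.replicate_zero, List.nil_append, List.replicate_succ, List.cons_append,
        List.cons.injEq] at h
      exact absurd h.1 hd
  | succ k ih =>
    cases k' with
    | zero =>
      simp only [List.replicate_zero, List.nil_append, List.replicate_succ, List.cons_append,
        List.cons.injEq] at h
      exact absurd h.1.symm hd'
    | succ k' =>
      simp only [List.replicate_succ, List.cons_append, List.cons.injEq, true_and] at h
      have := ih h
      exact ⟨by omega, this.2⟩

variable [DecidableEq α]

/-- Move all trailing occurrences of the letter `c` to the front of a word. -/
def List.trailToFront (c : α) (v : List α) : List α :=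
  List.replicate (v.rtakeWhile (· = c)).length c ++ v.rdropWhile (· = c)

theorem List.trailToFront_nil (c : α) : List.trailToFront c [] = [] := rfl

theorem List.trailToFront_concat_self (c : α) (v : List α) :
    List.trailToFront c (v ++ [c]) = c :: List.trailToFront c v := by
  simp [List.trailToFront, List.replicate_succ]

theorem List.trailToFront_concat_of_ne {c e : α} (he : e ≠ c) (v : List α) :
    List.trailToFront c (v ++ [e]) = v ++ [e] := by
  simp [List.trailToFront, he]

theorem List.trailToFront_append_replicate (c : α) (v : List α) (k : ℕ) :
    List.trailToFront c (v ++ List.replicate k c) =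
      List.replicate k c ++ List.trailToFront c v := by
  induction k with
  | zero => simp
  | succ k ih =>
    rw [List.replicate_succ', ← List.append_assoc, List.trailToFront_concat_self, ih,
      ← List.replicate_succ', List.replicate_succ, List.cons_append]

theorem List.length_trailToFront (c : α) (v : List α) :
    (List.trailToFront c v).length = v.length := by
  induction v using List.reverseRecOn with
  | nil => rfl
  | append_singleton v e ih =>
    by_cases he : e = c
    · subst he; simp [List.trailToFront_concat_self, ih]
    · rw [List.trailToFront_concat_of_ne he]

theorem List.exists_eq_append_replicate (c : α) (v : List α) :
    ∃ (s : List α) (k : ℕ), v = s ++ List.replicate k c ∧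
      (s = [] ∨ ∃ t e, e ≠ c ∧ s = t ++ [e]) := by
  induction v using List.reverseRecOn with
  | nil => exact ⟨[], 0, rfl, Or.inl rfl⟩
  | append_singleton v e ih =>
    by_cases he : e = c
    · obtain ⟨s, k, h, hs⟩ := ih
      refine ⟨s, k + 1, ?_, hs⟩
      rw [h, he, List.replicate_succ', List.append_assoc]
    · exact ⟨v ++ [e], 0, by simp, Or.inr ⟨v, e, he, rfl⟩⟩

theorem List.exists_trailToFront_eq (c : α) (v : List α) :
    ∃ (s : List α) (k : ℕ), List.trailToFront c v = List.replicate k c ++ s ∧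
      (s = [] ∨ ∃ t e, e ≠ c ∧ s = t ++ [e]) := by
  obtain ⟨s, k, rfl, hs⟩ := List.exists_eq_append_replicate c v
  refine ⟨s, k, ?_, hs⟩
  rw [List.trailToFront_append_replicate]
  rcases hs with rfl | ⟨t, e, he, rfl⟩
  · rfl
  · rw [List.trailToFront_concat_of_ne he]

theorem List.isRotated_trailToFront (c : α) (v : List α) (M : ℕ) :
    List.IsRotated (List.replicate M c ++ v) (List.replicate M c ++ List.trailToFront c v) := by
  induction v using List.reverseRecOn generalizing M with
  | nil => exact List.IsRotated.refl _
  | append_singleton v e ih =>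
    by_cases he : e = c
    · subst he
      rw [List.trailToFront_concat_self]
      have h := ih (M + 1)
      rw [List.replicate_succ', List.append_assoc, List.append_assoc] at h
      refine List.IsRotated.trans ?_ h
      rw [← List.append_assoc, ← List.append_assoc, ← List.replicate_succ', List.replicate_succ]
      exact List.isRotated_concat _ _
    · rw [List.trailToFront_concat_of_ne he]

omit [DecidableEq α] in
theorem List.eq_of_isRotated_replicate_append {c : α} {A B : ℕ} {w w' : List α}
    (hw : w = [] ∨ ∃ t e, e ≠ c ∧ w = t ++ [e])
    (hw' : w' = [] ∨ ∃ t e, e ≠ c ∧ w' = t ++ [e])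
    (hB : w.length ≤ B)
    (h : List.IsRotated (List.replicate A c ++ w) (List.replicate B c ++ w')) :
    List.replicate A c ++ w = List.replicate B c ++ w' := by
  obtain ⟨l₁, l₂, h₁, h₂⟩ := h.exists_append
  rcases List.append_eq_append_iff.1 h₁ with ⟨s, hs, hs'⟩ | ⟨s, hs, hs'⟩
  · have hl₂ : l₂ = List.replicate l₂.length c :=
      List.eq_replicate_of_append_eq_replicate_append h₂.symm
        (le_trans (by rw [hs']; simp) hB)
    rcases List.eq_nil_or_concat l₂ with rfl | ⟨t, e, rfl⟩
    · rw [h₁, h₂]; simp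
    · exfalso
      have he : e = c := by
        apply List.eq_of_mem_replicate (n := (t.concat e).length)
        rw [← hl₂]; simp
      rw [List.concat_eq_append, ← List.append_assoc] at hs'
      rcases hw with rfl | ⟨t', e', he', rfl⟩
      · simp at hs'
      · have := (List.append_inj' hs' rfl).2
        simp at this
        exact he' (this.trans he)
  · have hl₁ : ∀ b ∈ l₁, b = c := fun b hb =>
      List.eq_of_mem_replicate (n := A) (by rw [hs]; simp [hb])
    rcases List.eq_nil_or_concat l₁ with rfl | ⟨t, e, rfl⟩
    · rw [h₁, h₂]; simp
    · rw [List.concat_eq_append, ← List.append_assoc] at h₂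
      have hall : ∀ b ∈ List.replicate B c ++ w', b = c := by
        rcases hw' with rfl | ⟨t', e', he', rfl⟩
        · intro b hb
          simpa using (List.mem_append.1 hb |>.resolve_right (by simp) |> List.eq_of_mem_replicate)
        · exfalso
          rw [← List.append_assoc] at h₂
          have := (List.append_inj' h₂ rfl).2
          simp at this
          exact he' (this.trans (hl₁ e (by simp)))
      have hlen := h.perm.length_eq
      rw [List.eq_replicate_iff.2 ⟨rfl, hall⟩, List.eq_replicate_iff.2 ⟨rfl, fun b hb =>
        hall b (h.perm.mem_iff.1 hb)⟩, hlen]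

theorem List.isRotated_replicate_append_iff {c : α} {u v : List α} (M : ℕ)
    (hM : u.length ≤ M) :
    List.IsRotated (List.replicate M c ++ v)
        (List.replicate M c ++ List.trailToFront c u) ↔
      List.trailToFront c v = List.trailToFront c u := by
  constructor
  · intro h
    have hlen : v.length = u.length := by
      have := h.perm.length_eq
      simp only [List.length_append, List.length_trailToFront] at this
      omega
    have h' := (List.isRotated_trailToFront c v M).symm.trans h
    obtain ⟨s, k, hs, hs₁⟩ := List.exists_trailToFront_eq c v
    obtain ⟨t, l, ht, ht₁⟩ := List.exists_trailToFront_eq c u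
    have hsl : s.length ≤ v.length := by
      rw [← List.length_trailToFront c v, hs]; simp
    rw [hs, ht, ← List.append_assoc, ← List.append_assoc, List.replicate_append_replicate,
      List.replicate_append_replicate] at h'
    have := List.eq_of_isRotated_replicate_append hs₁ ht₁ (by omega) h'
    rw [← List.replicate_append_replicate, ← List.replicate_append_replicate,
      List.append_assoc, List.append_assoc] at this
    rw [hs, ht]
    exact List.append_cancel_left this
  · intro h
    rw [← h]
    exact List.isRotated_trailToFront c v M

theorem List.trailToFront_cons_replicate_append_eq {c d e : α} (hd : d ≠ c)
    {M : ℕ} {p v : List α} (hp : p.length ≤ M)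
    (h : List.trailToFront c (d :: List.replicate M c ++ v) = p ++ (List.replicate M c ++ [e])) :
    (d = e ∧ ∃ k, p = List.replicate k c ∧ v = List.replicate k c) ∨
      ∃ k l, p = List.replicate k c ++ d :: List.replicate l c ∧
        v = List.replicate l c ++ e :: List.replicate k c := by
  obtain ⟨s, k, rfl, hs⟩ := List.exists_eq_append_replicate c v
  rw [← List.append_assoc, List.trailToFront_append_replicate] at h
  rcases hs with rfl | ⟨t, e', he', rfl⟩
  · left
    have h1 := List.trailToFront_append_replicate c [d] M
    have h2 := List.trailToFront_concat_of_ne hd []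
    simp only [List.nil_append, List.singleton_append] at h1 h2
    rw [List.append_nil, h1, h2, ← List.append_assoc, ← List.append_assoc] at h
    have h3 := List.append_inj' h rfl
    refine ⟨by simpa using h3.2, k, ?_, by simp⟩
    have h4 := h3.1
    rw [List.replicate_append_replicate, Nat.add_comm, ← List.replicate_append_replicate] at h4
    have h5 := congrArg List.length h4
    simp only [List.length_append, List.length_replicate] at h5
    have h6 := List.eq_replicate_of_append_eq_replicate_append (w := List.replicate k c) h4.symm hp
    rw [h6, show p.length = k by omega]
  · right
    rw [← List.append_assoc, List.trailToFront_concat_of_ne he', ← List.append_assoc,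
      ← List.append_assoc p] at h
    have h3 := List.append_inj' h rfl
    obtain rfl : e' = e := by simpa using h3.2
    have h4 : (List.replicate k c ++ [d]) ++ (List.replicate M c ++ t) =
        p ++ List.replicate M c := by simpa using h3.1
    obtain ⟨r, hr, hr'⟩ : ∃ r, p = (List.replicate k c ++ [d]) ++ r ∧
        List.replicate M c ++ t = r ++ List.replicate M c := by
      rcases List.append_eq_append_iff.1 h4 with ⟨r, hr, hr'⟩ | ⟨r, hr, hr'⟩
      · exact ⟨r, hr, hr'⟩
      · have := congrArg List.length hr'
        simp only [List.length_append, List.length_replicate] at this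
        have h5 : r = [] := List.length_eq_zero_iff.1 (by omega)
        have h6 : t = [] := List.length_eq_zero_iff.1 (by omega)
        subst h5 h6
        exact ⟨[], by simpa using hr.symm, by simp⟩
    have h7 := List.eq_replicate_of_append_eq_replicate_append hr'.symm (by
      rw [hr] at hp
      simp only [List.length_append] at hp
      omega)
    refine ⟨k, r.length, ?_, ?_⟩
    · rw [← h7, hr]; simp
    · have h8 : t = List.replicate r.length c := by
        rw [h7, List.replicate_append_replicate, Nat.add_comm,
          ← List.replicate_append_replicate] at hr'
        exact List.append_cancel_left hr'
      rw [h8]; simp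

theorem List.trailToFront_cons_cons {c d : α} (hd : d ≠ c) (v : List α) :
    ∃ k s, List.trailToFront c (d :: d :: v) = List.replicate k c ++ d :: d :: s := by
  obtain ⟨s, k, rfl, hs⟩ := List.exists_eq_append_replicate c v
  refine ⟨k, s, ?_⟩
  rw [← List.cons_append, ← List.cons_append, List.trailToFront_append_replicate]
  congr 1
  rcases hs with rfl | ⟨t, e, he, rfl⟩
  · exact List.trailToFront_concat_of_ne hd [d]
  · exact List.trailToFront_concat_of_ne he (d :: d :: t)

end ListLemmas

namespace FreeAlgebra

section WordBasis

variable (K : Type*) {α : Type*} [Field K]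

/-- The monomial associated with a list of letters. -/
def word (v : List α) : FreeAlgebra K α := (v.map (ι K)).prod

theorem word_nil : word K ([] : List α) = 1 := rfl

theorem word_cons (e : α) (v : List α) : word K (e :: v) = ι K e * word K v := by
  simp [word]

theorem word_append (u v : List α) : word K (u ++ v) = word K u * word K v := by
  simp [word]

theorem word_singleton (e : α) : word K [e] = ι K e := by simp [word]

theorem word_concat (v : List α) (e : α) : word K (v ++ [e]) = word K v * ι K e := by
  rw [word_append, word_singleton]

theorem word_replicate (m : ℕ) (c : α) : word K (List.replicate m c) = ι K c ^ m := by
  simp [word]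

/-- The basis of the free algebra consisting of the monomials. -/
noncomputable def wordBasis : Module.Basis (List α) K (FreeAlgebra K α) :=
  basisFreeMonoid K α

theorem wordBasis_apply (v : List α) : wordBasis K v = word K v := by
  have : wordBasis K v = equivMonoidAlgebraFreeMonoid.symm
      (MonoidAlgebra.single (FreeMonoid.ofList v) (1 : K)) := rfl
  rw [this, equivMonoidAlgebraFreeMonoid]
  simp only [AlgEquiv.ofAlgHom_symm, AlgEquiv.ofAlgHom_apply, MonoidAlgebra.lift_single, one_smul,
    FreeMonoid.lift_apply, FreeMonoid.toList_ofList]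
  rfl

variable {K}

theorem linearMap_ext_word {M : Type*} [AddCommGroup M] [Module K M]
    {f h : FreeAlgebra K α →ₗ[K] M} (H : ∀ v, f (word K v) = h (word K v)) : f = h :=
  (wordBasis K).ext fun v => by rw [wordBasis_apply]; exact H v

theorem induction_word {p : FreeAlgebra K α → Prop} (word : ∀ v, p (word K v))
    (add : ∀ a b, p a → p b → p (a + b)) (smul : ∀ (r : K) a, p a → p (r • a))
    (a : FreeAlgebra K α) : p a := by
  have ha : a ∈ Submodule.span K (Set.range (wordBasis K (α := α))) := by
    rw [Module.Basis.span_eq]; trivial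
  induction ha using Submodule.span_induction with
  | mem x hx =>
    obtain ⟨v, rfl⟩ := hx
    rw [wordBasis_apply]; exact word v
  | zero => simpa using smul 0 _ (word [])
  | add x y _ _ hx hy => exact add x y hx hy
  | smul r x _ hx => exact smul r x hx

/-- The coefficient of a monomial, as a linear functional. -/
noncomputable def cf (v : List α) : FreeAlgebra K α →ₗ[K] K := (wordBasis K).coord v

theorem ext_cf {a b : FreeAlgebra K α} (h : ∀ v, cf v a = cf v b) : a = b :=
  (wordBasis K).ext_elem h

/-- The linear map with prescribed values on monomials. -/
noncomputable def ofWords {M : Type*} [AddCommGroup M] [Module K M] (f : List α → M) :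
    FreeAlgebra K α →ₗ[K] M := (wordBasis K).constr K f

theorem ofWords_word {M : Type*} [AddCommGroup M] [Module K M] (f : List α → M) (v : List α) :
    ofWords f (word K v) = f v := by
  rw [ofWords, ← wordBasis_apply, Module.Basis.constr_basis]

/-- Only finitely many coefficients are nonzero, so they vanish on long words. -/
theorem exists_length_bound (a : FreeAlgebra K α) :
    ∃ N : ℕ, ∀ v : List α, N ≤ v.length → cf v a = 0 := by
  refine ⟨((wordBasis K).repr a).support.sup List.length + 1, fun v hv => ?_⟩
  by_contra h
  have : v ∈ ((wordBasis K).repr a).support := by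
    rw [Finsupp.mem_support_iff]; exact h
  have := Finset.le_sup (f := List.length) this
  omega

variable [DecidableEq α]

theorem cf_word (u v : List α) : cf v (word K u) = if u = v then 1 else 0 := by
  rw [cf, ← wordBasis_apply, Module.Basis.coord_apply, Module.Basis.repr_self,
    Finsupp.single_apply]

theorem cf_map_eq {T : FreeAlgebra K α →ₗ[K] FreeAlgebra K α} {t : List α → List α}
    (hT : ∀ v, T (word K v) = word K (t v)) {u p : List α} (h : ∀ v, t v = u ↔ v = p)
    (a : FreeAlgebra K α) : cf u (T a) = cf p a := by
  have : (cf u).comp T = (cf p : FreeAlgebra K α →ₗ[K] K) := linearMap_ext_word fun v => by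
    rw [LinearMap.comp_apply, hT, cf_word, cf_word]
    simp only [h]
  exact LinearMap.congr_fun this a

theorem cf_map_eq_zero {T : FreeAlgebra K α →ₗ[K] FreeAlgebra K α} {t : List α → List α}
    (hT : ∀ v, T (word K v) = word K (t v)) {u : List α} (h : ∀ v, t v ≠ u)
    (a : FreeAlgebra K α) : cf u (T a) = 0 := by
  have : (cf u).comp T = 0 := linearMap_ext_word fun v => by
    rw [LinearMap.comp_apply, hT, cf_word, if_neg (h v), LinearMap.zero_apply]
  exact LinearMap.congr_fun this a

theorem cf_mul_word (a : FreeAlgebra K α) (u w : List α) :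
    cf (u ++ w) (a * word K w) = cf u a :=
  cf_map_eq (T := LinearMap.mulRight K (word K w)) (t := fun v => v ++ w)
    (fun v => by rw [LinearMap.mulRight_apply, word_append]) (by simp) a

theorem cf_mul_word_eq_zero (a : FreeAlgebra K α) {u w : List α} (h : ¬ w <:+ u) :
    cf u (a * word K w) = 0 :=
  cf_map_eq_zero (T := LinearMap.mulRight K (word K w)) (t := fun v => v ++ w)
    (fun v => by rw [LinearMap.mulRight_apply, word_append]) (fun v hv => h ⟨v, hv⟩) a

theorem cf_word_mul (a : FreeAlgebra K α) (u w : List α) :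
    cf (w ++ u) (word K w * a) = cf u a :=
  cf_map_eq (T := LinearMap.mulLeft K (word K w)) (t := fun v => w ++ v)
    (fun v => by rw [LinearMap.mulLeft_apply, word_append]) (by simp) a

theorem cf_word_mul_eq_zero (a : FreeAlgebra K α) {u w : List α} (h : ¬ w <+: u) :
    cf u (word K w * a) = 0 :=
  cf_map_eq_zero (T := LinearMap.mulLeft K (word K w)) (t := fun v => w ++ v)
    (fun v => by rw [LinearMap.mulLeft_apply, word_append]) (fun v hv => h ⟨v, hv⟩) a

/-- The class functional counting the cyclic word of `v`. -/
noncomputable def cyclicCf (v : List α) : FreeAlgebra K α →ₗ[K] K :=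
  ofWords fun u => if List.IsRotated u v then 1 else 0

theorem cyclicCf_word (v u : List α) :
    cyclicCf v (word K u) = if List.IsRotated u v then 1 else 0 := ofWords_word _ _

theorem cyclicCf_mul_comm (v : List α) (a b : FreeAlgebra K α) :
    cyclicCf v (a * b) = cyclicCf v (b * a) := by
  have : (LinearMap.mul K (FreeAlgebra K α)).compr₂ (cyclicCf v) =
      ((LinearMap.mul K (FreeAlgebra K α)).compr₂ (cyclicCf v)).flip := by
    refine linearMap_ext_word fun u => linearMap_ext_word fun w => ?_
    simp only [LinearMap.compr₂_apply, LinearMap.flip_apply, LinearMap.mul_apply', ← word_append,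
      cyclicCf_word]
    congr 1
    exact propext ⟨fun h => List.isRotated_append.trans h, fun h => List.isRotated_append.trans h⟩
  exact LinearMap.congr_fun₂ this a b

theorem cyclicCf_eq_zero (v : List α) {a : FreeAlgebra K α}
    (ha : a ∈ commutatorSpan K (FreeAlgebra K α)) : cyclicCf v a = 0 := by
  have : commutatorSpan K (FreeAlgebra K α) ≤ LinearMap.ker (cyclicCf v) := by
    refine Submodule.span_le.2 ?_
    rintro _ ⟨p, q, rfl⟩
    simp [cyclicCf_mul_comm v p q]
  exact this ha

/-- The linear extension of `List.trailToFront`. -/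
noncomputable def trailToFront (c : α) : FreeAlgebra K α →ₗ[K] FreeAlgebra K α :=
  ofWords fun v => word K (List.trailToFront c v)

theorem trailToFront_word (c : α) (v : List α) :
    trailToFront c (word K v) = word K (List.trailToFront c v) := ofWords_word _ _

theorem trailToFront_eq_zero {c : α} {h : FreeAlgebra K α}
    (H : ∀ M : ℕ, ι K c ^ M * h ∈ commutatorSpan K (FreeAlgebra K α)) :
    trailToFront c h = 0 := by
  refine ext_cf fun u => ?_
  rw [map_zero]
  by_cases hu : ∃ v, List.trailToFront c v = u
  · obtain ⟨v, rfl⟩ := hu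
    rw [← cyclicCf_eq_zero (List.replicate v.length c ++ List.trailToFront c v) (H v.length),
      ← word_replicate]
    have : (cf (List.trailToFront c v)).comp (trailToFront c) =
        (cyclicCf (List.replicate v.length c ++ List.trailToFront c v)).comp
          (LinearMap.mulLeft K (word K (List.replicate v.length c))) :=
      linearMap_ext_word fun w => by
        simp only [LinearMap.comp_apply, LinearMap.mulLeft_apply, trailToFront_word, cf_word,
          ← word_append, cyclicCf_word, List.isRotated_replicate_append_iff v.length le_rfl]
    exact LinearMap.congr_fun this h
  · exact cf_map_eq_zero (trailToFront_word c) (fun v hv => hu ⟨v, hv⟩) h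

theorem exists_sub_trailToFront_eq (c : α) (h : FreeAlgebra K α) :
    ∃ q, h - trailToFront c h = q * ι K c - ι K c * q := by
  let T : FreeAlgebra K α →ₗ[K] FreeAlgebra K α :=
    LinearMap.mulRight K (ι K c) - LinearMap.mulLeft K (ι K c)
  have hw : ∀ v, word K v - word K (List.trailToFront c v) ∈ LinearMap.range T := by
    intro v
    induction v using List.reverseRecOn with
    | nil => simp [List.trailToFront_nil]
    | append_singleton v e ih =>
      by_cases he : e = c
      · subst he
        obtain ⟨q, hq⟩ := ih
        refine ⟨word K v + ι K e * q, ?_⟩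
        rw [List.trailToFront_concat_self, word_concat, word_cons]
        have : ι K e * T q = ι K e * (word K v - word K (List.trailToFront e v)) := by rw [hq]
        simp only [T, LinearMap.sub_apply, LinearMap.mulRight_apply, LinearMap.mulLeft_apply,
          mul_sub] at this ⊢
        rw [add_mul, mul_add, mul_assoc (ι K e) q, add_sub_add_comm, this]
        abel
      · rw [List.trailToFront_concat_of_ne he, sub_self]
        exact zero_mem _
  have : (LinearMap.range T).mkQ.comp (LinearMap.id - trailToFront c) = 0 :=
    linearMap_ext_word fun v => by
      rw [LinearMap.comp_apply, LinearMap.sub_apply, LinearMap.id_apply, trailToFront_word]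
      exact (Submodule.Quotient.mk_eq_zero _).2 (hw v)
  have h' := LinearMap.congr_fun this h
  rw [LinearMap.comp_apply] at h'
  obtain ⟨q, hq⟩ := (Submodule.Quotient.mk_eq_zero _).1 h'
  exact ⟨q, hq.symm⟩

end WordBasis

section Derivation

variable {K : Type*} {α : Type*} [Field K]

/-- The value on a monomial of the derivation with prescribed values `F` on the letters. -/
def derivWord (F : α → FreeAlgebra K α) : List α → FreeAlgebra K α
  | [] => 0
  | e :: v => F e * word K v + ι K e * derivWord F v

theorem derivWord_append (F : α → FreeAlgebra K α) (u v : List α) :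
    derivWord F (u ++ v) = derivWord F u * word K v + word K u * derivWord F v := by
  induction u with
  | nil => simp [derivWord, word_nil]
  | cons e u ih =>
    simp only [List.cons_append, derivWord, ih, word_append, word_cons]
    noncomm_ring

theorem derivWord_singleton (F : α → FreeAlgebra K α) (e : α) : derivWord F [e] = F e := by
  simp [derivWord, word_nil]

theorem derivWord_replicate {F : α → FreeAlgebra K α} {c : α} (hc : F c = 0) (m : ℕ) :
    derivWord F (List.replicate m c) = 0 := by
  induction m with
  | zero => rfl
  | succ m ih => rw [List.replicate_succ, derivWord, hc, ih]; simp

theorem pow_mul_derivWord_replicate_sub_mem (F : α → FreeAlgebra K α) (c : α) (m k : ℕ) :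
    ι K c ^ k * derivWord F (List.replicate (m + 1) c) -
      ((m : K) + 1) • (ι K c ^ (m + k) * F c) ∈ commutatorSpan K (FreeAlgebra K α) := by
  induction m generalizing k with
  | zero => simp [derivWord_singleton]
  | succ m ih =>
    have h : ι K c ^ k * F c * ι K c ^ (m + 1) - ι K c ^ (m + 1) * (ι K c ^ k * F c) ∈
        commutatorSpan K (FreeAlgebra K α) := Submodule.subset_span ⟨_, _, rfl⟩
    convert add_mem (ih (k + 1)) h using 1
    rw [List.replicate_succ (n := m + 1), derivWord, word_replicate, mul_add, ← mul_assoc,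
      ← mul_assoc (_ ^ k) (ι K c), ← pow_succ, ← mul_assoc (ι K c ^ (m + 1)), ← pow_add,
      show m + (k + 1) = m + 1 + k by ring, Nat.cast_succ, add_smul ((m : K) + 1), one_smul]
    abel

theorem pow_mul_mem_of_derivWord_mem [CharZero K] {F : α → FreeAlgebra K α}
    (H : ∀ v, derivWord F v ∈ commutatorSpan K (FreeAlgebra K α)) (c : α) (m : ℕ) :
    ι K c ^ m * F c ∈ commutatorSpan K (FreeAlgebra K α) := by
  have h := pow_mul_derivWord_replicate_sub_mem F c m 0
  rw [pow_zero, one_mul, sub_mem_comm_iff, add_zero] at h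
  have h' := (Submodule.sub_mem_iff_left _ (H _)).1 h
  exact (Submodule.smul_mem_iff _ (Nat.cast_add_one_ne_zero m)).1 h'

theorem derivWord_add (F G : α → FreeAlgebra K α) (v : List α) :
    derivWord (fun e => F e + G e) v = derivWord F v + derivWord G v := by
  induction v with
  | nil => simp [derivWord]
  | cons e v ih => simp only [derivWord, ih]; noncomm_ring

theorem derivWord_smul (r : K) (F : α → FreeAlgebra K α) (v : List α) :
    derivWord (fun e => r • F e) v = r • derivWord F v := by
  induction v with
  | nil => simp [derivWord]
  | cons e v ih => simp only [derivWord, ih, smul_mul_assoc, mul_smul_comm, smul_add]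

theorem derivWord_eq_sum (F : α → FreeAlgebra K α) (v : List α) :
    derivWord F v = ∑ j : Fin v.length,
      word K (v.take j.1) * F (v.get j) * word K (v.drop (j.1 + 1)) := by
  induction v with
  | nil => rfl
  | cons e v ih =>
    rw [derivWord, ih]
    refine Eq.trans ?_ (Fin.sum_univ_succ (n := v.length) _).symm
    simp [word_nil, word_cons, Finset.mul_sum, mul_assoc]

theorem derivWord_sub (F G : α → FreeAlgebra K α) (v : List α) :
    derivWord (fun e => F e - G e) v = derivWord F v - derivWord G v := by
  induction v with
  | nil => simp [derivWord]
  | cons e v ih => simp only [derivWord, ih]; noncomm_ring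

theorem derivWord_commutator (p : FreeAlgebra K α) (v : List α) :
    derivWord (fun e => p * ι K e - ι K e * p) v = p * word K v - word K v * p := by
  induction v with
  | nil => simp [derivWord, word_nil]
  | cons e v ih => simp only [derivWord, ih, word_cons]; noncomm_ring

variable [DecidableEq α]

theorem cf_mul_ι (a : FreeAlgebra K α) (v : List α) (e : α) :
    cf (v ++ [e]) (a * ι K e) = cf v a := by
  rw [← word_singleton]; exact cf_mul_word a v [e]

theorem cf_mul_ι_eq_zero (a : FreeAlgebra K α) {u : List α} {e : α} (h : ∀ v, u ≠ v ++ [e]) :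
    cf u (a * ι K e) = 0 := by
  rw [← word_singleton]
  exact cf_mul_word_eq_zero a fun ⟨v, hv⟩ => h v hv.symm

theorem cf_ι_mul (a : FreeAlgebra K α) (v : List α) (e : α) :
    cf (e :: v) (ι K e * a) = cf v a := by
  rw [← word_singleton]; exact cf_word_mul a v [e]

theorem cf_ι_mul_eq_zero (a : FreeAlgebra K α) {u : List α} {e : α} (h : ∀ v, u ≠ e :: v) :
    cf u (ι K e * a) = 0 := by
  rw [← word_singleton]
  exact cf_word_mul_eq_zero a fun ⟨v, hv⟩ => h v hv.symm

/-- The part of an element consisting of monomials ending with the letter `e`, with this last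
letter removed. -/
noncomputable def rightQuot (e : α) : FreeAlgebra K α →ₗ[K] FreeAlgebra K α :=
  ofWords fun v => if v.getLast? = some e then word K v.dropLast else 0

theorem rightQuot_word_concat (e e' : α) (v : List α) :
    rightQuot e (word K (v ++ [e'])) = if e' = e then word K v else 0 := by
  rw [rightQuot, ofWords_word]; simp

theorem rightQuot_one (e : α) : rightQuot (K := K) e 1 = 0 := by
  rw [← word_nil, rightQuot, ofWords_word]; simp

theorem cf_rightQuot (e : α) (v : List α) (a : FreeAlgebra K α) :
    cf v (rightQuot e a) = cf (v ++ [e]) a := by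
  have : (cf v).comp (rightQuot e) = (cf (v ++ [e]) : FreeAlgebra K α →ₗ[K] K) :=
    linearMap_ext_word fun u => by
      rw [LinearMap.comp_apply]
      rcases List.eq_nil_or_concat u with rfl | ⟨t, e', rfl⟩
      · rw [word_nil, rightQuot_one, map_zero, ← word_nil, cf_word, if_neg]
        simp
      · rw [List.concat_eq_append, rightQuot_word_concat, cf_word]
        by_cases he : e' = e
        · rw [if_pos he, cf_word, he]; simp
        · rw [if_neg he, map_zero, if_neg]
          intro h
          exact he (by simpa using (List.append_inj' h rfl).2)
  exact LinearMap.congr_fun this a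

theorem trailToFront_mul_ι {c e : α} (he : e ≠ c) (a : FreeAlgebra K α) :
    trailToFront c (a * ι K e) = a * ι K e := by
  have : (trailToFront c).comp (LinearMap.mulRight K (ι K e)) = LinearMap.mulRight K (ι K e) :=
    linearMap_ext_word fun v => by
      rw [LinearMap.comp_apply, LinearMap.mulRight_apply, ← word_concat, trailToFront_word,
        List.trailToFront_concat_of_ne he]
  exact LinearMap.congr_fun this a

theorem trailToFront_derivWord_eq_zero {F : α → FreeAlgebra K α}
    (H : ∀ v, derivWord F v ∈ commutatorSpan K (FreeAlgebra K α)) {c : α} (hc : F c = 0)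
    (v : List α) : trailToFront c (derivWord F v) = 0 := by
  refine trailToFront_eq_zero fun M => ?_
  have := H (List.replicate M c ++ v)
  rwa [derivWord_append, derivWord_replicate hc, zero_mul, zero_add, word_replicate] at this

theorem cf_eq_zero_of_pos {F : α → FreeAlgebra K α} {c d : α}
    (H : ∀ v, trailToFront c (derivWord F v) = 0) (hd : d ≠ c) (k l : ℕ) :
    cf (List.replicate (k + 1) c ++ d :: List.replicate (l + 1) c) (F d) = 0 := by
  have h := H [d, d, d]
  have h₀ : derivWord F [d, d, d] =
      F d * ι K d * ι K d + ι K d * F d * ι K d + word K [d, d] * F d := by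
    simp only [derivWord, word_nil, word_cons]
    noncomm_ring
  rw [h₀, map_add, map_add, trailToFront_mul_ι hd, trailToFront_mul_ι hd] at h
  have h' := congrArg (cf (List.replicate (k + 1) c ++ d :: List.replicate (l + 1) c
    ++ [d] ++ [d])) h
  rw [map_add, map_add, map_zero, cf_mul_ι, cf_mul_ι, cf_mul_ι, cf_ι_mul_eq_zero,
    add_zero] at h'
  · rw [← h', left_eq_add]
    refine cf_map_eq_zero (T := (trailToFront c).comp (LinearMap.mulLeft K (word K [d, d])))
      (t := fun v => List.trailToFront c ([d, d] ++ v))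
      (fun v => by
        rw [LinearMap.comp_apply, LinearMap.mulLeft_apply, ← word_append, trailToFront_word])
      (fun v hv => ?_) _
    obtain ⟨j, s, hs⟩ := List.trailToFront_cons_cons hd v
    rw [List.cons_append, List.cons_append, List.nil_append, hs, List.append_assoc,
      List.append_assoc, List.cons_append] at hv
    have := (List.replicate_append_cons_inj hd hd hv).2.2
    rw [List.replicate_succ, List.cons_append, List.cons.injEq] at this
    exact hd this.1
  · intro v hv
    rw [List.replicate_succ, List.cons_append, List.cons_append, List.cons.injEq] at hv
    exact hd hv.1.symm

section

variable {F : α → FreeAlgebra K α} {c : α} (H : ∀ v, trailToFront c (derivWord F v) = 0)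
  (hc : F c = 0)

include H hc

theorem cf_eq_neg_cf_trailToFront {d e : α} (he : e ≠ c) (M : ℕ) (p : List α) :
    cf p (F d) = -cf (p ++ (List.replicate M c ++ [e]))
      (trailToFront c (word K (d :: List.replicate M c) * F e)) := by
  have h := H ([d] ++ (List.replicate M c ++ [e]))
  rw [derivWord_append, derivWord_append, derivWord_replicate hc, zero_mul, zero_add,
    derivWord_singleton, derivWord_singleton, ← mul_assoc, ← word_append, map_add, word_concat,
    ← mul_assoc, trailToFront_mul_ι he, mul_assoc, ← word_concat] at h
  rw [← cf_mul_word (F d) p (List.replicate M c ++ [e]), eq_neg_iff_add_eq_zero, ← map_add]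
  rw [List.singleton_append] at h
  rw [h, map_zero]

theorem cf_eq_neg_cf {d e : α} (hd : d ≠ c) (he : e ≠ c) (k l : ℕ) :
    cf (List.replicate k c ++ d :: List.replicate l c) (F d) =
      -cf (List.replicate l c ++ e :: List.replicate k c) (F e) := by
  rw [cf_eq_neg_cf_trailToFront H hc he (k + 1 + l)]
  congr 1
  refine cf_map_eq (T := (trailToFront c).comp
      (LinearMap.mulLeft K (word K (d :: List.replicate (k + 1 + l) c))))
    (t := fun v => List.trailToFront c (d :: List.replicate (k + 1 + l) c ++ v))
    (fun v => by
      rw [LinearMap.comp_apply, LinearMap.mulLeft_apply, ← word_append, trailToFront_word])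
    (fun v => ⟨fun h => ?_, ?_⟩) _
  · rcases List.trailToFront_cons_replicate_append_eq hd
      (by simp only [List.length_append, List.length_replicate, List.length_cons]; omega) h
      with ⟨-, j, hj, -⟩ | ⟨k', l', h₁, rfl⟩
    · exfalso
      refine hd (List.eq_of_mem_replicate (n := j) ?_)
      rw [← hj]; simp
    · obtain ⟨rfl, -, h₂⟩ := List.replicate_append_cons_inj hd hd h₁
      rw [h₂]
  · rintro rfl
    have h₁ := List.trailToFront_append_replicate c
      (d :: List.replicate (k + 1 + l) c ++ (List.replicate l c ++ [e])) k
    rw [← List.append_assoc (d :: _), List.trailToFront_concat_of_ne he] at h₁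
    simp only [List.append_assoc, List.cons_append, List.nil_append] at h₁ ⊢
    rw [h₁, ← List.append_assoc (List.replicate _ c) (List.replicate _ c),
      ← List.append_assoc (List.replicate _ c) (List.replicate _ c),
      List.replicate_append_replicate, List.replicate_append_replicate, Nat.add_comm]

theorem cf_eq_zero_of_ne [CharZero K] {d : α} (hd : d ≠ c) {p : List α}
    (hp : ∀ k l, p ≠ List.replicate k c ++ d :: List.replicate l c) : cf p (F d) = 0 := by
  have h := cf_eq_neg_cf_trailToFront H hc (d := d) hd p.length p
  have hT : ∀ v, ((trailToFront c).comp (LinearMap.mulLeft K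
      (word K (d :: List.replicate p.length c)))) (word K v) =
      word K (List.trailToFront c (d :: List.replicate p.length c ++ v)) := fun v => by
    rw [LinearMap.comp_apply, LinearMap.mulLeft_apply, ← word_append, trailToFront_word]
  by_cases hk : ∃ k, p = List.replicate k c
  · obtain ⟨k, hk⟩ := hk
    have h' := cf_map_eq hT (u := p ++ (List.replicate p.length c ++ [d])) (p := p)
      (fun v => ⟨fun hv => ?_, ?_⟩) (F d)
    · rw [LinearMap.comp_apply, LinearMap.mulLeft_apply] at h'
      rw [h'] at h
      exact self_eq_neg.1 h
    · rcases List.trailToFront_cons_replicate_append_eq hd le_rfl hv with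
        ⟨-, j, hj, hj'⟩ | ⟨k', l', h₁, -⟩
      · rw [hj, hj']
      · exact absurd h₁ (hp _ _)
    · intro hv
      have h₁ := List.trailToFront_append_replicate c [d] (p.length + k)
      have h₂ := List.trailToFront_concat_of_ne hd []
      rw [List.nil_append] at h₂
      rw [h₂, ← List.replicate_append_replicate, List.append_assoc] at h₁
      subst hk
      rw [hv]
      refine h₁.trans ?_
      rw [List.length_replicate]
  · have h' := cf_map_eq_zero hT (u := p ++ (List.replicate p.length c ++ [d]))
      (fun v hv => ?_) (F d)
    · rw [LinearMap.comp_apply, LinearMap.mulLeft_apply] at h'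
      rw [h, h', neg_zero]
    · rcases List.trailToFront_cons_replicate_append_eq hd le_rfl hv with
        ⟨-, j, hj, -⟩ | ⟨k', l', h₁, -⟩
      · exact hk ⟨j, hj⟩
      · exact hp _ _ h₁

end

end Derivation

section Inner

variable {K : Type*} {α : Type*} [Field K] [DecidableEq α] [CharZero K]

omit [CharZero K] in
theorem mul_ι_self_comm_of_cf_eq_zero {p : FreeAlgebra K α} {c : α}
    (hp : ∀ v, (∀ k, v ≠ List.replicate k c) → cf v p = 0) : p * ι K c = ι K c * p := by
  refine ext_cf fun u => ?_
  by_cases hu : ∃ k, u = List.replicate k c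
  · obtain ⟨k, rfl⟩ := hu
    cases k with
    | zero => rw [cf_mul_ι_eq_zero _ (by simp), cf_ι_mul_eq_zero _ (by simp)]
    | succ k =>
      nth_rw 1 [List.replicate_succ', List.replicate_succ]
      rw [cf_mul_ι, cf_ι_mul]
  · push Not at hu
    have h₁ : cf u (p * ι K c) = 0 := by
      by_cases h : ∃ v, u = v ++ [c]
      · obtain ⟨v, rfl⟩ := h
        rw [cf_mul_ι]
        exact hp v fun k hk => hu (k + 1) (by rw [hk, List.replicate_succ'])
      · push Not at h
        exact cf_mul_ι_eq_zero _ h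
    have h₂ : cf u (ι K c * p) = 0 := by
      by_cases h : ∃ v, u = c :: v
      · obtain ⟨v, rfl⟩ := h
        rw [cf_ι_mul]
        exact hp v fun k hk => hu (k + 1) (by rw [hk, List.replicate_succ])
      · push Not at h
        exact cf_ι_mul_eq_zero _ h
    rw [h₁, h₂]

theorem exists_eq_commutator_of_trailToFront {F : α → FreeAlgebra K α} {c : α}
    (H : ∀ v, trailToFront c (derivWord F v) = 0) (hc : F c = 0) :
    ∃ p, ∀ e, F e = p * ι K e - ι K e * p := by
  by_cases hd₀ : ∃ d, d ≠ c
  swap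
  · push Not at hd₀
    exact ⟨0, fun e => by rw [hd₀ e, hc]; simp⟩
  obtain ⟨d₀, hd₀⟩ := hd₀
  have hp : ∀ v, (∀ k, v ≠ List.replicate k c) → cf v (rightQuot d₀ (F d₀)) = 0 := by
    intro v hv
    rw [cf_rightQuot]
    refine cf_eq_zero_of_ne H hc hd₀ fun k l h => ?_
    rcases Nat.eq_zero_or_pos l with rfl | hl
    · exact hv k (List.append_inj' h rfl).1
    · obtain ⟨l, rfl⟩ := Nat.exists_eq_add_of_lt hl
      rw [zero_add, List.replicate_succ', ← List.cons_append, ← List.append_assoc] at h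
      exact hd₀ (by simpa using (List.append_inj' h rfl).2)
  refine ⟨rightQuot d₀ (F d₀), fun d => ?_⟩
  by_cases hd : d = c
  · rw [hd, hc, mul_ι_self_comm_of_cf_eq_zero hp, sub_self]
  have hR : ∀ k : ℕ, cf (List.replicate k c) (rightQuot d₀ (F d₀)) =
      cf (List.replicate k c ++ [d₀]) (F d₀) := fun k => cf_rightQuot _ _ _
  have hneg : ∀ k : ℕ, cf (d :: List.replicate k c) (F d) =
      -cf (List.replicate k c ++ [d₀]) (F d₀) := fun k => cf_eq_neg_cf H hc hd hd₀ 0 k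
  have hneg₀ : ∀ k : ℕ, cf (d₀ :: List.replicate k c) (F d₀) =
      -cf (List.replicate k c ++ [d₀]) (F d₀) := fun k => cf_eq_neg_cf H hc hd₀ hd₀ 0 k
  have hpos : ∀ k : ℕ, cf (List.replicate k c ++ [d]) (F d) =
      -cf (d₀ :: List.replicate k c) (F d₀) := fun k => cf_eq_neg_cf H hc hd hd₀ k 0
  refine ext_cf fun u => ?_
  rw [map_sub]
  by_cases hu : ∃ k l, u = List.replicate k c ++ d :: List.replicate l c
  · obtain ⟨k, l, rfl⟩ := hu
    cases k with
    | zero =>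
      cases l with
      | zero =>
        have h₁ := cf_mul_ι (rightQuot d₀ (F d₀)) [] d
        have h₂ := cf_ι_mul (rightQuot d₀ (F d₀)) [] d
        have h₃ := hneg 0
        have h₄ := hpos 0
        rw [hneg₀, neg_neg] at h₄
        simp only [List.replicate_zero, List.nil_append] at h₁ h₂ h₃ h₄ ⊢
        rw [h₁, h₂, sub_self]
        rw [h₄] at h₃
        rw [h₄, self_eq_neg.1 h₃]
      | succ l =>
        rw [List.replicate_zero, List.nil_append, cf_ι_mul, hR, hneg, cf_mul_ι_eq_zero, zero_sub]
        intro v hv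
        rw [List.replicate_succ', ← List.cons_append] at hv
        exact hd (by simpa using (List.append_inj' hv rfl).2.symm)
    | succ k =>
      have h₁ : cf (List.replicate (k + 1) c ++ d :: List.replicate l c)
          (ι K d * rightQuot d₀ (F d₀)) = 0 := by
        refine cf_ι_mul_eq_zero _ fun v hv => ?_
        rw [List.replicate_succ, List.cons_append, List.cons.injEq] at hv
        exact hd hv.1.symm
      rw [h₁, sub_zero]
      cases l with
      | zero => rw [List.replicate_zero, cf_mul_ι, hR, hpos, hneg₀, neg_neg]
      | succ l =>
        rw [cf_eq_zero_of_pos H hd, cf_mul_ι_eq_zero]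
        intro v hv
        rw [List.replicate_succ' (n := l), ← List.cons_append, ← List.append_assoc] at hv
        exact hd (by simpa using (List.append_inj' hv rfl).2.symm)
  · push Not at hu
    have h₁ : cf u (rightQuot d₀ (F d₀) * ι K d) = 0 := by
      by_cases h : ∃ v, u = v ++ [d]
      · obtain ⟨v, rfl⟩ := h
        rw [cf_mul_ι]
        exact hp v fun k hk => hu k 0 (by rw [hk]; rfl)
      · push Not at h
        exact cf_mul_ι_eq_zero _ h
    have h₂ : cf u (ι K d * rightQuot d₀ (F d₀)) = 0 := by
      by_cases h : ∃ v, u = d :: v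
      · obtain ⟨v, rfl⟩ := h
        rw [cf_ι_mul]
        exact hp v fun k hk => hu 0 k (by rw [hk]; rfl)
      · push Not at h
        exact cf_ι_mul_eq_zero _ h
    rw [h₁, h₂, cf_eq_zero_of_ne H hc hd hu, sub_self]

/-- A derivation of the free algebra all of whose values are sums of commutators is inner. -/
theorem exists_eq_commutator {F : α → FreeAlgebra K α}
    (H : ∀ v, derivWord F v ∈ commutatorSpan K (FreeAlgebra K α)) :
    ∃ p, ∀ e, F e = p * ι K e - ι K e * p := by
  rcases isEmpty_or_nonempty α with hα | ⟨⟨c⟩⟩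
  · exact ⟨0, fun e => hα.elim e⟩
  obtain ⟨q, hq⟩ := exists_sub_trailToFront_eq c (F c)
  rw [trailToFront_eq_zero (pow_mul_mem_of_derivWord_mem H c), sub_zero] at hq
  have H' : ∀ v, derivWord (fun e => F e - (q * ι K e - ι K e * q)) v ∈
      commutatorSpan K (FreeAlgebra K α) := fun v => by
    rw [derivWord_sub F, derivWord_commutator]
    exact sub_mem (H v) (Submodule.subset_span ⟨_, _, rfl⟩)
  have hc : F c - (q * ι K c - ι K c * q) = 0 := by rw [hq, sub_self]
  obtain ⟨p, hp⟩ := exists_eq_commutator_of_trailToFront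
    (trailToFront_derivWord_eq_zero H' hc) hc
  refine ⟨p + q, fun e => ?_⟩
  have := sub_eq_iff_eq_add.1 (hp e)
  rw [this]
  noncomm_ring

end Inner

section Centralizer

variable {K : Type*} {α : Type*} [Field K] [DecidableEq α]

theorem cf_nil_mul (a b : FreeAlgebra K α) : cf [] (a * b) = cf [] a * cf [] b := by
  have : (LinearMap.mul K (FreeAlgebra K α)).compr₂ (cf []) =
      (LinearMap.mul K K).compl₁₂ (cf []) (cf []) := by
    refine linearMap_ext_word fun u => linearMap_ext_word fun w => ?_
    simp only [LinearMap.compr₂_apply, LinearMap.compl₁₂_apply, LinearMap.mul_apply',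
      ← word_append, cf_word, List.append_eq_nil_iff]
    split_ifs <;> simp_all
  exact LinearMap.congr_fun₂ this a b

theorem cf_nil_one : cf [] (1 : FreeAlgebra K α) = 1 := by
  rw [← word_nil, cf_word, if_pos rfl]

theorem cf_nil_ι (e : α) : cf [] (ι K e) = 0 := by
  rw [← word_singleton, cf_word, if_neg (by simp)]

theorem rightQuot_ι (e e' : α) :
    rightQuot e (ι K e') = if e' = e then (1 : FreeAlgebra K α) else 0 := by
  rw [← word_singleton, ← List.nil_append [e'], rightQuot_word_concat, word_nil]

theorem rightQuot_mul (e : α) (a b : FreeAlgebra K α) :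
    rightQuot e (a * b) = a * rightQuot e b + cf [] b • rightQuot e a := by
  have : (LinearMap.mul K (FreeAlgebra K α)).compr₂ (rightQuot e) =
      (LinearMap.mul K (FreeAlgebra K α)).compl₁₂ LinearMap.id (rightQuot e) +
        ((LinearMap.lsmul K (FreeAlgebra K α)).compl₁₂ (cf []) (rightQuot e)).flip := by
    refine linearMap_ext_word fun u => linearMap_ext_word fun w => ?_
    simp only [LinearMap.compr₂_apply, LinearMap.add_apply, LinearMap.compl₁₂_apply,
      LinearMap.flip_apply, LinearMap.mul_apply', LinearMap.lsmul_apply, LinearMap.id_apply]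
    rcases List.eq_nil_or_concat w with rfl | ⟨t, e', rfl⟩
    · simp [word_nil, rightQuot_one, cf_nil_one]
    · rw [List.concat_eq_append, ← word_append, ← List.append_assoc, rightQuot_word_concat,
        rightQuot_word_concat, cf_word, if_neg (show ¬t ++ [e'] = [] by simp), zero_smul,
        add_zero, word_append]
      split_ifs <;> simp
  exact LinearMap.congr_fun₂ this a b

omit [DecidableEq α] in
/-- If left division by `w` of the elements commuting with `w` and without constant term is
possible and lowers the length, then only the polynomials in `w` commute with `w`. -/
theorem mem_span_pow_of_commute {w : FreeAlgebra K α} (hw : w ≠ 0)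
    (D : FreeAlgebra K α → FreeAlgebra K α)
    (hD : ∀ p, p * w = w * p → p = cf [] p • 1 + w * D p)
    (hlen : ∀ p, ∀ N : ℕ, (∀ v : List α, N + 1 ≤ v.length → cf v p = 0) →
      ∀ v : List α, N ≤ v.length → cf v (D p) = 0)
    {p : FreeAlgebra K α} (hp : p * w = w * p) :
    p ∈ Submodule.span K {x : FreeAlgebra K α | ∃ l : ℕ, x = w ^ l} := by
  obtain ⟨N, hN⟩ := exists_length_bound p
  induction N generalizing p with
  | zero =>
    have : p = 0 := ext_cf fun v => by rw [hN v (by simp), map_zero]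
    rw [this]; exact zero_mem _
  | succ N ih =>
    have h := hD p hp
    have hq : D p * w = w * D p := by
      rw [h] at hp
      simp only [add_mul, mul_add, smul_mul_assoc, mul_smul_comm, one_mul, mul_one,
        add_right_inj, mul_assoc] at hp
      exact mul_left_cancel₀ hw hp
    have hmem := ih hq (hlen p N hN)
    rw [h]
    generalize D p = q at hmem ⊢
    refine add_mem (Submodule.smul_mem _ _ (Submodule.subset_span ⟨0, (pow_zero w).symm⟩)) ?_
    clear h hq
    induction hmem using Submodule.span_induction with
    | mem x hx =>
      obtain ⟨l, rfl⟩ := hx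
      exact Submodule.subset_span ⟨l + 1, (pow_succ' w l).symm⟩
    | zero => simp
    | add x y _ _ hx hy => rw [mul_add]; exact add_mem hx hy
    | smul r x _ hx => rw [mul_smul_comm]; exact Submodule.smul_mem _ _ hx

theorem mem_span_pow_of_commute_of_rightQuot_eq_one {w : FreeAlgebra K α} {e : α}
    (h₀ : cf [] w = 0) (h₁ : rightQuot e w = 1) {p : FreeAlgebra K α} (hp : p * w = w * p) :
    p ∈ Submodule.span K {x : FreeAlgebra K α | ∃ l : ℕ, x = w ^ l} := by
  refine mem_span_pow_of_commute (w := w) ?_ (rightQuot e) (fun p hp => ?_)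
    (fun p N hN v hv => ?_) hp
  · rintro rfl
    rw [map_zero] at h₁
    exact zero_ne_one h₁
  · have := congrArg (rightQuot e) hp
    rw [rightQuot_mul, rightQuot_mul, h₀, h₁, zero_smul, mul_one, add_zero] at this
    rw [add_comm]; exact this
  · rw [cf_rightQuot]
    exact hN _ (by simpa using hv)

theorem mem_span_pow_of_commute_of_rightQuot_eq_ι [CharZero K] {w : FreeAlgebra K α} {x y : α}
    (h₀ : cf [] w = 0) (hy : rightQuot y w = ι K x) (hx : rightQuot x w = -ι K y)
    {p : FreeAlgebra K α} (hp : p * w = w * p) :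
    p ∈ Submodule.span K {x : FreeAlgebra K α | ∃ l : ℕ, x = w ^ l} := by
  refine mem_span_pow_of_commute (w := w) ?_ (fun p => -rightQuot y (rightQuot x p))
    (fun p hp => ?_) (fun p N hN v hv => ?_) hp
  · rintro rfl
    rw [map_zero] at hy
    have := congrArg (rightQuot x) hy
    rw [map_zero, rightQuot_ι, if_pos rfl] at this
    exact zero_ne_one this
  · have h₁ := congrArg (rightQuot x) hp
    rw [rightQuot_mul, rightQuot_mul, h₀, hx, zero_smul, add_zero] at h₁
    have h₂ := congrArg (rightQuot y) h₁
    rw [map_add, mul_neg, smul_neg, map_neg, map_neg, map_smul, rightQuot_mul, rightQuot_mul,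
      rightQuot_ι, if_pos rfl, cf_nil_ι, zero_smul, add_zero, mul_one, hy] at h₂
    have h₃ := congrArg (fun a => cf [] (rightQuot x a)) h₂
    simp only [map_add, map_neg, map_smul, rightQuot_mul, rightQuot_ι, if_pos, hx, cf_nil_mul,
      h₀, cf_nil_ι, cf_nil_one, rightQuot_one, smul_eq_mul] at h₃
    have h₄ : cf [] (rightQuot x p) = 0 := by
      simp at h₃
      linear_combination (-1 / 2 : K) * h₃
    rw [h₄, zero_smul, add_zero] at h₂
    rw [mul_neg, ← neg_inj, h₂]
    abel
  · rw [map_neg, cf_rightQuot, cf_rightQuot, hN _ (by simp; omega), neg_zero]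

end Centralizer

section CyclicDerivative

variable {K : Type*} {α : Type*} [Field K] [DecidableEq α]

/-- For a monomial `u`, the map sending `m` to the sum of `u_{i+1} ⋯ u_l * m * u_1 ⋯ u_{i-1}` over
the positions `i` at which the letter `e` occurs in `u`. -/
noncomputable def cyclicInsertWord (e : α) :
    List α → FreeAlgebra K α →ₗ[K] FreeAlgebra K α
  | [] => 0
  | e' :: u => (if e' = e then LinearMap.mulLeft K (word K u) else 0) +
      (cyclicInsertWord e u).comp (LinearMap.mulRight K (ι K e'))

/-- The linear extension of `cyclicInsertWord`; its value at `1` is the cyclic derivative. -/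
noncomputable def cyclicInsert (e : α) :
    FreeAlgebra K α →ₗ[K] FreeAlgebra K α →ₗ[K] FreeAlgebra K α :=
  ofWords (cyclicInsertWord e)

theorem cyclicInsert_word_nil (e : α) (m : FreeAlgebra K α) :
    cyclicInsert e (word K []) m = 0 := by
  rw [cyclicInsert, ofWords_word]; rfl

theorem cyclicInsert_word_cons (e e' : α) (u : List α) (m : FreeAlgebra K α) :
    cyclicInsert e (word K (e' :: u)) m =
      (if e' = e then word K u * m else 0) + cyclicInsert e (word K u) (m * ι K e') := by
  rw [cyclicInsert, ofWords_word, ofWords_word, cyclicInsertWord]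
  split_ifs <;> simp

theorem cyclicInsert_ι (e e' : α) (m : FreeAlgebra K α) :
    cyclicInsert e (ι K e') m = if e' = e then m else 0 := by
  rw [← word_singleton, cyclicInsert_word_cons, cyclicInsert_word_nil, word_nil, one_mul, add_zero]

theorem cyclicInsert_word_eq_sum (e : α) (u : List α) (m : FreeAlgebra K α) :
    cyclicInsert e (word K u) m = ∑ i : Fin u.length, if u.get i = e then
      word K (u.drop (i.1 + 1)) * m * word K (u.take i.1) else 0 := by
  induction u generalizing m with
  | nil => exact cyclicInsert_word_nil e m
  | cons e' u ih =>
    rw [cyclicInsert_word_cons, ih]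
    refine Eq.trans ?_ (Fin.sum_univ_succ (n := u.length) _).symm
    simp [word_nil, word_cons, mul_assoc]

theorem cyclicInsert_mul (e : α) (a b m : FreeAlgebra K α) :
    cyclicInsert e (a * b) m = cyclicInsert e a (b * m) + cyclicInsert e b (m * a) := by
  induction b using induction_word with
  | add b c hb hc =>
    simp only [mul_add, add_mul, map_add, LinearMap.add_apply, hb, hc]; abel
  | smul r b hb => simp [hb]
  | word w =>
    induction a using induction_word with
    | add b c hb hc =>
      simp only [mul_add, add_mul, map_add, LinearMap.add_apply, hb, hc]; abel
    | smul r b hb => simp [hb]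
    | word u =>
      induction u generalizing m with
      | nil => rw [cyclicInsert_word_nil, word_nil, one_mul, mul_one, zero_add]
      | cons e' u ih =>
        rw [← word_append, List.cons_append, cyclicInsert_word_cons, word_append, ih,
          cyclicInsert_word_cons, word_cons, mul_assoc m, mul_assoc (word K w), add_assoc,
          mul_assoc (word K u)]

theorem cyclicInsert_pow (e : α) (w : FreeAlgebra K α) (l k : ℕ) :
    cyclicInsert e (w ^ (l + 1)) (w ^ k) = ((l : K) + 1) • cyclicInsert e w (w ^ (l + k)) := by
  induction l generalizing k with
  | zero => simp
  | succ l ih =>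
    rw [pow_succ, cyclicInsert_mul, ← pow_succ', ← pow_add, ih, Nat.cast_succ,
      add_smul ((l : K) + 1), one_smul, show l + (k + 1) = l + 1 + k by ring, add_comm k]

theorem cyclicInsert_commutator (e : α) (a b : FreeAlgebra K α) :
    cyclicInsert e (a * b - b * a) 1 = 0 := by
  rw [map_sub, LinearMap.sub_apply, cyclicInsert_mul, cyclicInsert_mul]
  simp only [mul_one, one_mul]
  abel

theorem sum_commutator_cyclicInsert [Fintype α] (a m : FreeAlgebra K α) :
    ∑ e, (ι K e * cyclicInsert e a m - cyclicInsert e a m * ι K e) = a * m - m * a := by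
  induction a using induction_word with
  | add b c hb hc =>
    simp only [mul_add, add_mul, map_add, LinearMap.add_apply, add_sub_add_comm,
      Finset.sum_add_distrib, hb, hc]
  | smul r b hb => simp [hb, ← smul_sub, ← Finset.smul_sum]
  | word u =>
    induction u generalizing m with
    | nil =>
      simp only [cyclicInsert_word_nil]
      simp [word_nil]
    | cons e' u ih =>
      simp only [cyclicInsert_word_cons, mul_add, add_mul, add_sub_add_comm,
        Finset.sum_add_distrib, ih, mul_ite, ite_mul, mul_zero, zero_mul]
      rw [Finset.sum_sub_distrib, Finset.sum_ite_eq, Finset.sum_ite_eq, word_cons]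
      simp only [Finset.mem_univ, if_true]
      noncomm_ring

/-- The operator dividing a monomial of length `l` by `l + 1`. -/
noncomputable def divLengthSucc : FreeAlgebra K α →ₗ[K] FreeAlgebra K α :=
  ofWords fun v => ((v.length : K) + 1)⁻¹ • word K v

omit [DecidableEq α] in
theorem divLengthSucc_word (v : List α) :
    divLengthSucc (word K v) = ((v.length : K) + 1)⁻¹ • word K v := ofWords_word _ _

theorem divLengthSucc_cyclicInsert (e : α) (u w : List α) :
    divLengthSucc (cyclicInsert e (word K u) (word K w)) =
      ((u.length : K) + w.length)⁻¹ • cyclicInsert e (word K u) (word K w) := by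
  induction u generalizing w with
  | nil => simp [cyclicInsert_word_nil]
  | cons e' u ih =>
    rw [cyclicInsert_word_cons, map_add, ← word_concat, ih, smul_add]
    congr 1
    · split_ifs
      · rw [← word_append, divLengthSucc_word]
        congr 2
        simp only [List.length_append, List.length_cons]
        push_cast
        ring
      · simp
    · congr 2
      simp only [List.length_append, List.length_cons, List.length_nil]
      push_cast
      ring

theorem sum_mul_cyclicInsert_sub_mem [Fintype α] (u : List α) (m : FreeAlgebra K α) :
    ∑ e, ι K e * cyclicInsert e (word K u) m - (u.length : K) • (word K u * m) ∈
      commutatorSpan K (FreeAlgebra K α) := by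
  induction u generalizing m with
  | nil => simp [cyclicInsert_word_nil]
  | cons e' u ih =>
    have h : (((u.length : K)) • (word K u * m)) * ι K e' -
        ι K e' * (((u.length : K)) • (word K u * m)) ∈ commutatorSpan K (FreeAlgebra K α) :=
      Submodule.subset_span ⟨_, _, rfl⟩
    convert add_mem (ih (m * ι K e')) h using 1
    simp only [cyclicInsert_word_cons, mul_add, Finset.sum_add_distrib, mul_ite, mul_zero]
    rw [Finset.sum_ite_eq]
    simp only [Finset.mem_univ, if_true, List.length_cons, Nat.cast_succ, add_smul, one_smul,
      word_cons, smul_mul_assoc, mul_smul_comm, mul_assoc]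
    abel

/-- Modulo commutators, an element is recovered from its cyclic derivatives. -/
theorem sub_sum_divLengthSucc_mem [Fintype α] [CharZero K] (a : FreeAlgebra K α) :
    a - (cf [] a • 1 + ∑ e, ι K e * divLengthSucc (cyclicInsert e a 1)) ∈
      commutatorSpan K (FreeAlgebra K α) := by
  induction a using induction_word with
  | add b c hb hc =>
    convert add_mem hb hc using 1
    simp only [mul_add, map_add, LinearMap.add_apply, Finset.sum_add_distrib, add_smul]
    abel
  | smul r b hb =>
    convert Submodule.smul_mem _ r hb using 1
    simp only [map_smul, LinearMap.smul_apply, mul_smul_comm, ← Finset.smul_sum, smul_assoc,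
      smul_sub, smul_add]
  | word u =>
    have h := sum_mul_cyclicInsert_sub_mem (K := K) u 1
    simp only [← word_nil (K := K) (α := α), divLengthSucc_cyclicInsert, List.length_nil,
      Nat.cast_zero, add_zero, mul_smul_comm, ← Finset.smul_sum] at h ⊢
    rw [cf_word]
    rcases eq_or_ne u [] with rfl | hu
    · simp
    · have hl : (u.length : K) ≠ 0 := by simpa using hu
      convert Submodule.smul_mem _ (-(u.length : K)⁻¹) h using 1
      rw [if_neg hu, smul_sub, smul_smul, neg_mul, inv_mul_cancel₀ hl, word_nil, mul_one]
      simp only [zero_smul, neg_smul, one_smul]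
      abel

end CyclicDerivative

end FreeAlgebra

section GoldmanTuraev

open FreeAlgebra

variable {K : Type*} [Field K] {g n : ℕ}

/-- The values on the letters of the derivation by which `a` acts under the double bracket. -/
noncomputable def gtAction (a : FreeAlgebra K (GTLetter g n)) :
    GTLetter g n → FreeAlgebra K (GTLetter g n)
  | Sum.inl i => -cyclicInsert (Sum.inr (Sum.inl i)) a 1
  | Sum.inr (Sum.inl i) => cyclicInsert (Sum.inl i) a 1
  | Sum.inr (Sum.inr j) => ι K (Sum.inr (Sum.inr j)) * cyclicInsert (Sum.inr (Sum.inr j)) a 1 -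
      cyclicInsert (Sum.inr (Sum.inr j)) a 1 * ι K (Sum.inr (Sum.inr j))

theorem gtAction_add (a b : FreeAlgebra K (GTLetter g n)) (e : GTLetter g n) :
    gtAction (a + b) e = gtAction a e + gtAction b e := by
  rcases e with i | i | j <;> simp only [gtAction, map_add, LinearMap.add_apply, mul_add,
    add_mul] <;> abel

theorem gtAction_smul (r : K) (a : FreeAlgebra K (GTLetter g n)) (e : GTLetter g n) :
    gtAction (r • a) e = r • gtAction a e := by
  rcases e with i | i | j <;> simp [gtAction, smul_sub]

theorem gtAction_word (u : List (GTLetter g n)) (e : GTLetter g n) :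
    gtAction (word K u) e = ∑ i : Fin u.length,
      (gtPairing K (u.get i) e • (word K (u.drop (i.1 + 1)) * word K (u.take i.1)) +
        gtZ K e (u.get i) * (word K (u.drop (i.1 + 1)) * word K (u.take i.1)) -
        word K (u.drop (i.1 + 1)) * word K (u.take i.1) * gtZ K (u.get i) e) := by
  rcases e with i | i | j
  · rw [gtAction, cyclicInsert_word_eq_sum, ← Finset.sum_neg_distrib]
    refine Finset.sum_congr rfl fun k _ => ?_
    rcases u.get k with i' | i' | j' <;> simp [gtPairing, gtZ]
    split_ifs <;> simp
  · rw [gtAction, cyclicInsert_word_eq_sum]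
    refine Finset.sum_congr rfl fun k _ => ?_
    rcases u.get k with i' | i' | j' <;> simp [gtPairing, gtZ]
  · rw [gtAction, cyclicInsert_word_eq_sum, Finset.mul_sum, Finset.sum_mul,
      ← Finset.sum_sub_distrib]
    refine Finset.sum_congr rfl fun k _ => ?_
    rcases u.get k with i' | i' | j'
    · simp [gtPairing, gtZ]
    · simp [gtPairing, gtZ]
    · by_cases h : j' = j
      · subst h; simp [gtPairing, gtZ]
      · simp [gtPairing, gtZ, h, Ne.symm h]

theorem mul'_gtPiGrFormula (u v : List (GTLetter g n)) :
    LinearMap.mul' K (FreeAlgebra K (GTLetter g n)) (gtPiGrFormula K u v) =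
      derivWord (gtAction (word K u)) v := by
  have hw : ∀ w : List (GTLetter g n), wordProd K w = word K w := fun _ => rfl
  rw [derivWord_eq_sum, gtPiGrFormula, Finset.sum_comm, map_sum]
  refine Finset.sum_congr rfl fun j _ => ?_
  rw [map_sum, gtAction_word, Finset.mul_sum, Finset.sum_mul]
  refine Finset.sum_congr rfl fun i _ => ?_
  simp only [map_sub, map_add, map_smul, LinearMap.mul'_apply, hw, word_append, mul_add, mul_sub,
    add_mul, sub_mul, mul_smul_comm, smul_mul_assoc, mul_assoc]

theorem mul'_eq_derivWord
    {P : FreeAlgebra K (GTLetter g n) →ₗ[K] FreeAlgebra K (GTLetter g n) →ₗ[K]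
      FreeAlgebra K (GTLetter g n) ⊗[K] FreeAlgebra K (GTLetter g n)}
    (hP : ∀ u v : List (GTLetter g n),
      P (wordProd K u) (wordProd K v) = gtPiGrFormula K u v)
    (a : FreeAlgebra K (GTLetter g n)) (v : List (GTLetter g n)) :
    LinearMap.mul' K (FreeAlgebra K (GTLetter g n)) (P a (word K v)) =
      derivWord (gtAction a) v := by
  induction a using induction_word with
  | word u => rw [← mul'_gtPiGrFormula, ← hP]; rfl
  | add a b ha hb =>
    rw [funext (gtAction_add a b), derivWord_add, ← ha, ← hb, map_add, LinearMap.add_apply,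
      map_add]
  | smul r a ha =>
    rw [funext (gtAction_smul r a), derivWord_smul, ← ha, map_smul, LinearMap.smul_apply, map_smul]

theorem mkQ_mul'_eq_zero_iff
    {P : FreeAlgebra K (GTLetter g n) →ₗ[K] FreeAlgebra K (GTLetter g n) →ₗ[K]
      FreeAlgebra K (GTLetter g n) ⊗[K] FreeAlgebra K (GTLetter g n)}
    (hP : ∀ u v : List (GTLetter g n),
      P (wordProd K u) (wordProd K v) = gtPiGrFormula K u v)
    (a : FreeAlgebra K (GTLetter g n)) :
    (∀ b, (commutatorSpan K (FreeAlgebra K (GTLetter g n))).mkQ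
        (LinearMap.mul' K (FreeAlgebra K (GTLetter g n)) (P a b)) = 0) ↔
      ∀ v, derivWord (gtAction a) v ∈ commutatorSpan K (FreeAlgebra K (GTLetter g n)) := by
  simp only [Submodule.mkQ_apply, Submodule.Quotient.mk_eq_zero]
  refine ⟨fun h v => mul'_eq_derivWord hP a v ▸ h _, fun h b => ?_⟩
  induction b using induction_word with
  | word v => rw [mul'_eq_derivWord hP]; exact h v
  | add b c hb hc => rw [map_add, map_add]; exact add_mem hb hc
  | smul r b hb => rw [map_smul, map_smul]; exact Submodule.smul_mem _ _ hb

theorem gtAction_one (e : GTLetter g n) : gtAction (1 : FreeAlgebra K (GTLetter g n)) e = 0 := by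
  have h : ∀ e : GTLetter g n, cyclicInsert e (1 : FreeAlgebra K (GTLetter g n)) 1 = 0 :=
    fun e => cyclicInsert_word_nil e 1
  rcases e with i | i | j <;> simp [gtAction, h]

theorem gtAction_commutator (a b : FreeAlgebra K (GTLetter g n)) (e : GTLetter g n) :
    gtAction (a * b - b * a) e = 0 := by
  rcases e with i | i | j <;> simp only [gtAction, cyclicInsert_commutator] <;> simp

theorem gtAction_eq_zero_of_mem_commutatorSpan {a : FreeAlgebra K (GTLetter g n)}
    (ha : a ∈ commutatorSpan K (FreeAlgebra K (GTLetter g n))) (e : GTLetter g n) :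
    gtAction a e = 0 := by
  induction ha using Submodule.span_induction with
  | mem x hx => obtain ⟨p, q, rfl⟩ := hx; exact gtAction_commutator p q e
  | zero => simpa using gtAction_commutator (0 : FreeAlgebra K (GTLetter g n)) 0 e
  | add x y _ _ hx hy => simp only [gtAction_add, hx, hy, add_zero]
  | smul r x _ hx => simp only [gtAction_smul, hx, smul_zero]

theorem cyclicInsert_ι_pow_self (e : GTLetter g n) (l : ℕ) :
    cyclicInsert e (ι K e ^ (l + 1)) 1 = ((l : K) + 1) • ι K e ^ l := by
  simpa [cyclicInsert_ι] using cyclicInsert_pow e (ι K e) l 0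

theorem cyclicInsert_ι_pow_of_ne {e e' : GTLetter g n} (h : e' ≠ e) (l : ℕ) :
    cyclicInsert e (ι K e' ^ (l + 1)) 1 = 0 := by
  simpa [cyclicInsert_ι, h] using cyclicInsert_pow e (ι K e') l 0

theorem gtAction_ι_pow (j : Fin n) (l : ℕ) (e : GTLetter g n) :
    gtAction (ι K (Sum.inr (Sum.inr j) : GTLetter g n) ^ (l + 1)) e = 0 := by
  rcases e with i | i | j'
  · rw [gtAction, cyclicInsert_ι_pow_of_ne (by simp), neg_zero]
  · rw [gtAction, cyclicInsert_ι_pow_of_ne (by simp)]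
  · rw [gtAction]
    rcases eq_or_ne j j' with rfl | h
    · rw [cyclicInsert_ι_pow_self, mul_smul_comm, smul_mul_assoc, ← pow_succ, ← pow_succ', sub_self]
    · rw [cyclicInsert_ι_pow_of_ne (by simpa using h), mul_zero, zero_mul, sub_zero]

variable (K g n) in
/-- The boundary element `∑ᵢ (xᵢyᵢ − yᵢxᵢ) + ∑ⱼ zⱼ`. -/
noncomputable def gtOmega : FreeAlgebra K (GTLetter g n) :=
  (∑ i : Fin g, (ι K (Sum.inl i) * ι K (Sum.inr (Sum.inl i)) -
      ι K (Sum.inr (Sum.inl i)) * ι K (Sum.inl i))) +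
    ∑ j : Fin n, ι K (Sum.inr (Sum.inr j))

theorem cyclicInsert_gtOmega_inl (i : Fin g) (m : FreeAlgebra K (GTLetter g n)) :
    cyclicInsert (Sum.inl i) (gtOmega K g n) m =
      ι K (Sum.inr (Sum.inl i)) * m - m * ι K (Sum.inr (Sum.inl i)) := by
  simp [gtOmega, cyclicInsert_mul, cyclicInsert_ι, Finset.sum_sub_distrib]

theorem cyclicInsert_gtOmega_inr_inl (i : Fin g) (m : FreeAlgebra K (GTLetter g n)) :
    cyclicInsert (Sum.inr (Sum.inl i)) (gtOmega K g n) m =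
      m * ι K (Sum.inl i) - ι K (Sum.inl i) * m := by
  simp [gtOmega, cyclicInsert_mul, cyclicInsert_ι, Finset.sum_sub_distrib]

theorem cyclicInsert_gtOmega_inr_inr (j : Fin n) (m : FreeAlgebra K (GTLetter g n)) :
    cyclicInsert (Sum.inr (Sum.inr j)) (gtOmega K g n) m = m := by
  simp [gtOmega, cyclicInsert_mul, cyclicInsert_ι, Finset.sum_sub_distrib]

theorem gtAction_gtOmega_pow (l : ℕ) (e : GTLetter g n) :
    gtAction (gtOmega K g n ^ (l + 1)) e =
      -((l : K) + 1) • (gtOmega K g n ^ l * ι K e - ι K e * gtOmega K g n ^ l) := by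
  have h := fun e => cyclicInsert_pow e (gtOmega K g n) l 0
  simp only [pow_zero, add_zero] at h
  rcases e with i | i | j
  · rw [gtAction, h, cyclicInsert_gtOmega_inr_inl, neg_smul]
  · rw [gtAction, h, cyclicInsert_gtOmega_inl, neg_smul, ← smul_neg, neg_sub]
  · rw [gtAction, h, cyclicInsert_gtOmega_inr_inr, neg_smul, ← smul_neg, neg_sub, mul_smul_comm,
      smul_mul_assoc, smul_sub]

theorem exists_gtAction_eq_commutator [CharZero K] {p : FreeAlgebra K (GTLetter g n)}
    (hp : p ∈ Submodule.span K {x | ∃ l : ℕ, x = gtOmega K g n ^ l}) :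
    ∃ a ∈ Submodule.span K {x | ∃ l : ℕ, x = gtOmega K g n ^ l},
      ∀ e, gtAction a e = p * ι K e - ι K e * p := by
  induction hp using Submodule.span_induction with
  | mem x hx =>
    obtain ⟨l, rfl⟩ := hx
    refine ⟨(-((l : K) + 1))⁻¹ • gtOmega K g n ^ (l + 1),
      Submodule.smul_mem _ _ (Submodule.subset_span ⟨_, rfl⟩), fun e => ?_⟩
    rw [gtAction_smul, gtAction_gtOmega_pow,
      inv_smul_smul₀ (neg_ne_zero.2 (Nat.cast_add_one_ne_zero l))]
  | zero => exact ⟨0, zero_mem _, fun e => by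
      simpa using gtAction_commutator (0 : FreeAlgebra K (GTLetter g n)) 0 e⟩
  | add x y _ _ hx hy =>
    obtain ⟨a, ha, ha'⟩ := hx
    obtain ⟨b, hb, hb'⟩ := hy
    refine ⟨a + b, add_mem ha hb, fun e => ?_⟩
    rw [gtAction_add, ha', hb', add_mul, mul_add]
    abel
  | smul r x _ hx =>
    obtain ⟨a, ha, ha'⟩ := hx
    refine ⟨r • a, Submodule.smul_mem _ _ ha, fun e => ?_⟩
    rw [gtAction_smul, ha', smul_sub, smul_mul_assoc, mul_smul_comm]

theorem mem_span_gtOmega_pow [CharZero K] (e₀ : GTLetter g n) {p : FreeAlgebra K (GTLetter g n)}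
    (hp : p * gtOmega K g n = gtOmega K g n * p) :
    p ∈ Submodule.span K {x | ∃ l : ℕ, x = gtOmega K g n ^ l} := by
  have h₀ : cf [] (gtOmega K g n) = 0 := by simp [gtOmega, cf_nil_mul, cf_nil_ι]
  have hx : ∀ i, rightQuot (Sum.inl i) (gtOmega K g n) = -ι K (Sum.inr (Sum.inl i)) := fun i => by
    simp [gtOmega, rightQuot_mul, rightQuot_ι, cf_nil_ι]
  have hy : ∀ i, rightQuot (Sum.inr (Sum.inl i)) (gtOmega K g n) = ι K (Sum.inl i) := fun i => by
    simp [gtOmega, rightQuot_mul, rightQuot_ι, cf_nil_ι]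
  rcases e₀ with i | i | j
  · exact mem_span_pow_of_commute_of_rightQuot_eq_ι h₀ (hy i) (hx i) hp
  · exact mem_span_pow_of_commute_of_rightQuot_eq_ι h₀ (hy i) (hx i) hp
  · refine mem_span_pow_of_commute_of_rightQuot_eq_one (e := Sum.inr (Sum.inr j)) h₀ ?_ hp
    simp [gtOmega, rightQuot_mul, rightQuot_ι, cf_nil_ι]

theorem commute_gtOmega_of_gtAction_eq_commutator {a p : FreeAlgebra K (GTLetter g n)}
    (h : ∀ e, gtAction a e = p * ι K e - ι K e * p) :
    p * gtOmega K g n = gtOmega K g n * p := by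
  have hs := sum_commutator_cyclicInsert (K := K) a 1
  simp only [Fintype.sum_sum_type, mul_one, one_mul, sub_self] at hs
  rw [← add_assoc, ← Finset.sum_add_distrib] at hs
  rw [← sub_eq_zero, ← hs, gtOmega, mul_add, add_mul, add_sub_add_comm]
  simp only [Finset.mul_sum, Finset.sum_mul, ← Finset.sum_sub_distrib]
  congr 1
  · refine Finset.sum_congr rfl fun i _ => ?_
    have hx := h (Sum.inl i)
    have hy := h (Sum.inr (Sum.inl i))
    simp only [gtAction] at hx hy
    rw [hy, ← neg_neg (cyclicInsert (Sum.inr (Sum.inl i)) a 1), hx]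
    noncomm_ring
  · refine Finset.sum_congr rfl fun j _ => ?_
    exact (h (Sum.inr (Sum.inr j))).symm

theorem mem_of_gtAction_eq_zero [CharZero K] {b : FreeAlgebra K (GTLetter g n)}
    (h : ∀ e, gtAction b e = 0) :
    b ∈ commutatorSpan K (FreeAlgebra K (GTLetter g n)) ⊔ Submodule.span K {1} ⊔
      Submodule.span K {x | ∃ (j : Fin n) (l : ℕ), 1 ≤ l ∧
        x = ι K (Sum.inr (Sum.inr j) : GTLetter g n) ^ l} := by
  have hb := sub_sum_divLengthSucc_mem b
  rw [← sub_add_cancel b (cf [] b • 1 + _)]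
  refine add_mem (Submodule.mem_sup_left (Submodule.mem_sup_left hb)) (add_mem
    (Submodule.mem_sup_left (Submodule.mem_sup_right (Submodule.smul_mem _ _
      (Submodule.mem_span_singleton_self _)))) (Submodule.mem_sup_right
        (Submodule.sum_mem _ fun e _ => ?_)))
  rcases e with i | i | j
  · have := h (Sum.inr (Sum.inl i))
    rw [gtAction] at this
    rw [this, map_zero, mul_zero]
    exact zero_mem _
  · have := h (Sum.inl i)
    rw [gtAction, neg_eq_zero] at this
    rw [this, map_zero, mul_zero]
    exact zero_mem _
  · have := h (Sum.inr (Sum.inr j))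
    rw [gtAction, sub_eq_zero] at this
    have hq := mem_span_pow_of_commute_of_rightQuot_eq_one (e := Sum.inr (Sum.inr j))
      (cf_nil_ι _) (by rw [rightQuot_ι, if_pos rfl]) this.symm
    generalize cyclicInsert (Sum.inr (Sum.inr j)) b 1 = q at hq
    induction hq using Submodule.span_induction with
    | mem x hx =>
      obtain ⟨l, rfl⟩ := hx
      rw [← word_replicate, divLengthSucc_word, word_replicate, mul_smul_comm, ← pow_succ']
      exact Submodule.smul_mem _ _ (Submodule.subset_span ⟨j, l + 1, by simp, rfl⟩)
    | zero => simp
    | add x y _ _ hx hy => rw [map_add, mul_add]; exact add_mem hx hy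
    | smul r x _ hx => rw [map_smul, mul_smul_comm]; exact Submodule.smul_mem _ _ hx

theorem derivWord_gtAction_mem_iff [CharZero K] (a : FreeAlgebra K (GTLetter g n)) :
    (∀ v, derivWord (gtAction a) v ∈ commutatorSpan K (FreeAlgebra K (GTLetter g n))) ↔
      ∃ p, ∀ e, gtAction a e = p * ι K e - ι K e * p := by
  refine ⟨exists_eq_commutator, fun ⟨p, hp⟩ v => ?_⟩
  rw [funext hp, derivWord_commutator]
  exact Submodule.subset_span ⟨_, _, rfl⟩

theorem exists_gtAction_eq_commutator_iff [CharZero K] (a : FreeAlgebra K (GTLetter g n)) :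
    (∃ p, ∀ e, gtAction a e = p * ι K e - ι K e * p) ↔
      a ∈ commutatorSpan K (FreeAlgebra K (GTLetter g n))
          ⊔ Submodule.span K {x | ∃ l : ℕ, x = gtOmega K g n ^ l}
          ⊔ Submodule.span K {x | ∃ (j : Fin n) (l : ℕ), 1 ≤ l ∧
              x = ι K (Sum.inr (Sum.inr j) : GTLetter g n) ^ l} := by
  constructor
  · rintro ⟨p, hp⟩
    obtain ⟨a', ha', h⟩ : ∃ a' ∈ Submodule.span K {x | ∃ l : ℕ, x = gtOmega K g n ^ l},
        ∀ e, gtAction a' e = gtAction a e := by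
      rcases isEmpty_or_nonempty (GTLetter g n) with he | ⟨⟨e₀⟩⟩
      · exact ⟨0, zero_mem _, fun e => he.elim e⟩
      · simp only [hp]
        exact exists_gtAction_eq_commutator
          (mem_span_gtOmega_pow e₀ (commute_gtOmega_of_gtAction_eq_commutator hp))
    have hb : ∀ e, gtAction (a + (-1 : K) • a') e = 0 := fun e => by
      rw [gtAction_add, gtAction_smul]
      simp only [h, neg_smul, one_smul, add_neg_cancel]
    rw [← sub_add_cancel a a']
    refine add_mem ?_ (Submodule.mem_sup_left (Submodule.mem_sup_right ha'))
    rw [sub_eq_add_neg, ← neg_one_smul K a']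
    have h₁ : Submodule.span K {(1 : FreeAlgebra K (GTLetter g n))} ≤
        Submodule.span K {x | ∃ l : ℕ, x = gtOmega K g n ^ l} :=
      Submodule.span_mono (by rintro _ rfl; exact ⟨0, (pow_zero _).symm⟩)
    exact sup_le_sup (sup_le_sup le_rfl h₁) le_rfl (mem_of_gtAction_eq_zero hb)
  · intro ha
    obtain ⟨b, hb, d, hd, rfl⟩ := Submodule.mem_sup.1 ha
    obtain ⟨c, hc, w, hw, rfl⟩ := Submodule.mem_sup.1 hb
    have hd' : ∀ e, gtAction d e = 0 := fun e => by
      clear ha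
      induction hd using Submodule.span_induction with
      | mem x hx =>
        obtain ⟨j, l, hl, rfl⟩ := hx
        obtain ⟨l, rfl⟩ := Nat.exists_eq_add_of_le' hl
        exact gtAction_ι_pow j l e
      | zero => exact gtAction_eq_zero_of_mem_commutatorSpan (zero_mem _) e
      | add x y _ _ hx hy => simp only [gtAction_add, hx, hy, add_zero]
      | smul r x _ hx => simp only [gtAction_smul, hx, smul_zero]
    simp only [gtAction_add, gtAction_eq_zero_of_mem_commutatorSpan hc, hd', zero_add, add_zero]
    clear ha hb hd hd' hc
    induction hw using Submodule.span_induction with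
    | mem x hx =>
      obtain ⟨l, rfl⟩ := hx
      cases l with
      | zero => exact ⟨0, fun e => by simp [gtAction_one]⟩
      | succ l =>
        refine ⟨(-((l : K) + 1)) • gtOmega K g n ^ l, fun e => ?_⟩
        rw [gtAction_gtOmega_pow, smul_sub, smul_mul_assoc, mul_smul_comm]
    | zero =>
      exact ⟨0, fun e => by simpa using gtAction_commutator (0 : FreeAlgebra K (GTLetter g n)) 0 e⟩
    | add x y _ _ hx hy =>
      obtain ⟨p, hp⟩ := hx
      obtain ⟨q, hq⟩ := hy
      exact ⟨p + q, fun e => by rw [gtAction_add, hp, hq, add_mul, mul_add]; abel⟩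
    | smul r x _ hx =>
      obtain ⟨p, hp⟩ := hx
      exact ⟨r • p, fun e => by rw [gtAction_smul, hp, smul_sub, smul_mul_assoc, mul_smul_comm]⟩

end GoldmanTuraev

/-- With `Π_gr` defined on monomials by the explicit formula and
`B(a,b) = |m(Π_gr(a,b))| ∈ |A| = A/[A,A]`, the set `{a | B(a,b) = 0 for all b}` equals
`[A,A] + span{ω^l : l ≥ 0} + span{zⱼ^l : 1 ≤ j ≤ n, l ≥ 1}` where
`ω = Σᵢ (xᵢyᵢ − yᵢxᵢ) + Σⱼ zⱼ`; that is, the center of the induced Lie bracket on `|A|`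
is spanned by the classes `|ω^l|` and `|zⱼ^l|`. -/
theorem stmt_7 (K : Type*) [Field K] [CharZero K] (g n : ℕ)
    (P : FreeAlgebra K (GTLetter g n) →ₗ[K] FreeAlgebra K (GTLetter g n) →ₗ[K]
      FreeAlgebra K (GTLetter g n) ⊗[K] FreeAlgebra K (GTLetter g n))
    (hP : ∀ u v : List (GTLetter g n),
      P (wordProd K u) (wordProd K v) = gtPiGrFormula K u v)
    (ω : FreeAlgebra K (GTLetter g n))
    (hω : ω = (∑ i : Fin g,
        (FreeAlgebra.ι K (Sum.inl i) * FreeAlgebra.ι K (Sum.inr (Sum.inl i)) -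
          FreeAlgebra.ι K (Sum.inr (Sum.inl i)) * FreeAlgebra.ι K (Sum.inl i))) +
      ∑ j : Fin n, FreeAlgebra.ι K (Sum.inr (Sum.inr j))) :
    {a : FreeAlgebra K (GTLetter g n) |
        ∀ b : FreeAlgebra K (GTLetter g n),
          (commutatorSpan K (FreeAlgebra K (GTLetter g n))).mkQ
            (LinearMap.mul' K (FreeAlgebra K (GTLetter g n)) (P a b)) = 0}
      = ↑(commutatorSpan K (FreeAlgebra K (GTLetter g n))
          ⊔ Submodule.span K {x : FreeAlgebra K (GTLetter g n) | ∃ l : ℕ, x = ω ^ l}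
          ⊔ Submodule.span K {x : FreeAlgebra K (GTLetter g n) |
              ∃ (j : Fin n) (l : ℕ), 1 ≤ l ∧ x = FreeAlgebra.ι K (Sum.inr (Sum.inr j)) ^ l}) := by
  subst hω
  ext a
  exact (mkQ_mul'_eq_zero_iff hP a).trans
    ((derivWord_gtAction_mem_iff a).trans (exists_gtAction_eq_commutator_iff a))
end

section
/- Let K be a field of characteristic zero and g₁, g₂, n₁, n₂ ≥ 0. Let B be the free Lie algebra over K on two generators z₁, z₂, and let L be the free Lie algebra over K on the generators x_i^k, y_i^k (1 ≤ i ≤ g_k) and z_j^k (1 ≤ j ≤ n_k), for k = 1, 2. Let s : B → L be the Lie algebra homomorphism with s(z_k) = ω_k := Σ_{i=1}^{g_k} ⁅x_i^k, y_i^k⁆ + Σ_{j=1}^{n_k} z_j^k. For a pair u = (u₁,u₂) ∈ B × B, let û be the derivation of B with û(z_k) = ⁅z_k, u_k⁆, and let 𝒫(u) be the derivation of L sending each generator w belonging to block k (i.e. each x_i^k, y_i^k, z_j^k) to ⁅w, s(u_k)⁆. Define a bracket on B × B by ⟦(u₁,u₂),(v₁,v₂)⟧ := (û(v₁) − v̂(u₁)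 + ⁅u₁,v₁⁆, û(v₂) − v̂(u₂) + ⁅u₂,v₂⁆). Then 𝒫 is a Lie algebra homomorphism: 𝒫(⟦u,v⟧) = 𝒫(u) ∘ 𝒫(v) − 𝒫(v) ∘ 𝒫(u) for all u, v ∈ B × B. -/
/-- Induction principle for free Lie algebras. -/
theorem FreeLieAlgebra.induction_of {R X : Type*} [CommRing R] (p : FreeLieAlgebra R X → Prop)
    (of : ∀ x, p (of R x)) (zero : p 0) (add : ∀ a b, p a → p b → p (a + b))
    (smul : ∀ (r : R) a, p a → p (r • a)) (lie : ∀ a b, p a → p b → p ⁅a, b⁆)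
    (a : FreeLieAlgebra R X) : p a := by
  let S : LieSubalgebra R (FreeLieAlgebra R X) :=
    { carrier := {a | p a}
      zero_mem' := zero
      add_mem' := fun ha hb => add _ _ ha hb
      smul_mem' := fun r _ ha => smul r _ ha
      lie_mem' := fun ha hb => lie _ _ ha hb }
  let f : FreeLieAlgebra R X →ₗ⁅R⁆ S := FreeLieAlgebra.lift R fun x => ⟨FreeLieAlgebra.of R x, of x⟩
  have h : S.incl.comp f = LieHom.id := FreeLieAlgebra.hom_ext fun x => by simp [f]
  have ha : ((f a : S) : FreeLieAlgebra R X) = a := LieHom.congr_fun h a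
  exact ha ▸ (f a).2

/-- If a derivation `P` of a Lie algebra and a derivation `D` of a free Lie algebra are intertwined
by a homomorphism `s` on the generators, then they are intertwined by `s` everywhere. -/
theorem FreeLieAlgebra.derivation_comp_eq {R X L : Type*} [CommRing R] [LieRing L] [LieAlgebra R L]
    (s : FreeLieAlgebra R X →ₗ⁅R⁆ L) (D : FreeLieAlgebra R X →ₗ[R] FreeLieAlgebra R X)
    (P : L →ₗ[R] L) (hD : ∀ a b, D ⁅a, b⁆ = ⁅D a, b⁆ + ⁅a, D b⁆)
    (hP : ∀ a b, P ⁅a, b⁆ = ⁅P a, b⁆ + ⁅a, P b⁆)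
    (h : ∀ x, P (s (of R x)) = s (D (of R x))) (a : FreeLieAlgebra R X) :
    P (s a) = s (D a) := by
  induction a using FreeLieAlgebra.induction_of with
  | of x => exact h x
  | zero => simp
  | add a b ha hb => simp [ha, hb]
  | smul r a ha => simp [ha]
  | lie a b ha hb => simp [hD, hP, ha, hb]

/-- A linear map satisfying the Leibniz rule that acts as `⁅·, c⁆` on all the generators of a sum of
brackets and generators acts as `⁅·, c⁆` on that sum. -/
theorem derivation_sum_lie_add_sum {R L ι κ : Type*} [Fintype ι] [Fintype κ] [CommRing R]
    [LieRing L] [LieAlgebra R L] (P : L →ₗ[R] L) (hP : ∀ a b, P ⁅a, b⁆ = ⁅P a, b⁆ + ⁅a, P b⁆)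
    (c : L) (x y : ι → L) (z : κ → L) (hx : ∀ i, P (x i) = ⁅x i, c⁆)
    (hy : ∀ i, P (y i) = ⁅y i, c⁆) (hz : ∀ j, P (z j) = ⁅z j, c⁆) :
    P (∑ i, ⁅x i, y i⁆ + ∑ j, z j) = ⁅∑ i, ⁅x i, y i⁆ + ∑ j, z j, c⁆ := by
  rw [map_add, map_sum, map_sum, add_lie, sum_lie, sum_lie]
  congr 1
  · refine Finset.sum_congr rfl fun i _ => ?_
    rw [hP, hx, hy, lie_lie (x i) (y i) c, ← lie_skew (y i) ⁅x i, c⁆]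
    abel
  · exact Finset.sum_congr rfl fun j _ => hz j


/-- Let `B` be the free Lie algebra on `z₁, z₂` and `L` the free Lie
algebra on the generators `xᵢᵏ, yᵢᵏ, zⱼᵏ` (`k = 1,2`).  Let `s : B → L` send `z_k` to
`ω_k = Σᵢ ⁅xᵢᵏ,yᵢᵏ⁆ + Σⱼ zⱼᵏ`.  For a pair `u = (u₁,u₂)` let `û` be the (tangential)
derivation of `B` with `û(z_k) = ⁅z_k, u_k⁆` and `𝒫(u)` the derivation of `L` sending a
generator `t` of block `k` to `⁅t, s(u_k)⁆`.  With the `𝔱𝔡𝔢𝔯⁽⁰'³⁾`-bracket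
`⟦u,v⟧ = (û(v₁) − v̂(u₁) + ⁅u₁,v₁⁆, û(v₂) − v̂(u₂) + ⁅u₂,v₂⁆)`, the map `𝒫` is a Lie
algebra homomorphism: `𝒫(⟦u,v⟧) = 𝒫(u)∘𝒫(v) − 𝒫(v)∘𝒫(u)`. -/
theorem stmt_10 (K : Type*) [Field K] [CharZero K] (gg nn : Fin 2 → ℕ)
    (u v : Fin 2 → FreeLieAlgebra K (Fin 2))
    (Du Dv : FreeLieAlgebra K (Fin 2) →ₗ[K] FreeLieAlgebra K (Fin 2))
    (hDuLeib : ∀ a b : FreeLieAlgebra K (Fin 2), Du ⁅a, b⁆ = ⁅Du a, b⁆ + ⁅a, Du b⁆)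
    (hDvLeib : ∀ a b : FreeLieAlgebra K (Fin 2), Dv ⁅a, b⁆ = ⁅Dv a, b⁆ + ⁅a, Dv b⁆)
    (hDu : ∀ k : Fin 2, Du (FreeLieAlgebra.of K k) = ⁅FreeLieAlgebra.of K k, u k⁆)
    (hDv : ∀ k : Fin 2, Dv (FreeLieAlgebra.of K k) = ⁅FreeLieAlgebra.of K k, v k⁆)
    (ω : Fin 2 → FreeLieAlgebra K ((k : Fin 2) × (Fin (gg k) ⊕ Fin (gg k) ⊕ Fin (nn k))))
    (hω : ∀ k : Fin 2, ω k =
      (∑ i : Fin (gg k),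
        ⁅FreeLieAlgebra.of K (⟨k, Sum.inl i⟩ :
            (k : Fin 2) × (Fin (gg k) ⊕ Fin (gg k) ⊕ Fin (nn k))),
          FreeLieAlgebra.of K (⟨k, Sum.inr (Sum.inl i)⟩ :
            (k : Fin 2) × (Fin (gg k) ⊕ Fin (gg k) ⊕ Fin (nn k)))⁆) +
      ∑ j : Fin (nn k), FreeLieAlgebra.of K (⟨k, Sum.inr (Sum.inr j)⟩ :
            (k : Fin 2) × (Fin (gg k) ⊕ Fin (gg k) ⊕ Fin (nn k))))
    (s : FreeLieAlgebra K (Fin 2) →ₗ⁅K⁆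
      FreeLieAlgebra K ((k : Fin 2) × (Fin (gg k) ⊕ Fin (gg k) ⊕ Fin (nn k))))
    (hs : s = FreeLieAlgebra.lift K ω)
    (Pu Pv Pw : FreeLieAlgebra K ((k : Fin 2) × (Fin (gg k) ⊕ Fin (gg k) ⊕ Fin (nn k))) →ₗ[K]
      FreeLieAlgebra K ((k : Fin 2) × (Fin (gg k) ⊕ Fin (gg k) ⊕ Fin (nn k))))
    (hPuLeib : ∀ a b, Pu ⁅a, b⁆ = ⁅Pu a, b⁆ + ⁅a, Pu b⁆)
    (hPvLeib : ∀ a b, Pv ⁅a, b⁆ = ⁅Pv a, b⁆ + ⁅a, Pv b⁆)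
    (hPwLeib : ∀ a b, Pw ⁅a, b⁆ = ⁅Pw a, b⁆ + ⁅a, Pw b⁆)
    (hPu : ∀ t : (k : Fin 2) × (Fin (gg k) ⊕ Fin (gg k) ⊕ Fin (nn k)),
      Pu (FreeLieAlgebra.of K t) = ⁅FreeLieAlgebra.of K t, s (u t.1)⁆)
    (hPv : ∀ t : (k : Fin 2) × (Fin (gg k) ⊕ Fin (gg k) ⊕ Fin (nn k)),
      Pv (FreeLieAlgebra.of K t) = ⁅FreeLieAlgebra.of K t, s (v t.1)⁆)
    (hPw : ∀ t : (k : Fin 2) × (Fin (gg k) ⊕ Fin (gg k) ⊕ Fin (nn k)),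
      Pw (FreeLieAlgebra.of K t) =
        ⁅FreeLieAlgebra.of K t, s (Du (v t.1) - Dv (u t.1) + ⁅u t.1, v t.1⁆)⁆) :
    ∀ a, Pw a = Pu (Pv a) - Pv (Pu a) := by
  have key : ∀ (w : Fin 2 → FreeLieAlgebra K (Fin 2))
      (D : FreeLieAlgebra K (Fin 2) →ₗ[K] FreeLieAlgebra K (Fin 2))
      (P : FreeLieAlgebra K ((k : Fin 2) × (Fin (gg k) ⊕ Fin (gg k) ⊕ Fin (nn k))) →ₗ[K]
        FreeLieAlgebra K ((k : Fin 2) × (Fin (gg k) ⊕ Fin (gg k) ⊕ Fin (nn k)))),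
      (∀ a b, D ⁅a, b⁆ = ⁅D a, b⁆ + ⁅a, D b⁆) →
      (∀ k, D (FreeLieAlgebra.of K k) = ⁅FreeLieAlgebra.of K k, w k⁆) →
      (∀ a b, P ⁅a, b⁆ = ⁅P a, b⁆ + ⁅a, P b⁆) →
      (∀ t, P (FreeLieAlgebra.of K t) = ⁅FreeLieAlgebra.of K t, s (w t.1)⁆) →
      ∀ a, P (s a) = s (D a) := by
    intro w D P hDL hD hPL hP
    refine FreeLieAlgebra.derivation_comp_eq s D P hDL hPL fun k => ?_
    have hsk : s (FreeLieAlgebra.of K k) = ω k := by rw [hs, FreeLieAlgebra.lift_of_apply]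
    rw [hD, LieHom.map_lie, hsk, hω]
    exact derivation_sum_lie_add_sum P hPL _ _ _ _ (fun _ => hP _) (fun _ => hP _) (fun _ => hP _)
  have hu := key u Du Pu hDuLeib hDu hPuLeib hPu
  have hv := key v Dv Pv hDvLeib hDv hPvLeib hPv
  intro a
  induction a using FreeLieAlgebra.induction_of with
  | of t =>
    rw [hPw, hPu, hPv, hPuLeib, hPvLeib, hu, hv, hPu, hPv]
    simp only [map_add, map_sub, LieHom.map_lie, lie_add, lie_sub]
    rw [leibniz_lie (FreeLieAlgebra.of K t) (s (u t.1)) (s (v t.1)),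
      ← lie_skew (s (u t.1)) ⁅FreeLieAlgebra.of K t, s (v t.1)⁆]
    abel
  | zero => simp
  | add a b ha hb =>
    simp only [map_add, ha, hb]
    abel
  | smul r a ha => simp only [map_smul, ha, smul_sub]
  | lie a b ha hb =>
    simp only [hPwLeib, hPuLeib, hPvLeib, map_add, ha, hb, sub_lie, lie_sub]
    abel
end
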